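/- arXiv:2202.00635 — 3 statements merged into one kernel-verified Lean document; each statement's English description precedes it below -/
import Mathlib

section
/- For every A > 0 there exists a constant C_A > 0 such that for all x ≥ 2, all positive integers q with q ≤ (log x)^A, and all integers a with gcd(a, q) = 1, one has π(x; q, a) = (1/φ(q)) ∫₂ˣ dt/log t + O_A( x · exp(−C_A √(log x)) ), where the implied constant depends only on A. -/
open Real

/-- `π(x; q, a)`: the number of primes `p ≤ x` with `p ≡ a (mod q)`. -/
noncomputable def primeCountingMod (x : ℝ) (q : ℕ) (a : ℤ) : ℕ :=
  ((Finset.range (⌊x⌋₊ + 1)).filter (fun p : ℕ => p.Prime ∧ (p : ZMod q) = (a : ZMod q))).card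

namespace SiegelWalfisz

section ComplexAnalysis

open Complex Metric

/-- Holomorphic logarithm of a nonvanishing function on a disc, normalised at the centre. -/
lemma exists_log_on_ball {f : ℂ → ℂ} {c : ℂ} {R : ℝ} (hR : 0 < R)
    (hf : DifferentiableOn ℂ f (ball c R)) (h0 : ∀ z ∈ ball c R, f z ≠ 0) :
    ∃ h : ℂ → ℂ, h c = 0 ∧ (∀ z ∈ ball c R, HasDerivAt h (deriv f z / f z) z) ∧
      ∀ z ∈ ball c R, f z = f c * Complex.exp (h z) := by
  have hd : DifferentiableOn ℂ (fun z => deriv f z / f z) (ball c R) :=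
    (hf.deriv isOpen_ball).div hf h0
  obtain ⟨h, hhc, hh⟩ := IsExactOn.with_val_at hd.isExactOn_ball c 0
  refine ⟨h, hhc, hh, fun z hz => ?_⟩
  have hc : c ∈ ball c R := mem_ball_self hR
  have hder : ∀ w ∈ ball c R, HasDerivAt (fun w => f w * Complex.exp (-h w)) 0 w := by
    intro w hw
    have h1 : HasDerivAt f (deriv f w) w :=
      ((hf w hw).differentiableAt (isOpen_ball.mem_nhds hw)).hasDerivAt
    have := h0 w hw
    refine (h1.mul ((hh w hw).neg.cexp)).congr_deriv ?_
    field_simp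
    ring
  have := isOpen_ball.is_const_of_deriv_eq_zero (convex_ball c R).isPreconnected
    (fun w hw => (hder w hw).differentiableAt.differentiableWithinAt)
    (fun w hw => (hder w hw).deriv) hz hc
  simp only [hhc, neg_zero, Complex.exp_zero, mul_one] at this
  rw [← this, mul_assoc, ← Complex.exp_add]
  simp

/-- Borel–Carathéodory bound for the logarithmic derivative of a nonvanishing function. -/
lemma norm_logDeriv_le_of_ne_zero {f : ℂ → ℂ} {c : ℂ} {R M : ℝ} (hR : 0 < R) (hM : 0 ≤ M)
    (hf : DifferentiableOn ℂ f (ball c R)) (h0 : ∀ z ∈ ball c R, f z ≠ 0)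
    (hb : ∀ z ∈ ball c R, ‖f z‖ ≤ Real.exp M * ‖f c‖) {s : ℂ} (hs : dist s c ≤ R / 2) :
    ‖deriv f s / f s‖ ≤ 24 * M / R := by
  obtain ⟨h, hhc, hh, hexp⟩ := exists_log_on_ball hR hf h0
  have hc : c ∈ ball c R := mem_ball_self hR
  have hre : ∀ z ∈ ball c R, (h z).re ≤ M := by
    intro z hz
    have h1 := hb z hz
    rw [hexp z hz, norm_mul, Complex.norm_exp, mul_comm] at h1
    exact Real.exp_le_exp.mp (le_of_mul_le_mul_right h1 (norm_pos_iff.mpr (h0 c hc)))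
  have hsphere : ∀ z ∈ sphere s (R / 4), ‖h z‖ ≤ 6 * M := by
    intro z hz
    refine le_of_forall_pos_le_add fun ε hε => ?_
    have hzc : dist z c ≤ 3 * R / 4 := by
      have := dist_triangle z s c
      rw [mem_sphere] at hz
      linarith
    have hdiff : DifferentiableOn ℂ (fun w => h (c + w)) (ball 0 R) := by
      intro w hw
      have hw' : c + w ∈ ball c R := by simpa [mem_ball, dist_eq_norm] using hw
      exact ((hh _ hw').comp_const_add c w).differentiableAt.differentiableWithinAt
    have hzn : ‖z - c‖ ≤ 3 * R / 4 := by rwa [← dist_eq_norm]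
    have := borelCaratheodory_zero (f := fun w => h (c + w)) (M := M + ε / 6) (R := R) (z := z - c)
      (by positivity) hdiff ?_ hR ?_ (by simpa using hhc)
    · simp only [add_sub_cancel] at this
      refine this.trans ?_
      rw [div_le_iff₀ (by linarith)]
      nlinarith [norm_nonneg (z - c)]
    · intro w hw
      have hw' : c + w ∈ ball c R := by simpa [mem_ball, dist_eq_norm] using hw
      have := hre _ hw'
      simp only [Set.mem_ofPred_eq]
      linarith
    · simp only [mem_ball, dist_zero_right]; linarith
  have hsub : closedBall s (R / 4) ⊆ ball c R := by
    intro z hz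
    rw [mem_closedBall] at hz
    rw [mem_ball]
    have := dist_triangle z s c
    linarith
  have hsb : s ∈ ball c R := by rw [mem_ball]; linarith
  have := norm_deriv_le_of_forall_mem_sphere_norm_le (f := h) (c := s) (R := R / 4) (by positivity)
    (DifferentiableOn.diffContOnCl (s := ball s (R / 4)) (by
      rw [closure_ball s (by positivity)]
      exact fun z hz => (hh z (hsub hz)).differentiableAt.differentiableWithinAt)) hsphere
  rw [(hh s hsb).deriv] at this
  refine this.trans (le_of_eq ?_)
  field_simp
  ring

lemma exists_div_zero {f : ℂ → ℂ} (hf : Differentiable ℂ f) {c ρ : ℂ} (hρ : f ρ = 0)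
    (hc : f c ≠ 0) : ∃ g : ℂ → ℂ, Differentiable ℂ g ∧ (∀ z, f z = (1 - (z - c) / (ρ - c)) * g z) ∧
      g c = f c ∧ deriv f c / f c = deriv g c / g c + 1 / (c - ρ) := by
  have hne : ρ - c ≠ 0 := by
    intro h
    rw [sub_eq_zero] at h
    exact hc (h ▸ hρ)
  have hd : Differentiable ℂ (dslope f ρ) := by
    have := (differentiableOn_dslope (f := f) (s := Set.univ) (c := ρ) Filter.univ_mem).mpr
      hf.differentiableOn
    exact differentiableOn_univ.mp this
  have hfac : ∀ z, f z = (1 - (z - c) / (ρ - c)) * (-(ρ - c) * dslope f ρ z) := by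
    intro z
    have := sub_smul_dslope f ρ z
    rw [hρ, sub_zero, smul_eq_mul] at this
    rw [← this]
    field_simp
    ring
  have hgd : Differentiable ℂ (fun z => -(ρ - c) * dslope f ρ z) := hd.const_mul _
  have hgc : -(ρ - c) * dslope f ρ c = f c := by
    rw [hfac c]; simp
  refine ⟨fun z => -(ρ - c) * dslope f ρ z, hgd, hfac, hgc, ?_⟩
  simp only [hgc]
  have h1 : HasDerivAt (fun z : ℂ => 1 - (z - c) / (ρ - c)) (-(1 / (ρ - c))) c :=
    (((hasDerivAt_id c).sub_const c).div_const (ρ - c)).const_sub 1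
  have h2 := h1.mul (hgd c).hasDerivAt
  have hfe : f = (fun z => 1 - (z - c) / (ρ - c)) * fun z => -(ρ - c) * dslope f ρ z :=
    funext hfac
  rw [← hfe] at h2
  rw [h2.deriv, hgc]
  have : c - ρ ≠ 0 := by rw [← neg_sub]; exact neg_ne_zero.mpr hne
  simp only [sub_self]
  field_simp
  ring

lemma norm_div_zero_le {f g : ℂ → ℂ} (hg : Differentiable ℂ g) {c ρ : ℂ} {r B : ℝ} (hr : 0 < r)
    (hfg : ∀ z, f z = (1 - (z - c) / (ρ - c)) * g z) (hρc : ρ ≠ c) (hρ : dist ρ c ≤ r / 3)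
    (hb : ∀ z ∈ closedBall c r, ‖f z‖ ≤ B) : ∀ z ∈ closedBall c r, ‖g z‖ ≤ B / 2 := by
  intro z hz
  refine Complex.norm_le_of_forall_mem_frontier_norm_le (U := ball c r) isBounded_ball
    hg.diffContOnCl ?_ (by rwa [closure_ball c hr.ne'])
  intro w hw
  rw [frontier_ball c hr.ne', mem_sphere, dist_eq_norm] at hw
  have h1 := hb w (by rw [mem_closedBall, dist_eq_norm]; exact hw.le)
  rw [hfg w, norm_mul] at h1
  rw [dist_eq_norm] at hρ
  have hpos : 0 < ‖ρ - c‖ := norm_pos_iff.mpr (sub_ne_zero.mpr hρc)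
  have h2 : 2 ≤ ‖1 - (w - c) / (ρ - c)‖ := by
    have h3 : 3 ≤ ‖(w - c) / (ρ - c)‖ := by
      rw [norm_div, hw, le_div_iff₀ hpos]; linarith
    have h4 := norm_sub_norm_le ((w - c) / (ρ - c)) 1
    rw [norm_sub_rev] at h4
    simp only [norm_one] at h4
    linarith
  nlinarith [norm_nonneg (g w)]

/-- If an entire function has no zeros near `c` to the right of `c`, its logarithmic derivative
at `c` has real part bounded from below. -/
lemma re_logDeriv_ge {f : ℂ → ℂ} (hf : Differentiable ℂ f) {c : ℂ} {r M : ℝ} (hr : 0 < r)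
    (hM : 0 ≤ M) (hc : f c ≠ 0) (hb : ∀ z ∈ closedBall c r, ‖f z‖ ≤ Real.exp M * ‖f c‖)
    (hz : ∀ ρ ∈ ball c (r / 3), f ρ = 0 → ρ.re ≤ c.re) :
    -(72 * M / r) ≤ (deriv f c / f c).re := by
  obtain ⟨n, hn⟩ : ∃ n : ℕ, M < n * Real.log 2 := by
    obtain ⟨n, hn⟩ := exists_nat_gt (M / Real.log 2)
    exact ⟨n, (div_lt_iff₀ (Real.log_pos one_lt_two)).mp hn⟩
  induction n generalizing f M with
  | zero => simp at hn; linarith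
  | succ n ih =>
    by_cases hex : ∃ ρ ∈ ball c (r / 3), f ρ = 0
    · obtain ⟨ρ, hρb, hρ⟩ := hex
      have hρc : ρ ≠ c := fun h => hc (h ▸ hρ)
      obtain ⟨g, hg, hfg, hgc, hld⟩ := exists_div_zero hf hρ hc
      have hgb := norm_div_zero_le hg hr hfg hρc (mem_ball.mp hρb).le hb
      have hexp : Real.exp M * ‖f c‖ / 2 = Real.exp (M - Real.log 2) * ‖g c‖ := by
        rw [Real.exp_sub, Real.exp_log two_pos, hgc]; ring
      rw [hexp] at hgb
      have hgc0 : g c ≠ 0 := hgc ▸ hc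
      have hM2 : 0 ≤ M - Real.log 2 := by
        have h1 := hgb c (mem_closedBall_self hr.le)
        have h2 : 0 < ‖g c‖ := norm_pos_iff.mpr hgc0
        have h3 : 1 ≤ Real.exp (M - Real.log 2) := by
          by_contra hlt
          push Not at hlt
          nlinarith
        exact Real.one_le_exp_iff.mp h3
      have hlog : 0 < Real.log 2 := Real.log_pos one_lt_two
      have := ih hg hM2 hgc0 hgb
        (fun w hw hw0 => hz w hw (by rw [hfg w, hw0, mul_zero])) (by push_cast at hn; linarith)
      have hle : (72 * (M - Real.log 2) / r) ≤ 72 * M / r := by gcongr; linarith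
      have hre : 0 ≤ (1 / (c - ρ)).re := by
        rw [one_div, Complex.inv_re]
        have := hz ρ hρb hρ
        refine div_nonneg ?_ (Complex.normSq_nonneg _)
        simp only [Complex.sub_re]; linarith
      rw [hld, Complex.add_re]
      linarith
    · push Not at hex
      have h1 := norm_logDeriv_le_of_ne_zero (R := r / 3) (by positivity) hM hf.differentiableOn hex
        (fun z hz => hb z (by
          rw [mem_closedBall]; rw [mem_ball] at hz; linarith)) (s := c) (by
            rw [dist_self]; positivity)
      have h2 := Complex.abs_re_le_norm (deriv f c / f c)
      have h3 := neg_abs_le (deriv f c / f c).re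
      have h4 : 24 * M / (r / 3) = 72 * M / r := by field_simp; ring
      linarith

/-- As `re_logDeriv_ge`, keeping the contribution of one zero. -/
lemma re_logDeriv_ge_of_zero {f : ℂ → ℂ} (hf : Differentiable ℂ f) {c : ℂ} {r M : ℝ} (hr : 0 < r)
    (hM : 0 ≤ M) (hc : f c ≠ 0) (hb : ∀ z ∈ closedBall c r, ‖f z‖ ≤ Real.exp M * ‖f c‖)
    (hz : ∀ ρ ∈ ball c (r / 3), f ρ = 0 → ρ.re ≤ c.re) {ρ : ℂ} (hρ : f ρ = 0)
    (hρb : ρ ∈ ball c (r / 3)) :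
    (1 / (c - ρ)).re - 72 * M / r ≤ (deriv f c / f c).re := by
  have hρc : ρ ≠ c := fun h => hc (h ▸ hρ)
  obtain ⟨g, hg, hfg, hgc, hld⟩ := exists_div_zero hf hρ hc
  have hgb := norm_div_zero_le hg hr hfg hρc (mem_ball.mp hρb).le hb
  have := re_logDeriv_ge hg hr hM (hgc ▸ hc) (fun z hz => (hgb z hz).trans (by
    rw [hgc]; linarith [norm_nonneg (f c), mul_nonneg (Real.exp_pos M).le (norm_nonneg (f c))]))
    (fun w hw hw0 => hz w hw (by rw [hfg w, hw0, mul_zero]))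
  rw [hld, Complex.add_re]
  linarith

end ComplexAnalysis

section LFunctionBounds

open Complex Filter Topology MeasureTheory Asymptotics

variable {q : ℕ} [NeZero q]

/-- The mean value of a Dirichlet character. -/
noncomputable def charMean (χ : DirichletCharacter ℂ q) : ℝ :=
  open Classical in if χ = 1 then (q.totient : ℝ) / q else 0

lemma charMean_nonneg (χ : DirichletCharacter ℂ q) : 0 ≤ charMean χ := by
  unfold charMean; split_ifs <;> positivity

lemma charMean_le_one (χ : DirichletCharacter ℂ q) : charMean χ ≤ 1 := by
  unfold charMean
  split_ifs
  · exact div_le_one_of_le₀ (by exact_mod_cast q.totient_le) (by positivity)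
  · exact zero_le_one

/-- Deviation of the partial sums of a Dirichlet character from their mean. -/
noncomputable def charErr (χ : DirichletCharacter ℂ q) (t : ℝ) : ℂ :=
  ∑ k ∈ Finset.Icc 1 ⌊t⌋₊, χ (k : ZMod q) - charMean χ * t

lemma sum_range_char (χ : DirichletCharacter ℂ q) :
    ∑ k ∈ Finset.range q, χ (k : ZMod q) = charMean χ * q := by
  have h1 : ∑ k ∈ Finset.range q, χ (k : ZMod q) = ∑ a : ZMod q, χ a := by
    refine Finset.sum_bij (fun k _ => (k : ZMod q)) (fun _ _ => Finset.mem_univ _) ?_ ?_ ?_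
    · intro a ha b hb hab
      rw [ZMod.natCast_eq_natCast_iff'] at hab
      rwa [Nat.mod_eq_of_lt (Finset.mem_range.mp ha), Nat.mod_eq_of_lt (Finset.mem_range.mp hb)]
        at hab
    · intro b _
      exact ⟨b.val, Finset.mem_range.mpr b.val_lt, ZMod.natCast_zmod_val b⟩
    · intros; rfl
  have hq : (q : ℂ) ≠ 0 := NeZero.ne _
  rw [h1]
  unfold charMean
  split_ifs with h
  · rw [h, MulChar.sum_one_eq_card_units, ZMod.card_units_eq_totient]
    push_cast
    field_simp
  · rw [MulChar.sum_eq_zero_of_ne_one h]; simp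

omit [NeZero q] in
lemma norm_sum_char_le (χ : DirichletCharacter ℂ q) (N : ℕ) :
    ‖∑ k ∈ Finset.Icc 1 N, χ (k : ZMod q)‖ ≤ N := by
  refine (norm_sum_le _ _).trans ((Finset.sum_le_sum fun k _ => χ.norm_le_one _).trans ?_)
  simp

lemma norm_charErr_nat_le (χ : DirichletCharacter ℂ q) (N : ℕ) :
    ‖∑ k ∈ Finset.Icc 1 N, χ (k : ZMod q) - charMean χ * N‖ ≤ 2 * N := by
  refine (norm_sub_le _ _).trans ?_
  have h1 := norm_sum_char_le χ N
  have h2 : ‖((charMean χ : ℂ) * N)‖ ≤ N := by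
    rw [norm_mul, Complex.norm_natCast, Complex.norm_real, Real.norm_of_nonneg (charMean_nonneg χ)]
    exact mul_le_of_le_one_left (by positivity) (charMean_le_one χ)
  linarith

lemma charErr_nat_periodic (χ : DirichletCharacter ℂ q) :
    Function.Periodic (fun N : ℕ => ∑ k ∈ Finset.Icc 1 N, χ (k : ZMod q) - charMean χ * N) q := by
  intro N
  have hper : Function.Periodic (fun k : ℕ => χ ((k + 1 : ℕ) : ZMod q)) q := by
    intro k; simp [add_assoc, add_comm, add_left_comm]
  have key : ∀ M : ℕ, ∑ k ∈ Finset.Icc 1 M, χ (k : ZMod q) =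
      ∑ k ∈ Finset.range M, χ ((k + 1 : ℕ) : ZMod q) := by
    intro M
    rw [Finset.range_eq_Ico, Finset.sum_Ico_add' (fun k : ℕ => χ (k : ZMod q)) 0 M 1]
    rfl
  have h2 : ∑ k ∈ Finset.range q, χ ((k + 1 : ℕ) : ZMod q) = charMean χ * q := by
    rw [← sum_range_char χ]
    have := Finset.sum_range_succ' (fun k : ℕ => χ (k : ZMod q)) q
    rw [Finset.sum_range_succ] at this
    simpa using this.symm
  have h3 : ∀ M : ℕ, ∑ k ∈ Finset.range (M + q), χ ((k + 1 : ℕ) : ZMod q) =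
      ∑ k ∈ Finset.range M, χ ((k + 1 : ℕ) : ZMod q) + charMean χ * q := by
    intro M
    induction M with
    | zero => simpa using h2
    | succ M ih =>
      rw [show M + 1 + q = (M + q) + 1 by ring, Finset.sum_range_succ, ih, Finset.sum_range_succ]
      have := hper M
      simp only at this
      rw [this]; ring
  simp only [key, h3]
  push_cast
  ring

lemma norm_charErr_le (χ : DirichletCharacter ℂ q) {t : ℝ} (ht : 1 ≤ t) :
    ‖charErr χ t‖ ≤ 3 * t ∧ ‖charErr χ t‖ ≤ 3 * q := by
  have hfl : (⌊t⌋₊ : ℝ) ≤ t := Nat.floor_le (by linarith)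
  have hfl2 : t < ⌊t⌋₊ + 1 := Nat.lt_floor_add_one t
  have h1 : charErr χ t = (∑ k ∈ Finset.Icc 1 ⌊t⌋₊, χ (k : ZMod q) - charMean χ * (⌊t⌋₊ : ℕ)) -
      charMean χ * ((t - ⌊t⌋₊ : ℝ) : ℂ) := by
    unfold charErr; push_cast; ring
  have h2 : ‖(charMean χ : ℂ) * ((t - ⌊t⌋₊ : ℝ) : ℂ)‖ ≤ 1 := by
    rw [norm_mul, Complex.norm_real, Complex.norm_real, Real.norm_of_nonneg (charMean_nonneg χ),
      Real.norm_of_nonneg (by linarith)]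
    nlinarith [charMean_nonneg χ, charMean_le_one χ]
  have hq : (1 : ℝ) ≤ q := by exact_mod_cast NeZero.one_le
  have h3 : ‖∑ k ∈ Finset.Icc 1 ⌊t⌋₊, χ (k : ZMod q) - charMean χ * (⌊t⌋₊ : ℕ)‖ ≤ 2 * q := by
    have := (charErr_nat_periodic χ).map_mod_nat ⌊t⌋₊
    rw [← this]
    refine (norm_charErr_nat_le χ _).trans ?_
    have : ((⌊t⌋₊ % q : ℕ) : ℝ) ≤ q := by
      exact_mod_cast (Nat.mod_lt _ (NeZero.pos q)).le
    linarith
  have h4 := norm_charErr_nat_le χ ⌊t⌋₊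
  rw [h1]
  constructor <;> refine (norm_sub_le _ _).trans ?_ <;> linarith

lemma norm_charErr_le_rpow (χ : DirichletCharacter ℂ q) {t θ : ℝ} (ht : 1 ≤ t) (h0 : 0 ≤ θ)
    (h1 : θ ≤ 1) : ‖charErr χ t‖ ≤ 3 * (q : ℝ) ^ (1 - θ) * t ^ θ := by
  obtain ⟨ha, hb⟩ := norm_charErr_le χ ht
  have hq : (1 : ℝ) ≤ q := by exact_mod_cast NeZero.one_le
  have hx : ‖charErr χ t‖ / 3 ≤ t := by linarith
  have hy : ‖charErr χ t‖ / 3 ≤ q := by linarith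
  have h0' : 0 ≤ ‖charErr χ t‖ / 3 := by positivity
  have : ‖charErr χ t‖ / 3 ≤ (q : ℝ) ^ (1 - θ) * t ^ θ := by
    calc ‖charErr χ t‖ / 3 = (‖charErr χ t‖ / 3) ^ (1 - θ) * (‖charErr χ t‖ / 3) ^ θ := by
          rw [← Real.rpow_add_of_nonneg h0' (by linarith) h0]; simp
      _ ≤ _ := by gcongr
  linarith

/-- The error function cut off to `t > 1`. -/
noncomputable def charErrCut (χ : DirichletCharacter ℂ q) : ℝ → ℂ :=
  Set.indicator (Set.Ioi 1) (charErr χ)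

lemma norm_charErrCut_le (χ : DirichletCharacter ℂ q) {t θ : ℝ} (ht : 0 < t) (h0 : 0 ≤ θ)
    (h1 : θ ≤ 1) : ‖charErrCut χ t‖ ≤ 3 * (q : ℝ) ^ (1 - θ) * t ^ θ := by
  unfold charErrCut
  by_cases h : t ∈ Set.Ioi 1
  · rw [Set.indicator_of_mem h]
    exact norm_charErr_le_rpow χ (le_of_lt h) h0 h1
  · rw [Set.indicator_of_notMem h, norm_zero]; positivity

lemma measurable_charErrCut (χ : DirichletCharacter ℂ q) : Measurable (charErrCut χ) := by
  refine Measurable.indicator ?_ measurableSet_Ioi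
  unfold charErr
  refine Measurable.sub ?_ (by fun_prop)
  exact (measurable_from_nat (f := fun n : ℕ => ∑ k ∈ Finset.Icc 1 n, χ (k : ZMod q))).comp
    Nat.measurable_floor

lemma locallyIntegrableOn_charErrCut (χ : DirichletCharacter ℂ q) :
    LocallyIntegrableOn (charErrCut χ) (Set.Ioi 0) := by
  have hloc : LocallyIntegrableOn (fun _ : ℝ => 3 * (q : ℝ)) (Set.Ioi 0) :=
    (locallyIntegrable_const _).locallyIntegrableOn _
  refine hloc.mono (measurable_charErrCut χ).aestronglyMeasurable ?_
  refine (ae_of_all _ fun t => ?_)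
  unfold charErrCut
  by_cases h : t ∈ Set.Ioi 1
  · rw [Set.indicator_of_mem h]
    exact (norm_charErr_le χ (le_of_lt h)).2.trans (le_abs_self _)
  · rw [Set.indicator_of_notMem h, norm_zero]; positivity

/-- The Mellin transform giving the analytic continuation of the `L`-series. -/
noncomputable def charMellin (χ : DirichletCharacter ℂ q) (s : ℂ) : ℂ :=
  mellin (charErrCut χ) (-s)

lemma differentiableAt_charMellin (χ : DirichletCharacter ℂ q) {s : ℂ} (hs : 0 < s.re) :
    DifferentiableAt ℂ (charMellin χ) s := by
  have : DifferentiableAt ℂ (mellin (charErrCut χ)) (-s) := by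
    refine mellin_differentiableAt_of_isBigO_rpow (a := 0) (b := -s.re - 1)
      (locallyIntegrableOn_charErrCut χ) ?_ (by simpa using hs) ?_ (by simp)
    · refine IsBigO.of_bound (3 * q) ?_
      filter_upwards [eventually_gt_atTop 0] with t ht
      simpa using norm_charErrCut_le χ ht le_rfl zero_le_one
    · refine IsBigO.of_bound 1 ?_
      filter_upwards [Ioo_mem_nhdsGT (zero_lt_one (α := ℝ))] with t ht
      have : charErrCut χ t = 0 := Set.indicator_of_notMem (by simpa using ht.2.le) _
      rw [this, norm_zero]; positivity
  exact this.comp s differentiableAt_id.neg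

lemma charMellin_eq (χ : DirichletCharacter ℂ q) (s : ℂ) :
    charMellin χ s = ∫ t in Set.Ioi (1 : ℝ), charErr χ t * (t : ℂ) ^ (-(s + 1)) := by
  unfold charMellin mellin charErrCut
  rw [← integral_indicator measurableSet_Ioi, ← integral_indicator measurableSet_Ioi]
  congr 1
  funext t
  by_cases h : t ∈ Set.Ioi (1 : ℝ)
  · have h' : t ∈ Set.Ioi (0 : ℝ) := show (0 : ℝ) < t from lt_trans zero_lt_one h
    simp only [Set.indicator_of_mem h, Set.indicator_of_mem h', smul_eq_mul]
    rw [mul_comm, neg_add']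
  · have h' : ¬ 1 < t := h
    simp [Set.indicator_apply, h']

lemma integrableOn_charErr_mul (χ : DirichletCharacter ℂ q) {s : ℂ} (hs : 0 < s.re) :
    IntegrableOn (fun t : ℝ => charErr χ t * (t : ℂ) ^ (-(s + 1))) (Set.Ioi 1) := by
  have hi : IntegrableOn (fun t : ℝ => 3 * (q : ℝ) * t ^ (-s.re - 1)) (Set.Ioi 1) :=
    (integrableOn_Ioi_rpow_of_lt (by linarith) zero_lt_one).const_mul _
  refine Integrable.mono' hi ?_ ?_
  · refine AEStronglyMeasurable.mul ?_ ?_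
    · refine (measurable_charErrCut χ).aestronglyMeasurable.congr ?_
      filter_upwards [ae_restrict_mem measurableSet_Ioi] with t ht
      exact Set.indicator_of_mem ht _
    · refine ContinuousOn.aestronglyMeasurable (fun t ht => ?_) measurableSet_Ioi
      exact (Complex.continuousAt_ofReal_cpow_const t _
        (Or.inr (zero_lt_one.trans ht).ne')).continuousWithinAt
  · filter_upwards [ae_restrict_mem measurableSet_Ioi] with t ht
    have ht0 : 0 < t := zero_lt_one.trans ht
    rw [norm_mul, Complex.norm_cpow_eq_rpow_re_of_pos ht0]
    have : (-(s + 1)).re = -s.re - 1 := by simp; ring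
    rw [this]
    gcongr
    exact (norm_charErr_le χ (le_of_lt ht)).2

lemma norm_charMellin_le (χ : DirichletCharacter ℂ q) {s : ℂ} {θ : ℝ} (h0 : 0 ≤ θ) (h1 : θ ≤ 1)
    (hs : θ < s.re) : ‖charMellin χ s‖ ≤ 3 * (q : ℝ) ^ (1 - θ) / (s.re - θ) := by
  rw [charMellin_eq]
  have hlt : θ - s.re - 1 < -1 := by linarith
  have hi : IntegrableOn (fun t : ℝ => 3 * (q : ℝ) ^ (1 - θ) * t ^ (θ - s.re - 1)) (Set.Ioi 1) :=
    (integrableOn_Ioi_rpow_of_lt hlt zero_lt_one).const_mul _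
  refine (norm_integral_le_of_norm_le hi ?_).trans (le_of_eq ?_)
  · filter_upwards [ae_restrict_mem measurableSet_Ioi] with t ht
    have ht0 : 0 < t := zero_lt_one.trans ht
    rw [norm_mul, Complex.norm_cpow_eq_rpow_re_of_pos ht0]
    have : t ^ (θ - s.re - 1) = t ^ θ * t ^ (-(s + 1)).re := by
      rw [← Real.rpow_add ht0]; congr 1; simp; ring
    rw [this, ← mul_assoc]
    gcongr
    exact norm_charErr_le_rpow χ (le_of_lt ht) h0 h1
  · rw [integral_const_mul, integral_Ioi_rpow_of_lt hlt zero_lt_one]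
    rw [Real.one_rpow, show θ - s.re - 1 + 1 = -(s.re - θ) by ring, neg_div_neg_eq]
    ring

lemma LFunction_eq_of_one_lt_re (χ : DirichletCharacter ℂ q) {s : ℂ} (hs : 1 < s.re) :
    DirichletCharacter.LFunction χ s = charMean χ * s / (s - 1) + s * charMellin χ s := by
  rw [DirichletCharacter.LFunction_eq_LSeries χ hs, charMellin_eq]
  have hs0 : 0 < s.re := by linarith
  have hO : (fun n : ℕ ↦ ∑ k ∈ Finset.Icc 1 n, ‖χ ((k : ℕ) : ZMod q)‖) =O[atTop] fun n : ℕ ↦ (n : ℝ) ^ (1:ℝ) := by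
    refine IsBigO.of_bound 1 (Eventually.of_forall fun n => ?_)
    rw [Real.norm_of_nonneg (Finset.sum_nonneg fun _ _ => norm_nonneg _)]
    refine (Finset.sum_le_sum fun k _ => χ.norm_le_one _).trans ?_
    simp
  rw [LSeries_eq_mul_integral' (fun n : ℕ => χ (n : ZMod q)) zero_le_one hs hO]
  have hi2 : IntegrableOn (fun t : ℝ => (charMean χ : ℂ) * (t : ℂ) ^ (-s)) (Set.Ioi 1) :=
    (integrableOn_Ioi_cpow_of_lt (by simpa using hs) zero_lt_one).const_mul _
  have hval : ∫ t in Set.Ioi (1 : ℝ), (charMean χ : ℂ) * (t : ℂ) ^ (-s) = charMean χ / (s - 1) := by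
    rw [integral_const_mul, integral_Ioi_cpow_of_lt (by simpa using hs) zero_lt_one]
    rw [Complex.ofReal_one, Complex.one_cpow, show -s + 1 = -(s - 1) by ring, neg_div_neg_eq]
    ring
  have : ∫ t in Set.Ioi (1 : ℝ), (∑ k ∈ Finset.Icc 1 ⌊t⌋₊, χ (k : ZMod q)) * (t : ℂ) ^ (-(s + 1))
      = ∫ t in Set.Ioi (1 : ℝ), (charErr χ t * (t : ℂ) ^ (-(s + 1)) +
        (charMean χ : ℂ) * (t : ℂ) ^ (-s)) := by
    refine setIntegral_congr_fun measurableSet_Ioi fun t ht => ?_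
    have ht0 : (t : ℂ) ≠ 0 := by
      exact_mod_cast (zero_lt_one.trans ht).ne'
    have h1 : (t : ℂ) ^ (-s) = t * (t : ℂ) ^ (-(s + 1)) := by
      rw [show -s = 1 + (-(s + 1)) by ring, Complex.cpow_add _ _ ht0, Complex.cpow_one]
    simp only [charErr, h1]
    ring
  rw [this, integral_add (integrableOn_charErr_mul χ hs0) hi2, hval]
  ring

lemma eqOn_re_pos {P Q : ℂ → ℂ} (hP : DifferentiableOn ℂ P {s | 0 < s.re})
    (hQ : DifferentiableOn ℂ Q {s | 0 < s.re}) (h : ∀ s : ℂ, 1 < s.re → P s = Q s) :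
    Set.EqOn P Q {s | 0 < s.re} := by
  have ho : IsOpen {s : ℂ | 0 < s.re} := isOpen_lt continuous_const continuous_re
  refine (hP.analyticOnNhd ho).eqOn_of_preconnected_of_eventuallyEq (hQ.analyticOnNhd ho)
    (convex_halfSpace_re_gt 0).isPreconnected (z₀ := 2) (by simp) ?_
  have : {s : ℂ | 1 < s.re} ∈ 𝓝 (2 : ℂ) :=
    (isOpen_lt continuous_const continuous_re).mem_nhds (by simp)
  filter_upwards [this] with s hs using h s hs

lemma LFunction_eq (χ : DirichletCharacter ℂ q) {s : ℂ} (hs : 0 < s.re) (h1 : s ≠ 1 ∨ χ ≠ 1) :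
    DirichletCharacter.LFunction χ s = charMean χ * s / (s - 1) + s * charMellin χ s := by
  have hdm : DifferentiableOn ℂ (charMellin χ) {s | 0 < s.re} :=
    fun z hz => (differentiableAt_charMellin χ hz).differentiableWithinAt
  by_cases hχ : χ = 1
  · have hs1 : s ≠ 1 := h1.resolve_right (not_not.mpr hχ)
    subst hχ
    have := eqOn_re_pos (P := DirichletCharacter.LFunctionTrivChar₁ q)
      (Q := fun s => charMean (1 : DirichletCharacter ℂ q) * s +
      (s - 1) * (s * charMellin (1 : DirichletCharacter ℂ q) s))
      (DirichletCharacter.differentiable_LFunctionTrivChar₁ q).differentiableOn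
      (((differentiableOn_const _).mul differentiableOn_id).add
        ((differentiableOn_id.sub_const 1).mul (differentiableOn_id.mul hdm)))
      (fun z hz => ?_) hs
    · have hs1' : s - 1 ≠ 0 := sub_ne_zero.mpr hs1
      simp only [DirichletCharacter.LFunctionTrivChar₁, Function.update_of_ne hs1] at this
      rw [DirichletCharacter.LFunctionTrivChar] at this
      field_simp
      linear_combination this
    · have hz1 : z ≠ 1 := fun h => by simp [h] at hz
      have hz1' : z - 1 ≠ 0 := sub_ne_zero.mpr hz1
      simp only [DirichletCharacter.LFunctionTrivChar₁, Function.update_of_ne hz1]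
      rw [DirichletCharacter.LFunctionTrivChar, LFunction_eq_of_one_lt_re _ hz]
      field_simp
  · have hm : charMean χ = 0 := by simp [charMean, hχ]
    have := eqOn_re_pos (P := DirichletCharacter.LFunction χ) (Q := fun s => s * charMellin χ s)
      (DirichletCharacter.differentiable_LFunction hχ).differentiableOn
      (differentiableOn_id.mul hdm)
      (fun z hz => by rw [LFunction_eq_of_one_lt_re _ hz, hm]; simp) hs
    rw [this, hm]; simp

lemma norm_LFunction_sub_le (χ : DirichletCharacter ℂ q) {s : ℂ} {θ : ℝ} (h0 : 0 ≤ θ) (hθ : θ ≤ 1)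
    (hs : θ < s.re) (h1 : s ≠ 1 ∨ χ ≠ 1) :
    ‖DirichletCharacter.LFunction χ s - charMean χ * s / (s - 1)‖ ≤
      3 * (q : ℝ) ^ (1 - θ) * ‖s‖ / (s.re - θ) := by
  rw [LFunction_eq χ (h0.trans_lt hs) h1, add_sub_cancel_left, norm_mul]
  have := norm_charMellin_le χ h0 hθ hs
  calc _ ≤ ‖s‖ * (3 * (q : ℝ) ^ (1 - θ) / (s.re - θ)) := by gcongr
    _ = _ := by ring

/-- The entire function `L(s, χ)` for nontrivial `χ`, and `(s - 1) L(s, χ)` for trivial `χ`. -/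
noncomputable def entireL (χ : DirichletCharacter ℂ q) : ℂ → ℂ :=
  open Classical in
  if χ = 1 then DirichletCharacter.LFunctionTrivChar₁ q else DirichletCharacter.LFunction χ

lemma entireL_of_ne {χ : DirichletCharacter ℂ q} (hχ : χ ≠ 1) :
    entireL χ = DirichletCharacter.LFunction χ := by simp [entireL, hχ]

lemma entireL_one_apply {s : ℂ} (hs : s ≠ 1) :
    entireL (1 : DirichletCharacter ℂ q) s =
      (s - 1) * DirichletCharacter.LFunction (1 : DirichletCharacter ℂ q) s := by
  simp [entireL, DirichletCharacter.LFunctionTrivChar₁, Function.update_of_ne hs]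

lemma differentiable_entireL (χ : DirichletCharacter ℂ q) : Differentiable ℂ (entireL χ) := by
  by_cases hχ : χ = 1
  · simp only [entireL, hχ, if_true]
    exact DirichletCharacter.differentiable_LFunctionTrivChar₁ q
  · rw [entireL_of_ne hχ]; exact DirichletCharacter.differentiable_LFunction hχ

lemma entireL_ne_zero_of_one_le_re (χ : DirichletCharacter ℂ q) {s : ℂ} (hs : 1 ≤ s.re) :
    entireL χ s ≠ 0 := by
  by_cases hχ : χ = 1
  · subst hχ
    by_cases h1 : s = 1
    · subst h1
      simp only [entireL, if_true]
      exact DirichletCharacter.LFunctionTrivChar₁_apply_one_ne_zero q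
    · rw [entireL_one_apply h1]
      exact mul_ne_zero (sub_ne_zero.mpr h1)
        (DirichletCharacter.LFunction_ne_zero_of_one_le_re _ (.inr h1) hs)
  · rw [entireL_of_ne hχ]
    exact DirichletCharacter.LFunction_ne_zero_of_one_le_re _ (.inl hχ) hs

lemma entireL_one_eq {s : ℂ} (hs : 0 < s.re) :
    entireL (1 : DirichletCharacter ℂ q) s =
      charMean (1 : DirichletCharacter ℂ q) * s +
        (s - 1) * (s * charMellin (1 : DirichletCharacter ℂ q) s) := by
  have hdm : DifferentiableOn ℂ (charMellin (1 : DirichletCharacter ℂ q)) {s | 0 < s.re} :=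
    fun z hz => (differentiableAt_charMellin 1 hz).differentiableWithinAt
  refine eqOn_re_pos (P := entireL 1)
    (Q := fun s => charMean (1 : DirichletCharacter ℂ q) * s +
      (s - 1) * (s * charMellin (1 : DirichletCharacter ℂ q) s))
    (differentiable_entireL 1).differentiableOn
    (((differentiableOn_const _).mul differentiableOn_id).add
      ((differentiableOn_id.sub_const 1).mul (differentiableOn_id.mul hdm)))
    (fun z hz => ?_) hs
  have hz1 : z ≠ 1 := fun h => by simp [h] at hz
  have hz1' : z - 1 ≠ 0 := sub_ne_zero.mpr hz1
  rw [entireL_one_apply hz1, LFunction_eq_of_one_lt_re _ hz]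
  field_simp

lemma norm_entireL_le (χ : DirichletCharacter ℂ q) {s : ℂ} (hs : 1 / 2 ≤ s.re) :
    ‖entireL χ s‖ ≤ 7 * q * (‖s‖ + 1) ^ 2 := by
  have hq : (1 : ℝ) ≤ q := by exact_mod_cast NeZero.one_le
  have hpos : 0 < s.re := by linarith
  have hm : ‖charMellin χ s‖ ≤ 6 * q := by
    refine (norm_charMellin_le χ le_rfl zero_le_one hpos).trans ?_
    rw [sub_zero, sub_zero, Real.rpow_one, div_le_iff₀ hpos]
    nlinarith
  have hsn := norm_nonneg s
  have hmn := norm_nonneg (charMellin χ s)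
  by_cases hχ : χ = 1
  · have key : entireL χ s = charMean χ * s + (s - 1) * (s * charMellin χ s) := by
      subst hχ; exact entireL_one_eq hpos
    rw [key]
    refine (norm_add_le _ _).trans ?_
    rw [norm_mul, norm_mul, norm_mul, Complex.norm_real, Real.norm_of_nonneg (charMean_nonneg χ)]
    have h1 : ‖s - 1‖ ≤ ‖s‖ + 1 := by simpa using norm_sub_le s 1
    have h2 : charMean χ * ‖s‖ ≤ q * (‖s‖ + 1) ^ 2 := by
      have := charMean_le_one χ
      have h3 : charMean χ * ‖s‖ ≤ 1 * ‖s‖ := by gcongr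
      nlinarith
    have h3 : ‖s - 1‖ * (‖s‖ * ‖charMellin χ s‖) ≤ (‖s‖ + 1) * ((‖s‖ + 1) * (6 * q)) := by
      gcongr; linarith
    linarith
  · rw [entireL_of_ne hχ, LFunction_eq χ hpos (.inr hχ)]
    have hm0 : charMean χ = 0 := by simp [charMean, hχ]
    rw [hm0, Complex.ofReal_zero, zero_mul, zero_div, zero_add, norm_mul]
    have h3 : ‖s‖ * ‖charMellin χ s‖ ≤ (‖s‖ + 1) * (6 * q) := by gcongr; linarith
    have h4 : (‖s‖ + 1) * (6 * q) ≤ (‖s‖ + 1) ^ 2 * (7 * q) := by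
      gcongr ?_ * ?_
      · nlinarith
      · linarith
    linarith

end LFunctionBounds

section Estermann

open Complex Filter Topology

lemma iteratedDeriv_sub_one_inv_two (m : ℕ) :
    iteratedDeriv m (fun s : ℂ => (s - 1)⁻¹) 2 = (-1) ^ m * m.factorial := by
  have h1 := iteratedDeriv_comp_sub_const m (fun s : ℂ => s⁻¹) 1
  rw [h1, iteratedDeriv_eq_iterate]
  have h2 : deriv^[m] (fun s : ℂ => s⁻¹) (2 - 1) = _ := iter_deriv_inv (𝕜 := ℂ) m (2 - 1)
  simp only [h2]
  norm_num

/-- Estermann's lower bound for the residue of a Dirichlet series with nonnegative coefficients. -/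
lemma le_residue_of_nonneg {G : ℂ → ℂ} (hG : Differentiable ℂ G) {M : ℝ}
    (hM : ∀ z ∈ Metric.sphere (2 : ℂ) (4 / 3), ‖G z‖ ≤ M) (hM1 : ‖G 1‖ ≤ M)
    (hpos : ∀ m, 0 ≤ ((-1) ^ m * iteratedDeriv m (fun s => G s / (s - 1)) 2).re)
    {N : ℕ} (hN : N ≠ 0) {α : ℝ} (h1 : 19 / 20 ≤ α) (h2 : α < 1) (hα : 0 ≤ (G α).re) :
    (G 2).re ≤ (G 1).re * (2 - α) ^ N / (1 - α) + 30 * M * (63 / 80) ^ N := by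
  set P := dslope G 1 with hP
  set lam := (G 1).re with hlam
  have hM0 : 0 ≤ M := (norm_nonneg _).trans hM1
  have hPd : Differentiable ℂ P := by
    rw [← differentiableOn_univ]
    exact (Complex.differentiableOn_dslope univ_mem).mpr hG.differentiableOn
  have hPv : ∀ s : ℂ, s ≠ 1 → P s = G s / (s - 1) - G 1 * (s - 1)⁻¹ := by
    intro s hs
    rw [hP, dslope_of_ne _ hs, slope_def_field]
    ring
  have hPM : ∀ z ∈ Metric.sphere (2 : ℂ) (4 / 3), ‖P z‖ ≤ 6 * M := by
    intro z hz
    have hz2 : ‖z - 2‖ = 4 / 3 := by simpa [dist_eq_norm] using hz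
    have hz1 : 1 / 3 ≤ ‖z - 1‖ := by
      have := norm_sub_norm_le (z - 2) (-1)
      rw [norm_neg, norm_one, hz2, show z - 2 - -1 = z - 1 by ring] at this
      linarith
    have hne : z ≠ 1 := by rintro rfl; norm_num at hz1
    have : P z = (G z - G 1) / (z - 1) := by rw [hPv z hne]; ring
    rw [this, norm_div, div_le_iff₀ (by linarith)]
    have h3 := norm_sub_le (G z) (G 1)
    have h4 := hM z hz
    nlinarith
  set b : ℕ → ℝ := fun m => ((-1) ^ m * iteratedDeriv m P 2).re / m.factorial with hb
  have hfac : ∀ m : ℕ, (0 : ℝ) < m.factorial := fun m => by exact_mod_cast m.factorial_pos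
  have hbM : ∀ m, |b m| ≤ 6 * M * (3 / 4) ^ m := by
    intro m
    have := Complex.norm_iteratedDeriv_le_of_forall_mem_sphere_norm_le m (by norm_num)
      hPd.diffContOnCl hPM
    rw [hb]
    simp only
    rw [abs_div, abs_of_pos (hfac m), div_le_iff₀ (hfac m)]
    refine (Complex.abs_re_le_norm _).trans ?_
    rw [norm_mul, norm_pow, norm_neg, norm_one, one_pow, one_mul]
    refine this.trans (le_of_eq ?_)
    rw [show (3 / 4 : ℝ) = (4 / 3)⁻¹ by norm_num, inv_pow]
    ring
  have hblam : ∀ m, 0 ≤ b m + lam := by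
    intro m
    have hcd : ContDiffAt ℂ m (fun s : ℂ => (s - 1)⁻¹) 2 :=
      (contDiffAt_id.sub contDiffAt_const).inv (by norm_num)
    have hcd2 : ContDiffAt ℂ m (fun s : ℂ => G s / (s - 1)) 2 :=
      (hG.contDiff.contDiffAt).div (contDiffAt_id.sub contDiffAt_const) (by norm_num)
    have heq : P =ᶠ[𝓝 2] ((fun s => G s / (s - 1)) - fun s => G 1 * (s - 1)⁻¹) := by
      filter_upwards [isOpen_ne.mem_nhds (show (2 : ℂ) ≠ 1 by norm_num)] with s hs
      exact hPv s hs
    have h5 : iteratedDeriv m P 2 = iteratedDeriv m (fun s => G s / (s - 1)) 2 -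
        G 1 * ((-1) ^ m * m.factorial) := by
      rw [heq.iteratedDeriv_eq m, iteratedDeriv_sub hcd2 (contDiffAt_const.mul hcd),
        iteratedDeriv_const_mul_field, iteratedDeriv_sub_one_inv_two]
    have h6 : (-1) ^ m * iteratedDeriv m P 2 =
        (-1) ^ m * iteratedDeriv m (fun s => G s / (s - 1)) 2 - ((m.factorial : ℝ) : ℂ) * G 1 := by
      rw [h5, mul_sub]
      congr 1
      have : (-1 : ℂ) ^ m * (-1) ^ m = 1 := by rw [← mul_pow]; simp
      push_cast
      linear_combination (G 1 * m.factorial) * this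
    have h7 := hpos m
    simp only [hb]
    rw [h6, sub_re, re_ofReal_mul, sub_div, mul_div_cancel_left₀ _ (hfac m).ne']
    have := div_nonneg h7 (hfac m).le
    linarith
  set w := 2 - α with hw
  have hw0 : 0 < w := by linarith
  have hw1 : w ≤ 21 / 20 := by linarith
  have hsum : HasSum (fun m => b m * w ^ m) (P α).re := by
    have h8 := Complex.hasSum_taylorSeries_of_entire hPd 2 α
    convert! (Complex.hasSum_iff _ _ |>.mp h8).1 using 2 with m
    have : ((α : ℂ) - 2) ^ m = (-1) ^ m * ((w ^ m : ℝ) : ℂ) := by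
      rw [hw]; push_cast; rw [← mul_pow]; congr 1; ring
    simp only [smul_eq_mul, hb]
    rw [this, show (m.factorial : ℂ)⁻¹ * ((-1) ^ m * ((w ^ m : ℝ) : ℂ) * iteratedDeriv m P 2) =
      ((w ^ m / m.factorial : ℝ) : ℂ) * ((-1) ^ m * iteratedDeriv m P 2) by push_cast; ring,
      re_ofReal_mul]
    ring
  have hPα : (P α).re ≤ lam / (1 - α) := by
    have hne : (α : ℂ) ≠ 1 := by exact_mod_cast h2.ne
    have : P α = ((1 / (1 - α) : ℝ) : ℂ) * (G 1 - G α) := by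
      have : (1 : ℂ) - α ≠ 0 := sub_ne_zero.mpr hne.symm
      have : (α : ℂ) - 1 ≠ 0 := sub_ne_zero.mpr hne
      rw [hPv _ hne]; push_cast; field_simp; ring
    rw [this, re_ofReal_mul, sub_re, div_mul_eq_mul_div, one_mul]
    have : 0 < 1 - α := by linarith
    gcongr
    linarith
  have htail : -(30 * M * (63 / 80) ^ N) ≤ ∑' m, b (m + N) * w ^ (m + N) := by
    have hg := hasSum_geometric_of_lt_one (r := (63 / 80 : ℝ)) (by norm_num) (by norm_num)
    have hg2 := hg.mul_left (6 * M * (63 / 80) ^ N)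
    have h9 : ‖∑' m, b (m + N) * w ^ (m + N)‖ ≤ 6 * M * (63 / 80) ^ N * (1 - 63 / 80)⁻¹ := by
      refine tsum_of_norm_bounded hg2 fun m => ?_
      rw [norm_mul, Real.norm_eq_abs, norm_pow, Real.norm_of_nonneg hw0.le]
      calc |b (m + N)| * w ^ (m + N) ≤ 6 * M * (3 / 4) ^ (m + N) * (21 / 20) ^ (m + N) := by
            gcongr; exact hbM _
        _ = _ := by rw [mul_assoc, ← mul_pow, pow_add]; norm_num; ring
    have h10 : 6 * M * (63 / 80) ^ N * (1 - 63 / 80)⁻¹ ≤ 30 * M * (63 / 80) ^ N := by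
      have : 0 ≤ M * (63 / 80 : ℝ) ^ N := by positivity
      norm_num
      nlinarith
    have := neg_abs_le (∑' m, b (m + N) * w ^ (m + N))
    rw [← Real.norm_eq_abs] at this
    linarith
  have hsplit := hsum.summable.sum_add_tsum_nat_add N
  rw [hsum.tsum_eq] at hsplit
  have hfirst : (G 2).re - lam * ((w ^ N - 1) / (w - 1)) ≤ ∑ m ∈ Finset.range N, b m * w ^ m := by
    rw [← geom_sum_eq (by linarith), Finset.mul_sum, sub_le_iff_le_add, ← Finset.sum_add_distrib]
    have h0 : (G 2).re = b 0 * w ^ 0 + lam * w ^ 0 := by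
      have : P 2 = G 2 - G 1 := by rw [hPv 2 (by norm_num)]; norm_num
      simp [hb, this, hlam]
    rw [h0]
    refine Finset.single_le_sum (f := fun m => b m * w ^ m + lam * w ^ m) (fun m _ => ?_)
      (Finset.mem_range.mpr (Nat.pos_of_ne_zero hN))
    rw [← add_mul]
    exact mul_nonneg (hblam m) (by positivity)
  have hw3 : w - 1 = 1 - α := by rw [hw]; ring
  rw [hw3] at hfirst
  have : lam * w ^ N / (1 - α) = lam * ((w ^ N - 1) / (1 - α)) + lam / (1 - α) := by
    ring
  rw [this]
  linarith

end Estermann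

section RealCharacters

open Complex Filter Topology MeasureTheory ComplexOrder

variable {q : ℕ} [NeZero q]

omit [NeZero q] in
lemma conj_char {χ : DirichletCharacter ℂ q} (hχ : χ ^ 2 = 1) (a : ZMod q) :
    (starRingEnd ℂ) (χ a) = χ a := by
  have h1 : χ⁻¹ = χ := by
    rw [inv_eq_iff_mul_eq_one, ← sq, hχ]
  have := MulChar.star_apply' χ a
  rwa [h1] at this

lemma conj_charErr {χ : DirichletCharacter ℂ q} (hχ : χ ^ 2 = 1) (t : ℝ) :
    (starRingEnd ℂ) (charErr χ t) = charErr χ t := by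
  simp [charErr, conj_char hχ]

lemma conj_charMellin {χ : DirichletCharacter ℂ q} (hχ : χ ^ 2 = 1) (x : ℝ) :
    (starRingEnd ℂ) (charMellin χ x) = charMellin χ x := by
  rw [charMellin_eq, ← integral_conj]
  refine setIntegral_congr_fun measurableSet_Ioi fun t ht => ?_
  have ht0 : 0 ≤ t := (zero_lt_one.trans ht).le
  simp only [map_mul, conj_charErr hχ]
  rw [show -((x : ℂ) + 1) = ((-(x + 1) : ℝ) : ℂ) by push_cast; ring, ← ofReal_cpow ht0, conj_ofReal]

lemma entireL_im_eq_zero {χ : DirichletCharacter ℂ q} (hχ : χ ^ 2 = 1) {x : ℝ} (hx : 0 < x) :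
    (entireL χ x).im = 0 := by
  rw [← conj_eq_iff_im]
  by_cases h : χ = 1
  · subst h
    rw [entireL_one_eq (by simpa using hx)]
    simp [conj_charMellin hχ]
  · rw [entireL_of_ne h, LFunction_eq χ (by simpa using hx) (.inr h)]
    simp [conj_charMellin hχ]

omit [NeZero q] in
lemma char_apply_eq {χ : DirichletCharacter ℂ q} (hχ : χ ^ 2 = 1) (a : ZMod q) :
    χ a = 0 ∨ χ a = 1 ∨ χ a = -1 := by
  by_cases ha : IsUnit a
  · right
    have : χ a ^ 2 = 1 := by
      rw [← MulChar.pow_apply' _ two_ne_zero, hχ, MulChar.one_apply ha]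
    rcases mul_eq_zero.mp (show (χ a - 1) * (χ a + 1) = 0 by linear_combination this) with h | h
    · left; linear_combination h
    · right; linear_combination h
  · left; exact χ.map_nonunit ha

lemma re_entireL_two_ge {χ : DirichletCharacter ℂ q} (hχ : χ ^ 2 = 1) :
    7 / 20 ≤ (entireL χ 2).re := by
  have h1 : entireL χ 2 = DirichletCharacter.LFunction χ 2 := by
    by_cases h : χ = 1
    · subst h; rw [entireL_one_apply (by norm_num)]; norm_num
    · rw [entireL_of_ne h]
  have h2 : HasSum (fun n : ℕ => (χ n : ℂ) / (n : ℂ) ^ 2) (entireL χ 2) := by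
    rw [h1, DirichletCharacter.LFunction_eq_LSeries χ (by norm_num)]
    have hs : LSeriesSummable (fun n : ℕ => χ (n : ZMod q)) 2 :=
      (DirichletCharacter.LSeriesSummable_iff (NeZero.ne q) χ).mpr (by norm_num)
    have := hs.hasSum
    convert! this using 2 with n
    rcases eq_or_ne n 0 with rfl | hn
    · simp
    · rw [LSeries.term_of_ne_zero hn]; norm_cast
  have h3 := (Complex.hasSum_iff _ _ |>.mp h2).1.add hasSum_zeta_two
  have h4 : (2 : ℝ) ≤ (entireL χ 2).re + π ^ 2 / 6 := by
    refine le_trans ?_ (le_hasSum h3 1 fun n _ => ?_)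
    · norm_num
    · have h5 : ((χ n : ℂ) / (n : ℂ) ^ 2).re = (χ n).re / (n : ℝ) ^ 2 := by
        rw [← Complex.div_ofReal_re]; push_cast; rfl
      rw [h5, ← add_div]
      refine div_nonneg ?_ (by positivity)
      rcases char_apply_eq hχ n with h | h | h <;> rw [h] <;> norm_num
  have : π ^ 2 < 9.9 := by nlinarith [Real.pi_lt_d4, Real.pi_pos]
  linarith

/-- The product of the functions `entireL χ` over a finite set of characters. -/
noncomputable def prodL (S : Finset (DirichletCharacter ℂ q)) (s : ℂ) : ℂ :=
  ∏ χ ∈ S, entireL χ s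

lemma differentiable_prodL (S : Finset (DirichletCharacter ℂ q)) : Differentiable ℂ (prodL S) := by
  unfold prodL
  exact Differentiable.fun_finsetProd fun χ _ => differentiable_entireL χ

lemma prodL_im_eq_zero {S : Finset (DirichletCharacter ℂ q)} (hS : ∀ χ ∈ S, χ ^ 2 = 1) {x : ℝ}
    (hx : 0 < x) : (prodL S x).im = 0 := by
  rw [← conj_eq_iff_im]
  unfold prodL
  rw [map_prod]
  exact Finset.prod_congr rfl fun χ hχ => conj_eq_iff_im.mpr (entireL_im_eq_zero (hS χ hχ) hx)

lemma prodL_two_eq {S : Finset (DirichletCharacter ℂ q)} (hS : ∀ χ ∈ S, χ ^ 2 = 1) :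
    prodL S 2 = ((∏ χ ∈ S, (entireL χ 2).re : ℝ) : ℂ) := by
  rw [Complex.ofReal_prod]
  refine Finset.prod_congr rfl fun χ hχ => ?_
  refine Complex.ext (by simp) ?_
  simpa using entireL_im_eq_zero (hS χ hχ) (x := 2) (by norm_num)

lemma re_prodL_two_ge {S : Finset (DirichletCharacter ℂ q)} (hS : ∀ χ ∈ S, χ ^ 2 = 1)
    (hc : S.card ≤ 4) : 1 / 100 ≤ (prodL S 2).re := by
  rw [prodL_two_eq hS, ofReal_re]
  calc (1 / 100 : ℝ) ≤ (7 / 20) ^ 4 := by norm_num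
    _ ≤ (7 / 20) ^ S.card := pow_le_pow_of_le_one (by norm_num) (by norm_num) hc
    _ = ∏ χ ∈ S, (7 / 20 : ℝ) := by rw [Finset.prod_const]
    _ ≤ _ := Finset.prod_le_prod (fun _ _ => by norm_num) fun χ hχ => re_entireL_two_ge (hS χ hχ)

lemma prodL_div_eq {S : Finset (DirichletCharacter ℂ q)} (h1 : 1 ∈ S) {s : ℂ} (hs : s ≠ 1) :
    prodL S s / (s - 1) = ∏ χ ∈ S, DirichletCharacter.LFunction χ s := by
  unfold prodL
  rw [← Finset.mul_prod_erase S _ h1, ← Finset.mul_prod_erase S _ h1, entireL_one_apply hs,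
    mul_assoc, mul_div_cancel_left₀ _ (sub_ne_zero.mpr hs)]
  congr 1
  refine Finset.prod_congr rfl fun χ hχ => ?_
  rw [entireL_of_ne (Finset.ne_of_mem_erase hχ)]

/-- Coefficients of minus the logarithmic derivative of a product of `L`-functions. -/
noncomputable def prodCoeff (S : Finset (DirichletCharacter ℂ q)) : ℕ → ℂ :=
  ∑ χ ∈ S, (fun n : ℕ => χ (n : ZMod q)) * (fun n : ℕ => (ArithmeticFunction.vonMangoldt n : ℂ))

lemma deriv_prodL_div {S : Finset (DirichletCharacter ℂ q)} (h1 : 1 ∈ S) {s : ℂ} (hs : 1 < s.re) :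
    deriv (fun s => prodL S s / (s - 1)) s =
      -(prodL S s / (s - 1) * LSeries (prodCoeff S) s) := by
  have hs1 : s ≠ 1 := by rintro rfl; simp at hs
  have heq : (fun s => prodL S s / (s - 1)) =ᶠ[𝓝 s]
      fun s => ∏ χ ∈ S, DirichletCharacter.LFunction χ s := by
    filter_upwards [isOpen_ne.mem_nhds hs1] with z hz using prodL_div_eq h1 hz
  have hne : ∀ χ ∈ S, DirichletCharacter.LFunction χ s ≠ 0 := fun χ _ =>
    DirichletCharacter.LFunction_ne_zero_of_one_le_re χ (.inr hs1) hs.le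
  have h2 := logDeriv_prod (s := S) (f := fun χ => DirichletCharacter.LFunction χ) hne
    (fun χ _ => DirichletCharacter.differentiableAt_LFunction χ s (.inl hs1))
  have h3 : LSeries (prodCoeff S) s = -∑ χ ∈ S, logDeriv (DirichletCharacter.LFunction χ) s := by
    unfold prodCoeff
    rw [LSeries_sum fun χ _ => DirichletCharacter.LSeriesSummable_twist_vonMangoldt χ hs,
      ← Finset.sum_neg_distrib]
    refine Finset.sum_congr rfl fun χ _ => ?_
    have := DirichletCharacter.LSeries_twist_vonMangoldt_eq χ hs
    rw [logDeriv_apply, DirichletCharacter.deriv_LFunction_eq_deriv_LSeries χ hs,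
      DirichletCharacter.LFunction_eq_LSeries χ hs, ← neg_div]
    exact this
  rw [heq.deriv_eq, prodL_div_eq h1 hs1, h3, ← h2, logDeriv_apply]
  have : ∏ χ ∈ S, DirichletCharacter.LFunction χ s ≠ 0 := Finset.prod_ne_zero_iff.mpr hne
  field_simp

omit [NeZero q] in
lemma abscissa_prodCoeff (S : Finset (DirichletCharacter ℂ q)) :
    LSeries.abscissaOfAbsConv (prodCoeff S) < ((2 : ℝ) : EReal) := by
  have : LSeriesSummable (prodCoeff S) (3 / 2 : ℝ) :=
    LSeriesSummable.sum fun χ _ => DirichletCharacter.LSeriesSummable_twist_vonMangoldt χ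
      (by rw [ofReal_re]; norm_num)
  refine this.abscissaOfAbsConv_le.trans_lt ?_
  rw [ofReal_re]
  exact_mod_cast (by norm_num : (3 / 2 : ℝ) < 2)

lemma iteratedDeriv_prodL_alternating {S : Finset (DirichletCharacter ℂ q)} (h1 : 1 ∈ S)
    (hS : ∀ χ ∈ S, χ ^ 2 = 1) (hnn : ∀ a : ZMod q, 0 ≤ ∑ χ ∈ S, χ a) (m : ℕ) :
    0 ≤ (-1) ^ m * iteratedDeriv m (fun s => prodL S s / (s - 1)) 2 := by
  have hcoef : 0 ≤ prodCoeff S := by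
    intro n
    simp only [prodCoeff, Finset.sum_apply, Pi.mul_apply, ← Finset.sum_mul, Pi.zero_apply]
    exact mul_nonneg (hnn n) (by exact_mod_cast ArithmeticFunction.vonMangoldt_nonneg)
  have hH : ∀ k, 0 ≤ (-1) ^ k * iteratedDeriv k (LSeries (prodCoeff S)) 2 := fun k => by
    simpa using LSeries.iteratedDeriv_alternating hcoef (abscissa_prodCoeff S) k
  induction m using Nat.strong_induction_on with
  | _ m ih =>
    cases m with
    | zero =>
      simp only [pow_zero, one_mul, iteratedDeriv_zero]
      rw [prodL_two_eq hS]
      norm_num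
      rw [← Complex.ofReal_prod, Complex.zero_le_real]
      exact Finset.prod_nonneg fun χ hχ => by linarith [re_entireL_two_ge (hS χ hχ)]
    | succ m =>
      have hF : ContDiffAt ℂ m (fun s => prodL S s / (s - 1)) 2 :=
        ((differentiable_prodL S).contDiff.contDiffAt).div (contDiffAt_id.sub contDiffAt_const)
          (by norm_num)
      have hHc : ContDiffAt ℂ m (LSeries (prodCoeff S)) 2 :=
        (LSeries_analyticOnNhd (prodCoeff S) 2
          (by simpa using abscissa_prodCoeff S)).contDiffAt
      have heq : deriv (fun s => prodL S s / (s - 1)) =ᶠ[𝓝 2]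
          -((fun s => prodL S s / (s - 1)) * LSeries (prodCoeff S)) := by
        filter_upwards [(isOpen_lt continuous_const continuous_re).mem_nhds
          (show (1 : ℝ) < (2 : ℂ).re by simp)] with s hs
        exact deriv_prodL_div h1 hs
      rw [iteratedDeriv_succ', heq.iteratedDeriv_eq, iteratedDeriv_neg, iteratedDeriv_mul hF hHc,
        pow_succ, mul_neg_one, neg_mul_neg, Finset.mul_sum]
      refine Finset.sum_nonneg fun i hi => ?_
      have hi' : i ≤ m := by simpa [Nat.lt_succ_iff] using hi
      have := mul_nonneg (mul_nonneg (Nat.cast_nonneg (α := ℂ) (m.choose i))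
        (ih i (by omega))) (hH (m - i))
      convert! this using 1
      have : (-1 : ℂ) ^ m = (-1) ^ i * (-1) ^ (m - i) := by
        rw [← pow_add]; congr 1; omega
      rw [this]; ring

end RealCharacters

section Siegel

open Complex Filter Topology ComplexOrder

lemma exists_le_re_prodL_one : ∃ c : ℝ, 0 < c ∧ ∀ (q : ℕ) [NeZero q]
    (S : Finset (DirichletCharacter ℂ q)), 1 ∈ S → (∀ χ ∈ S, χ ^ 2 = 1) →
    (∀ a : ZMod q, 0 ≤ ∑ χ ∈ S, χ a) → S.card ≤ 4 → ∀ α : ℝ, 19 / 20 ≤ α → α < 1 →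
    0 ≤ (prodL S α).re →
    c * (1 - α) * (q : ℝ) ^ (-(20 * (1 - α))) ≤ (prodL S 1).re := by
  set K0 : ℝ := 5 * Real.log (6000 * 175 ^ 4) + 2 with hK0
  refine ⟨Real.exp (-K0) / 200, by positivity, ?_⟩
  intro q _ S h1 hS hnn hc α ha1 ha2 hα
  have hq : (1 : ℝ) ≤ q := by exact_mod_cast NeZero.one_le
  set M : ℝ := (175 * q) ^ 4 with hM
  have hbound : ∀ z : ℂ, 1 / 2 ≤ z.re → ‖z‖ ≤ 10 / 3 → ‖prodL S z‖ ≤ M := by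
    intro z hz hz2
    unfold prodL
    calc ‖∏ χ ∈ S, entireL χ z‖ = ∏ χ ∈ S, ‖entireL χ z‖ := norm_prod _ _
      _ ≤ ∏ χ ∈ S, (175 * q : ℝ) := by
          refine Finset.prod_le_prod (fun _ _ => norm_nonneg _) fun χ _ => ?_
          refine (norm_entireL_le χ hz).trans ?_
          have : (‖z‖ + 1) ^ 2 ≤ (10 / 3 + 1) ^ 2 := by gcongr
          nlinarith
      _ = (175 * q : ℝ) ^ S.card := by rw [Finset.prod_const]
      _ ≤ M := pow_le_pow_right₀ (by linarith) hc
  have hM1 : 1 ≤ M := one_le_pow₀ (by linarith)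
  set N : ℕ := ⌈5 * Real.log (6000 * M)⌉₊ + 1 with hN
  have hlogpos : 0 ≤ Real.log (6000 * M) := Real.log_nonneg (by linarith)
  have hN1 : 5 * Real.log (6000 * M) ≤ N := by
    rw [hN]; push_cast
    linarith [Nat.le_ceil (5 * Real.log (6000 * M))]
  have hN2 : (N : ℝ) ≤ 5 * Real.log (6000 * M) + 2 := by
    rw [hN]; push_cast
    linarith [Nat.ceil_lt_add_one (show 0 ≤ 5 * Real.log (6000 * M) by linarith)]
  have key := le_residue_of_nonneg (differentiable_prodL S) (M := M)
    (fun z hz => by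
      have hz2 : ‖z - 2‖ = 4 / 3 := by simpa [dist_eq_norm] using hz
      refine hbound z ?_ ?_
      · have := (Complex.abs_re_le_norm (z - 2))
        rw [hz2, sub_re, abs_le] at this
        have h2 : (2 : ℂ).re = 2 := rfl
        rw [h2] at this
        linarith [this.1]
      · have := norm_add_le (z - 2) 2
        rw [hz2, sub_add_cancel, Complex.norm_ofNat] at this
        linarith)
    (hbound 1 (by norm_num) (by norm_num))
    (fun m => (Complex.le_def.mp (iteratedDeriv_prodL_alternating h1 hS hnn m)).1)
    (N := N) (by omega) ha1 ha2 hα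
  have htail : 30 * M * (63 / 80 : ℝ) ^ N ≤ 1 / 200 := by
    have h3 : (63 / 80 : ℝ) ≤ Real.exp (-(1 / 5)) := by
      linarith [Real.add_one_le_exp (-(1 / 5 : ℝ))]
    have h4 : (63 / 80 : ℝ) ^ N ≤ (6000 * M)⁻¹ := by
      calc (63 / 80 : ℝ) ^ N ≤ Real.exp (-(1 / 5)) ^ N := by gcongr
        _ = Real.exp (-(N / 5)) := by rw [← Real.exp_nat_mul]; congr 1; ring
        _ ≤ Real.exp (-Real.log (6000 * M)) := by
            apply Real.exp_le_exp.mpr; linarith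
        _ = _ := by rw [Real.exp_neg, Real.exp_log (by linarith)]
    calc 30 * M * (63 / 80 : ℝ) ^ N ≤ 30 * M * (6000 * M)⁻¹ := by gcongr
      _ = 1 / 200 := by field_simp; norm_num
  have h2 := re_prodL_two_ge hS hc
  have hα' : 0 < 1 - α := by linarith
  have hmain : (1 - α) / 200 ≤ (prodL S 1).re * (2 - α) ^ N := by
    have h5 : 1 / 200 ≤ (prodL S 1).re * (2 - α) ^ N / (1 - α) := by linarith
    rw [le_div_iff₀ hα'] at h5
    linarith
  have hw : (2 - α) ^ N ≤ Real.exp K0 * (q : ℝ) ^ (20 * (1 - α)) := by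
    have h6 : (2 - α) ^ N ≤ Real.exp ((1 - α) * N) := by
      calc (2 - α) ^ N ≤ Real.exp (1 - α) ^ N := by
            have := Real.add_one_le_exp (1 - α)
            have h7 : 0 ≤ 2 - α := by linarith
            gcongr; linarith
        _ = _ := by rw [← Real.exp_nat_mul]; congr 1; ring
    refine h6.trans ?_
    rw [Real.rpow_def_of_pos (by linarith), ← Real.exp_add]
    apply Real.exp_le_exp.mpr
    have h8 : Real.log (6000 * M) = Real.log (6000 * 175 ^ 4) + 4 * Real.log q := by
      rw [hM, mul_pow, ← mul_assoc, Real.log_mul (by norm_num) (by positivity), Real.log_pow]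
      norm_num
    have h9 : (N : ℝ) ≤ K0 + 20 * Real.log q := by rw [hK0]; linarith
    have hK0pos : 0 ≤ K0 := by
      have : 0 ≤ Real.log (6000 * 175 ^ 4) := Real.log_nonneg (by norm_num)
      linarith
    nlinarith [Real.log_nonneg hq]
  have hlpos : 0 ≤ (prodL S 1).re := by
    by_contra! h
    have : 0 < (2 - α) ^ N := pow_pos (by linarith) _
    nlinarith
  have hfin : (1 - α) / 200 ≤ (prodL S 1).re * (Real.exp K0 * (q : ℝ) ^ (20 * (1 - α))) :=
    hmain.trans (by gcongr)
  have hX : 0 < Real.exp K0 * (q : ℝ) ^ (20 * (1 - α)) := by positivity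
  rw [← div_le_iff₀ hX] at hfin
  refine le_trans (le_of_eq ?_) hfin
  rw [Real.exp_neg, Real.rpow_neg (by linarith)]
  field_simp

variable {q : ℕ} [NeZero q]

lemma norm_LFunction_le_near_one {χ : DirichletCharacter ℂ q} (hχ : χ ≠ 1) {δ : ℝ} (h0 : 0 < δ)
    (h1 : δ ≤ 1) {s : ℂ} (hs : ‖s - 1‖ ≤ δ / 2) :
    ‖DirichletCharacter.LFunction χ s‖ ≤ 12 * (q : ℝ) ^ δ / δ := by
  have hre : 1 - δ / 2 ≤ s.re := by
    have := (abs_le.mp ((Complex.abs_re_le_norm (s - 1)).trans hs)).1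
    rw [sub_re, one_re] at this
    linarith
  have hn : ‖s‖ ≤ 2 := by
    have := norm_add_le (s - 1) 1
    rw [sub_add_cancel, norm_one] at this
    linarith
  have := norm_LFunction_sub_le χ (θ := 1 - δ) (by linarith) (by linarith) (by linarith)
    (s := s) (.inr hχ)
  rw [show charMean χ = 0 by simp [charMean, hχ]] at this
  simp only [ofReal_zero, zero_mul, zero_div, sub_zero, sub_sub_cancel] at this
  refine this.trans ?_
  have hd : δ / 2 ≤ s.re - (1 - δ) := by linarith
  calc _ ≤ 3 * (q : ℝ) ^ δ * 2 / (δ / 2) := by gcongr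
    _ = _ := by field_simp; ring

lemma LFunction_ne_zero_of_norm_one_ge {χ : DirichletCharacter ℂ q} (hχ : χ ≠ 1) {δ κ : ℝ}
    (h0 : 0 < δ) (h1 : δ ≤ 1) (hκ : 0 < κ)
    (hL : κ * (q : ℝ) ^ (-(22 * δ)) ≤ ‖DirichletCharacter.LFunction χ 1‖) {s : ℂ}
    (hs : ‖s - 1‖ ≤ min (δ / 4) (κ * δ ^ 2 / 96) * (q : ℝ) ^ (-(23 * δ))) :
    DirichletCharacter.LFunction χ s ≠ 0 := by
  have hq : (1 : ℝ) ≤ q := by exact_mod_cast NeZero.one_le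
  have hq0 : (0 : ℝ) < q := by linarith
  have hle1 : (q : ℝ) ^ (-(23 * δ)) ≤ 1 := Real.rpow_le_one_of_one_le_of_nonpos hq (by linarith)
  have hs1 : ‖s - 1‖ ≤ δ / 4 := by
    refine hs.trans ?_
    calc _ ≤ (δ / 4) * 1 := by gcongr; exact min_le_left _ _
      _ = _ := mul_one _
  have hs2 : ‖s - 1‖ ≤ κ * δ ^ 2 / 96 * (q : ℝ) ^ (-(23 * δ)) := by
    refine hs.trans ?_
    gcongr; exact min_le_right _ _
  have hmaps : Set.MapsTo (DirichletCharacter.LFunction χ) (Metric.ball 1 (δ / 2))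
      (Metric.closedBall (DirichletCharacter.LFunction χ 1) (24 * (q : ℝ) ^ δ / δ)) := by
    intro z hz
    rw [mem_closedBall_iff_norm]
    have hz' : ‖z - 1‖ ≤ δ / 2 := (mem_ball_iff_norm.mp hz).le
    have ha := norm_LFunction_le_near_one hχ h0 h1 hz'
    have hb := norm_LFunction_le_near_one hχ h0 h1 (s := 1) (by simp; positivity)
    refine (norm_sub_le _ _).trans ((add_le_add ha hb).trans (le_of_eq ?_))
    ring
  have hd := Complex.dist_le_div_mul_dist_of_mapsTo_ball (z := s)
    (DirichletCharacter.differentiable_LFunction hχ).differentiableOn hmaps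
    (by rw [mem_ball_iff_norm]; linarith)
  intro hzero
  rw [hzero, dist_eq_norm, zero_sub, norm_neg, dist_eq_norm] at hd
  have h3 : κ * (q : ℝ) ^ (-(22 * δ)) ≤
      24 * (q : ℝ) ^ δ / δ / (δ / 2) * (κ * δ ^ 2 / 96 * (q : ℝ) ^ (-(23 * δ))) :=
    hL.trans (hd.trans (by gcongr))
  have h4 : (q : ℝ) ^ (-(22 * δ)) = (q : ℝ) ^ δ * (q : ℝ) ^ (-(23 * δ)) := by
    rw [← Real.rpow_add hq0]; congr 1; ring
  have h5 : 24 * (q : ℝ) ^ δ / δ / (δ / 2) * (κ * δ ^ 2 / 96 * (q : ℝ) ^ (-(23 * δ))) =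
      κ * (q : ℝ) ^ (-(22 * δ)) / 2 := by
    rw [h4]; field_simp; norm_num
  rw [h5] at h3
  have : 0 < κ * (q : ℝ) ^ (-(22 * δ)) := by positivity
  linarith

lemma sum_pair_nonneg {χ : DirichletCharacter ℂ q} (h2 : χ ^ 2 = 1) (h1 : χ ≠ 1) (a : ZMod q) :
    0 ≤ ∑ ψ ∈ ({1, χ} : Finset (DirichletCharacter ℂ q)), ψ a := by
  rw [Finset.sum_pair h1.symm]
  by_cases ha : IsUnit a
  · rw [MulChar.one_apply ha]
    rcases char_apply_eq h2 a with h | h | h <;> rw [h] <;> norm_num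
  · simp [MulChar.map_nonunit _ ha]

lemma norm_entireL_one_one_le : ‖entireL (1 : DirichletCharacter ℂ q) 1‖ ≤ 1 := by
  rw [entireL_one_eq (by simp)]
  simp [abs_of_nonneg (charMean_nonneg _), charMean_le_one]

lemma prodL_pair {χ : DirichletCharacter ℂ q} (h1 : χ ≠ 1) (s : ℂ) :
    prodL {1, χ} s = entireL (1 : DirichletCharacter ℂ q) s * DirichletCharacter.LFunction χ s := by
  rw [prodL, Finset.prod_pair h1.symm, entireL_of_ne h1]

lemma norm_LFunction_one_ge_of_pair {c : ℝ} {δ : ℝ} (h0 : 0 < δ) (hδ : δ ≤ 1 / 20) (hc : 0 < c)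
    (hc' : ∀ (S : Finset (DirichletCharacter ℂ q)), 1 ∈ S → (∀ χ ∈ S, χ ^ 2 = 1) →
      (∀ a : ZMod q, 0 ≤ ∑ χ ∈ S, χ a) → S.card ≤ 4 → ∀ α : ℝ, 19 / 20 ≤ α → α < 1 →
      0 ≤ (prodL S α).re → c * (1 - α) * (q : ℝ) ^ (-(20 * (1 - α))) ≤ (prodL S 1).re)
    {χ : DirichletCharacter ℂ q} (h2 : χ ^ 2 = 1) (h1 : χ ≠ 1)
    (hpos : 0 ≤ (prodL {1, χ} ((1 - δ : ℝ) : ℂ)).re) :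
    c * δ * (q : ℝ) ^ (-(22 * δ)) ≤ ‖DirichletCharacter.LFunction χ 1‖ := by
  have hq : (1 : ℝ) ≤ q := by exact_mod_cast NeZero.one_le
  have := hc' {1, χ} (by simp) (by simp [h2]) (sum_pair_nonneg h2 h1)
    (Finset.card_le_two.trans (by norm_num)) (1 - δ) (by linarith) (by linarith) hpos
  rw [sub_sub_cancel] at this
  have h3 : (prodL {1, χ} 1).re ≤ ‖DirichletCharacter.LFunction χ 1‖ := by
    refine (Complex.re_le_norm _).trans ?_
    rw [prodL_pair h1, norm_mul]
    exact mul_le_of_le_one_left (norm_nonneg _) norm_entireL_one_one_le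
  refine le_trans ?_ (this.trans h3)
  gcongr
  all_goals first | exact hq | norm_num

lemma exists_zero_of_pair {δ : ℝ} (h0 : 0 < δ) (hδ : δ ≤ 1 / 20)
    {χ : DirichletCharacter ℂ q} (h2 : χ ^ 2 = 1)
    (hneg : (prodL {1, χ} ((1 - δ : ℝ) : ℂ)).re < 0) :
    ∃ β : ℝ, 1 - δ < β ∧ β < 1 ∧ prodL {1, χ} β = 0 := by
  have hS : ∀ ψ ∈ ({1, χ} : Finset (DirichletCharacter ℂ q)), ψ ^ 2 = 1 := by simp [h2]
  have hcont : ContinuousOn (fun x : ℝ => (prodL {1, χ} (x : ℂ)).re) (Set.Icc (1 - δ) 2) :=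
    (continuous_re.comp ((differentiable_prodL _).continuous.comp continuous_ofReal)).continuousOn
  have hp2 := re_prodL_two_ge hS (Finset.card_le_two.trans (by norm_num))
  obtain ⟨β, hβ, hβ0⟩ := intermediate_value_Ioo (by linarith) hcont
    (show (0 : ℝ) ∈ Set.Ioo _ _ from ⟨hneg, by push_cast; linarith⟩)
  have hz : prodL {1, χ} (β : ℂ) = 0 :=
    Complex.ext hβ0 (prodL_im_eq_zero hS (by linarith [hβ.1]))
  refine ⟨β, hβ.1, ?_, hz⟩
  by_contra! h
  refine Finset.prod_ne_zero_iff.mpr (fun ψ _ => ?_) hz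
  exact entireL_ne_zero_of_one_le_re ψ (by simpa using h)

lemma norm_LFunction_one_ge_of_zero {c : ℝ} {δ : ℝ} (h0 : 0 < δ) (hδ : δ ≤ 1 / 20) (hc : 0 < c)
    (hc' : ∀ (S : Finset (DirichletCharacter ℂ q)), 1 ∈ S → (∀ χ ∈ S, χ ^ 2 = 1) →
      (∀ a : ZMod q, 0 ≤ ∑ χ ∈ S, χ a) → S.card ≤ 4 → ∀ α : ℝ, 19 / 20 ≤ α → α < 1 →
      0 ≤ (prodL S α).re → c * (1 - α) * (q : ℝ) ^ (-(20 * (1 - α))) ≤ (prodL S 1).re)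
    {χ₁ χ₂ : DirichletCharacter ℂ q} (h1 : χ₁ ^ 2 = 1) (h1' : χ₁ ≠ 1) (h2 : χ₂ ^ 2 = 1)
    (h2' : χ₂ ≠ 1) (h12 : χ₁ ≠ χ₂) {β : ℝ} (hβ : 1 - δ < β) (hβ1 : β < 1)
    (hz : prodL {1, χ₁} β = 0) :
    c * (1 - β) * δ ^ 2 / 144 * (q : ℝ) ^ (-(22 * δ)) ≤ ‖DirichletCharacter.LFunction χ₂ 1‖ := by
  have hq : (1 : ℝ) ≤ q := by exact_mod_cast NeZero.one_le
  have hq0 : (0 : ℝ) < q := by linarith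
  have h3 : χ₁ * χ₂ ≠ 1 := by
    intro h
    apply h12
    have : χ₁ * (χ₁ * χ₂) = χ₁ := by rw [h, mul_one]
    rw [← mul_assoc, ← sq, h1, one_mul] at this
    exact this.symm
  have hd1 : χ₂ ≠ χ₁ * χ₂ := fun h => h1' (by simpa using h)
  have hd2 : χ₁ ≠ χ₁ * χ₂ := fun h => h2' (by simpa using h)
  have hprod : ∀ s, prodL {1, χ₁, χ₂, χ₁ * χ₂} s =
      prodL {1, χ₁} s * (DirichletCharacter.LFunction χ₂ s *
        DirichletCharacter.LFunction (χ₁ * χ₂) s) := by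
    intro s
    rw [prodL_pair h1', prodL, Finset.prod_insert, Finset.prod_insert, Finset.prod_pair hd1,
      entireL_of_ne h1', entireL_of_ne h2', entireL_of_ne h3]
    · ring
    · simp [h12, hd2]
    · simp [h1'.symm, h2'.symm, h3.symm]
  have hnn : ∀ a : ZMod q, 0 ≤ ∑ ψ ∈ ({1, χ₁, χ₂, χ₁ * χ₂} : Finset _), ψ a := by
    intro a
    rw [Finset.sum_insert (by simp [h1'.symm, h2'.symm, h3.symm]),
      Finset.sum_insert (by simp [h12, hd2]), Finset.sum_pair hd1]
    by_cases ha : IsUnit a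
    · rw [MulChar.one_apply ha, MulChar.mul_apply]
      rcases char_apply_eq h1 a with h | h | h <;> rcases char_apply_eq h2 a with h' | h' | h' <;>
        rw [h, h'] <;> norm_num
    · simp [MulChar.map_nonunit _ ha]
  have hcard : ({1, χ₁, χ₂, χ₁ * χ₂} : Finset (DirichletCharacter ℂ q)).card ≤ 4 :=
    Finset.card_le_four
  have key := hc' {1, χ₁, χ₂, χ₁ * χ₂} (by simp)
    (by simp [h1, h2, mul_pow]) hnn hcard β (by linarith) hβ1 (by rw [hprod, hz]; simp)
  have hup : (prodL {1, χ₁, χ₂, χ₁ * χ₂} 1).re ≤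
      (12 * (q : ℝ) ^ δ / δ) * (12 * (q : ℝ) ^ δ / δ) * ‖DirichletCharacter.LFunction χ₂ 1‖ := by
    refine (Complex.re_le_norm _).trans ?_
    rw [hprod, prodL_pair h1']
    simp only [norm_mul]
    have e1 := norm_entireL_one_one_le (q := q)
    have e2 := norm_LFunction_le_near_one h1' h0 (by linarith) (s := 1) (by simp; positivity)
    have e3 := norm_LFunction_le_near_one h3 h0 (by linarith) (s := 1) (by simp; positivity)
    calc _ ≤ 1 * (12 * (q : ℝ) ^ δ / δ) *
          (‖DirichletCharacter.LFunction χ₂ 1‖ * (12 * (q : ℝ) ^ δ / δ)) := by gcongr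
      _ = _ := by ring
  have h20 : (q : ℝ) ^ (-(20 * δ)) ≤ (q : ℝ) ^ (-(20 * (1 - β))) := by
    apply Real.rpow_le_rpow_of_exponent_le hq; linarith
  have hβ' : 0 < 1 - β := by linarith
  have hch : c * (1 - β) * (q : ℝ) ^ (-(20 * δ)) ≤
      (12 * (q : ℝ) ^ δ / δ) * (12 * (q : ℝ) ^ δ / δ) * ‖DirichletCharacter.LFunction χ₂ 1‖ :=
    le_trans (by gcongr) (key.trans hup)
  have hX : 0 < (12 * (q : ℝ) ^ δ / δ) * (12 * (q : ℝ) ^ δ / δ) := by positivity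
  rw [← div_le_iff₀' hX] at hch
  refine le_trans (le_of_eq ?_) hch
  have h4 : (q : ℝ) ^ (-(20 * δ)) = (q : ℝ) ^ δ * (q : ℝ) ^ δ * (q : ℝ) ^ (-(22 * δ)) := by
    rw [← Real.rpow_add hq0, ← Real.rpow_add hq0]; congr 1; ring
  rw [h4]
  field_simp
  norm_num

end Siegel

section SiegelTheorem

open Complex Filter Topology DirichletCharacter

lemma prod_euler_ne_zero {M N : ℕ} (χ : DirichletCharacter ℂ M) {s : ℂ} (hs : 0 < s.re) :
    ∏ p ∈ N.primeFactors, (1 - χ p * (p : ℂ) ^ (-s)) ≠ 0 := by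
  rw [Finset.prod_ne_zero_iff]
  intro p hp
  have hp' := Nat.prime_of_mem_primeFactors hp
  have h1 : ‖χ p * (p : ℂ) ^ (-s)‖ < 1 := by
    rw [norm_mul, Complex.norm_natCast_cpow_of_pos hp'.pos]
    have h2 : (p : ℝ) ^ (-s).re < 1 :=
      Real.rpow_lt_one_of_one_lt_of_neg (by exact_mod_cast hp'.one_lt) (by simpa using hs)
    have h3 := χ.norm_le_one p
    have h4 : 0 ≤ (p : ℝ) ^ (-s).re := by positivity
    nlinarith
  intro h
  rw [sub_eq_zero] at h
  rw [← h] at h1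
  simp at h1

lemma prodL_pair_changeLevel_eq_zero {M N : ℕ} [NeZero M] [NeZero N] (hMN : M ∣ N)
    {χ : DirichletCharacter ℂ M} (hχ : χ ≠ 1) {s : ℂ} (hs : s ≠ 1) (h : prodL {1, χ} s = 0) :
    prodL {1, changeLevel hMN χ} s = 0 := by
  have hχ' : changeLevel hMN χ ≠ 1 := hχ ∘ (changeLevel_eq_one_iff hMN).mp
  rw [prodL_pair hχ, entireL_one_apply hs] at h
  rw [prodL_pair hχ', entireL_one_apply hs, LFunction_changeLevel hMN χ (.inl hχ),
    ← changeLevel_one hMN, LFunction_changeLevel hMN 1 (.inr hs)]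
  linear_combination (∏ p ∈ N.primeFactors, (1 - (1 : DirichletCharacter ℂ M) p * (p : ℂ) ^ (-s))) *
    (∏ p ∈ N.primeFactors, (1 - χ p * (p : ℂ) ^ (-s))) * h

/-- **Siegel's theorem**, as a zero-free neighbourhood of `1`. -/
theorem exists_LFunction_ne_zero_near_one {ε : ℝ} (hε : 0 < ε) : ∃ c : ℝ, 0 < c ∧
    ∀ (q : ℕ) [NeZero q] (χ : DirichletCharacter ℂ q), χ ^ 2 = 1 → χ ≠ 1 →
    ∀ s : ℂ, ‖s - 1‖ ≤ c * (q : ℝ) ^ (-ε) → LFunction χ s ≠ 0 := by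
  set δ : ℝ := min (ε / 23) (1 / 20) with hδ
  have h0 : 0 < δ := by positivity
  have hδ1 : δ ≤ 1 / 20 := min_le_right _ _
  have hδε : 23 * δ ≤ ε := by
    have : δ ≤ ε / 23 := min_le_left _ _
    linarith
  obtain ⟨c, hc, hcQ⟩ := exists_le_re_prodL_one
  have hrp : ∀ (q : ℕ) [NeZero q], (q : ℝ) ^ (-ε) ≤ (q : ℝ) ^ (-(23 * δ)) := fun q _ =>
    Real.rpow_le_rpow_of_exponent_le (by exact_mod_cast NeZero.one_le) (by linarith)
  by_cases hcase : ∀ (q : ℕ) [NeZero q] (χ : DirichletCharacter ℂ q), χ ^ 2 = 1 → χ ≠ 1 →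
      0 ≤ (prodL {1, χ} ((1 - δ : ℝ) : ℂ)).re
  · refine ⟨min (δ / 4) (c * δ * δ ^ 2 / 96), by positivity, ?_⟩
    intro q _ χ h2 h1 s hs
    refine LFunction_ne_zero_of_norm_one_ge h1 h0 (by linarith) (mul_pos hc h0)
      (norm_LFunction_one_ge_of_pair h0 hδ1 hc (hcQ q) h2 h1 (hcase q χ h2 h1)) (hs.trans ?_)
    exact mul_le_mul_of_nonneg_left (hrp q) (by positivity)
  · push Not at hcase
    obtain ⟨q₁, hq₁, χ₁, h1, h1', hneg⟩ := hcase
    obtain ⟨β, hβ, hβ1, hz⟩ := exists_zero_of_pair h0 hδ1 h1 hneg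
    have hβ' : 0 < 1 - β := by linarith
    have hnhds : {s : ℂ | LFunction χ₁ s ≠ 0} ∈ 𝓝 (1 : ℂ) :=
      (isOpen_ne.preimage (differentiable_LFunction h1').continuous).mem_nhds
        (LFunction_ne_zero_of_one_le_re χ₁ (.inl h1') (by simp))
    obtain ⟨r, hr, hball⟩ := Metric.mem_nhds_iff.mp hnhds
    have hq₁1 : (1 : ℝ) ≤ q₁ := by exact_mod_cast NeZero.one_le
    set κ : ℝ := c * (1 - β) * δ ^ 2 / 144 with hκ
    have hκ0 : 0 < κ := by positivity
    set d : ℝ := min (δ / 4) (κ * δ ^ 2 / 96) with hd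
    refine ⟨min (min (r / 2) (1 / 2)) (d * (q₁ : ℝ) ^ (-(23 * δ))), by positivity, ?_⟩
    intro q _ χ₂ h2 h2' s hs
    have hQ1 : q₁ ∣ q₁ * q := dvd_mul_right _ _
    have hQ2 : q ∣ q₁ * q := dvd_mul_left _ _
    have hne1 : changeLevel hQ1 χ₁ ≠ 1 := h1' ∘ (changeLevel_eq_one_iff hQ1).mp
    have hne2 : changeLevel hQ2 χ₂ ≠ 1 := h2' ∘ (changeLevel_eq_one_iff hQ2).mp
    have hfac := LFunction_changeLevel hQ2 χ₂ (s := s) (.inl h2')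
    suffices LFunction (changeLevel hQ2 χ₂) s ≠ 0 by
      intro h
      rw [h, zero_mul] at hfac
      exact this hfac
    have hq1 : (1 : ℝ) ≤ q := by exact_mod_cast NeZero.one_le
    have hle1 : (q : ℝ) ^ (-ε) ≤ 1 := Real.rpow_le_one_of_one_le_of_nonpos hq1 (by linarith)
    by_cases h12 : changeLevel hQ1 χ₁ = changeLevel hQ2 χ₂
    · have hs' : ‖s - 1‖ ≤ min (r / 2) (1 / 2) := by
        refine hs.trans ?_
        calc _ ≤ min (r / 2) (1 / 2) * 1 :=
              mul_le_mul (min_le_left _ _) hle1 (by positivity) (by positivity)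
          _ = _ := mul_one _
      rw [← h12, LFunction_changeLevel hQ1 χ₁ (.inl h1')]
      refine mul_ne_zero (hball ?_) (prod_euler_ne_zero χ₁ ?_)
      · rw [mem_ball_iff_norm]
        linarith [min_le_left (r / 2) (1 / 2 : ℝ)]
      · have := (abs_le.mp ((Complex.abs_re_le_norm (s - 1)).trans hs')).1
        rw [sub_re, one_re] at this
        linarith [min_le_right (r / 2) (1 / 2 : ℝ)]
    · have hzQ := prodL_pair_changeLevel_eq_zero hQ1 h1'
        (by exact_mod_cast hβ1.ne) hz
      have hge := norm_LFunction_one_ge_of_zero h0 hδ1 hc (hcQ (q₁ * q))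
        (by rw [← map_pow, h1, map_one]) hne1 (by rw [← map_pow, h2, map_one]) hne2 h12 hβ hβ1 hzQ
      refine LFunction_ne_zero_of_norm_one_ge hne2 h0 (by linarith) hκ0 hge (hs.trans ?_)
      rw [Nat.cast_mul, Real.mul_rpow (by linarith) (by linarith), ← mul_assoc]
      exact mul_le_mul (min_le_right _ _) (hrp q) (by positivity) (by positivity)

end SiegelTheorem

section LogDeriv

open Complex Filter Topology DirichletCharacter
open ArithmeticFunction (vonMangoldt)

variable {q : ℕ} [NeZero q]

/-- The Dirichlet series `∑ χ(n) Λ(n) n⁻ˢ`. -/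
noncomputable def mangoldtL (χ : DirichletCharacter ℂ q) (s : ℂ) : ℂ :=
  LSeries (fun n : ℕ ↦ χ ((n : ℕ) : ZMod q) * (vonMangoldt n : ℂ)) s

lemma tsum_rpow_le {σ : ℝ} (h1 : 1 < σ) (h2 : σ ≤ 2) :
    ∑' n : ℕ, 1 / (n : ℝ) ^ σ ≤ 5 / (σ - 1) := by
  have hs : (1 : ℝ) < (σ : ℂ).re := by simpa using h1
  have hne : (σ : ℂ) ≠ 1 := by exact_mod_cast h1.ne'
  have h := norm_LFunction_sub_le (1 : DirichletCharacter ℂ 1) (θ := 0) le_rfl zero_le_one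
    (s := σ) (by simp; linarith) (.inl hne)
  have e : LFunction (1 : DirichletCharacter ℂ 1) (σ : ℂ) = ((∑' n : ℕ, 1 / (n : ℝ) ^ σ : ℝ) : ℂ) := by
    rw [LFunction_modOne_eq, zeta_eq_tsum_one_div_nat_cpow hs, Complex.ofReal_tsum]
    congr 1; ext n
    rw [Complex.ofReal_div, Complex.ofReal_cpow (by positivity)]; simp
  have hm := charMean_le_one (1 : DirichletCharacter ℂ 1)
  have hm0 := charMean_nonneg (1 : DirichletCharacter ℂ 1)
  rw [e] at h
  have h3 : (∑' n : ℕ, 1 / (n : ℝ) ^ σ) - charMean (1 : DirichletCharacter ℂ 1) * σ / (σ - 1) ≤ 3 := by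
    have : ((∑' n : ℕ, 1 / (n : ℝ) ^ σ) - charMean (1 : DirichletCharacter ℂ 1) * σ / (σ - 1) : ℝ) ≤
      ‖(((∑' n : ℕ, 1 / (n : ℝ) ^ σ) - charMean (1 : DirichletCharacter ℂ 1) * σ / (σ - 1) : ℝ) : ℂ)‖ := by
      rw [Complex.norm_real]; exact le_abs_self _
    refine this.trans ?_
    push_cast at h ⊢
    refine h.trans (le_of_eq ?_)
    rw [Complex.norm_real, Real.norm_of_nonneg (by linarith)]
    have : σ ≠ 0 := by linarith
    simp [this]
  have h4 : charMean (1 : DirichletCharacter ℂ 1) * σ / (σ - 1) ≤ σ / (σ - 1) := by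
    apply div_le_div_of_nonneg_right _ (by linarith)
    nlinarith
  have h5 : σ / (σ - 1) + 3 ≤ 5 / (σ - 1) := by
    rw [le_div_iff₀ (by linarith), add_mul, div_mul_cancel₀ _ (by linarith)]
    linarith
  linarith

lemma norm_LFunction_ge (χ : DirichletCharacter ℂ q) {s : ℂ} (h1 : 1 < s.re) (h2 : s.re ≤ 2) :
    (s.re - 1) / 5 ≤ ‖LFunction χ s‖ := by
  have h := DirichletCharacter.LSeries.mul_mu_eq_one χ h1
  rw [← LFunction_eq_LSeries χ h1] at h
  have hb : ‖LSeries ((fun n : ℕ ↦ χ n) * fun n : ℕ ↦ (ArithmeticFunction.moebius n : ℂ)) s‖ ≤ 5 / (s.re - 1) := by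
    refine le_trans ?_ (tsum_rpow_le h1 h2)
    have hsum : Summable fun n : ℕ ↦ 1 / (n : ℝ) ^ s.re := Real.summable_one_div_nat_rpow.mpr h1
    refine tsum_of_norm_bounded hsum.hasSum fun n ↦ ?_
    rcases Nat.eq_zero_or_pos n with rfl | hn
    · simp; positivity
    rw [LSeries.norm_term_eq, if_neg hn.ne']
    apply div_le_div_of_nonneg_right _ (by positivity)
    simp only [Pi.mul_apply, norm_mul]
    have ha := χ.norm_le_one (n : ZMod q)
    have hb : ‖((ArithmeticFunction.moebius n : ℤ) : ℂ)‖ ≤ 1 := by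
      rw [Complex.norm_intCast]; exact_mod_cast ArithmeticFunction.abs_moebius_le_one
    exact mul_le_one₀ ha (norm_nonneg _) hb
  have h3 : ‖LFunction χ s‖ * ‖LSeries ((fun n : ℕ ↦ χ n) * fun n : ℕ ↦ (ArithmeticFunction.moebius n : ℂ)) s‖ = 1 := by
    rw [← norm_mul, h, norm_one]
  have h4 : 1 ≤ ‖LFunction χ s‖ * (5 / (s.re - 1)) :=
    h3.symm.le.trans (mul_le_mul_of_nonneg_left hb (norm_nonneg _))
  rw [← mul_div_assoc, le_div_iff₀ (by linarith)] at h4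
  linarith

lemma norm_entireL_ge (χ : DirichletCharacter ℂ q) {s : ℂ} (h1 : 1 < s.re) (h2 : s.re ≤ 2) :
    (s.re - 1) ^ 2 / 5 ≤ ‖entireL χ s‖ := by
  have h := norm_LFunction_ge χ h1 h2
  by_cases hχ : χ = 1
  · subst hχ
    have hne : s ≠ 1 := by rintro rfl; simp at h1
    rw [entireL_one_apply hne, norm_mul]
    have : s.re - 1 ≤ ‖s - 1‖ := by simpa using Complex.re_le_norm (s - 1)
    have := mul_le_mul this h (by linarith) (norm_nonneg _)
    linarith
  · rw [entireL_of_ne hχ]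
    nlinarith

omit [NeZero q] in
lemma mangoldtL_summable (χ : DirichletCharacter ℂ q) {s : ℂ} (hs : 1 < s.re) :
    LSeriesSummable (fun n : ℕ ↦ χ ((n : ℕ) : ZMod q) * (vonMangoldt n : ℂ)) s :=
  LSeriesSummable_twist_vonMangoldt χ hs

lemma logDeriv_entireL (χ : DirichletCharacter ℂ q) {s : ℂ} (hs : 1 < s.re) :
    deriv (entireL χ) s / entireL χ s =
      -mangoldtL χ s + (if χ = 1 then 1 / (s - 1) else 0) := by
  have hne : s ≠ 1 := by rintro rfl; simp at hs
  have h : mangoldtL χ s = - deriv (LFunction χ) s / LFunction χ s := by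
    rw [deriv_LFunction_eq_deriv_LSeries χ hs, LFunction_eq_LSeries χ hs]
    exact LSeries_twist_vonMangoldt_eq χ hs
  rw [h]
  split_ifs with hχ
  · subst hχ
    have h1 : entireL (1 : DirichletCharacter ℂ q) =ᶠ[𝓝 s] fun z ↦ (z - 1) * LFunction (1 : DirichletCharacter ℂ q) z := by
      filter_upwards [isOpen_ne.mem_nhds hne] with z hz using entireL_one_apply hz
    have hL : LFunction (1 : DirichletCharacter ℂ q) s ≠ 0 := by
      have := entireL_ne_zero_of_one_le_re (1 : DirichletCharacter ℂ q) hs.le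
      rw [entireL_one_apply hne] at this
      exact right_ne_zero_of_mul this
    have hd : DifferentiableAt ℂ (LFunction (1 : DirichletCharacter ℂ q)) s :=
      differentiableAt_LFunction _ _ (.inl hne)
    rw [h1.deriv_eq, h1.eq_of_nhds]
    have : deriv (fun z ↦ (z - 1) * LFunction (1 : DirichletCharacter ℂ q) z) s =
        1 * LFunction (1 : DirichletCharacter ℂ q) s + (s - 1) * deriv (LFunction (1 : DirichletCharacter ℂ q)) s :=
      (((hasDerivAt_id s).sub_const 1).mul hd.hasDerivAt).deriv
    rw [this]
    have : s - 1 ≠ 0 := sub_ne_zero.mpr hne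
    field_simp
    ring
  · rw [entireL_of_ne hχ]; ring

lemma re_mangoldtL_three_four_one (χ : DirichletCharacter ℂ q) {σ t : ℝ} (hσ : 1 < σ) :
    0 ≤ 3 * (mangoldtL (1 : DirichletCharacter ℂ q) σ).re + 4 * (mangoldtL χ (σ + t * I)).re +
      (mangoldtL (χ ^ 2) (σ + 2 * t * I)).re := by
  have h0 := mangoldtL_summable (1 : DirichletCharacter ℂ q) (s := σ) (by simpa using hσ)
  have h1 := mangoldtL_summable χ (s := σ + t * I) (by simpa using hσ)
  have h2 := mangoldtL_summable (χ ^ 2) (s := σ + 2 * t * I) (by simpa using hσ)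
  have key : 0 ≤ (3 * mangoldtL (1 : DirichletCharacter ℂ q) σ + 4 * mangoldtL χ (σ + t * I) +
      mangoldtL (χ ^ 2) (σ + 2 * t * I)).re := by
    have := ((h0.hasSum.mul_left 3).add (h1.hasSum.mul_left 4)).add h2.hasSum
    refine (Complex.hasSum_re this).nonneg fun n ↦ ?_
    rcases Nat.eq_zero_or_pos n with rfl | hn
    · simp
    have hn0 : (n : ℂ) ≠ 0 := by exact_mod_cast hn.ne'
    have hΛ := ArithmeticFunction.vonMangoldt_nonneg (n := n)
    simp only [LSeries.term_of_ne_zero hn.ne']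
    by_cases hu : IsUnit ((n : ℕ) : ZMod q)
    · have e1 : (1 : DirichletCharacter ℂ q) ((n : ℕ) : ZMod q) = 1 := MulChar.one_apply hu
      have e2 : (χ ^ 2) ((n : ℕ) : ZMod q) = χ n ^ 2 := MulChar.pow_apply' _ two_ne_zero _
      have n1 : ‖χ ((n : ℕ) : ZMod q)‖ = 1 := by
        obtain ⟨u, hu⟩ := hu
        rw [← hu]; exact χ.unit_norm_eq_one u
      set z := χ ((n : ℕ) : ZMod q) * (n : ℂ) ^ (-(t * I)) with hz
      have nz : ‖z‖ = 1 := by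
        rw [hz, norm_mul, n1, Complex.norm_natCast_cpow_of_pos hn]; simp
      have hr : ((n : ℂ) ^ (σ : ℂ))⁻¹ = (((n : ℝ) ^ σ)⁻¹ : ℝ) := by
        rw [Complex.ofReal_inv, Complex.ofReal_cpow (by positivity)]; simp
      have t1 : χ ((n : ℕ) : ZMod q) * (vonMangoldt n : ℂ) / (n : ℂ) ^ ((σ : ℂ) + t * I) =
          ((vonMangoldt n * ((n : ℝ) ^ σ)⁻¹ : ℝ) : ℂ) * z := by
        rw [Complex.cpow_add _ _ hn0, hz, Complex.cpow_neg, Complex.ofReal_mul, ← hr]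
        field_simp
      have t2 : (χ ^ 2) ((n : ℕ) : ZMod q) * (vonMangoldt n : ℂ) / (n : ℂ) ^ ((σ : ℂ) + 2 * t * I) =
          ((vonMangoldt n * ((n : ℝ) ^ σ)⁻¹ : ℝ) : ℂ) * z ^ 2 := by
        have : (2 : ℂ) * t * I = (t * I) + t * I := by ring
        rw [this, Complex.cpow_add _ _ hn0, Complex.cpow_add _ _ hn0, hz, Complex.cpow_neg, Complex.ofReal_mul, ← hr, e2]
        field_simp
      have t0 : (1 : DirichletCharacter ℂ q) ((n : ℕ) : ZMod q) * (vonMangoldt n : ℂ) / (n : ℂ) ^ (σ : ℂ) =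
          ((vonMangoldt n * ((n : ℝ) ^ σ)⁻¹ : ℝ) : ℂ) := by
        rw [e1, Complex.ofReal_mul, ← hr]
        field_simp
      rw [t0, t1, t2]
      have : (3 * ((vonMangoldt n * ((n : ℝ) ^ σ)⁻¹ : ℝ) : ℂ) + 4 * (((vonMangoldt n * ((n : ℝ) ^ σ)⁻¹ : ℝ) : ℂ) * z)
          + ((vonMangoldt n * ((n : ℝ) ^ σ)⁻¹ : ℝ) : ℂ) * z ^ 2) =
          ((vonMangoldt n * ((n : ℝ) ^ σ)⁻¹ : ℝ) : ℂ) * (3 + 4 * z + z ^ 2) := by ring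
      rw [this, Complex.re_ofReal_mul]
      apply mul_nonneg (by positivity)
      have hsq : z.re ^ 2 + z.im ^ 2 = 1 := by
        have := Complex.sq_norm z
        rw [nz, Complex.normSq_apply] at this
        linarith
      have : (3 + 4 * z + z ^ 2).re = 2 * (1 + z.re) ^ 2 := by
        simp [pow_two]
        nlinarith
      rw [this]; positivity
    · rw [MulChar.map_nonunit _ hu, MulChar.map_nonunit _ hu, MulChar.map_nonunit _ hu]; simp
  simpa using key

end LogDeriv

section ZeroFree

open Complex Filter Topology DirichletCharacter Metric

variable {q : ℕ} [NeZero q]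

lemma norm_entireL_le_exp_mul (χ : DirichletCharacter ℂ q) {A B κ L : ℝ} (hA : 0 < A) (hL : 1 ≤ L)
    (hq : (q : ℝ) ≤ L ^ A) (hκ : 0 < κ) (hκ1 : κ ≤ 1) (hB : 0 ≤ B) (hκB : (κ ^ 2)⁻¹ ≤ Real.exp B)
    {c z : ℂ} (hre : c.re = 1 + κ / L) (him : |c.im| ≤ 2 * (Real.exp L + 1))
    (hz : dist z c ≤ 1 / 2) :
    ‖entireL χ z‖ ≤ Real.exp ((11 + A + B) * L) * ‖entireL χ c‖ := by
  have hL0 : 0 < L := by linarith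
  have hd0 : 0 < κ / L := by positivity
  have hd1 : κ / L ≤ 1 := by rw [div_le_one hL0]; linarith
  have hge := norm_entireL_ge χ (s := c) (by linarith) (by linarith)
  have hre' : c.re - 1 = κ / L := by linarith
  rw [hre'] at hge
  rw [dist_eq_norm] at hz
  have hzre : 1 / 2 ≤ z.re := by
    have := (abs_le.mp ((Complex.abs_re_le_norm (z - c)).trans hz)).1
    rw [Complex.sub_re] at this
    linarith
  have hup := norm_entireL_le χ hzre
  have he : (2.7 : ℝ) ≤ Real.exp L := by
    have := Real.exp_one_gt_d9
    have := Real.exp_le_exp.mpr hL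
    linarith
  have hzn : ‖z‖ + 1 ≤ 5 * Real.exp L := by
    have h1 : ‖z‖ ≤ ‖z - c‖ + ‖c‖ := by simpa using norm_add_le (z - c) c
    have h2 := Complex.norm_le_abs_re_add_abs_im c
    rw [hre, abs_of_pos (by linarith)] at h2
    linarith
  have hqe : (q : ℝ) ≤ Real.exp (A * L) := by
    refine hq.trans ?_
    rw [mul_comm, Real.exp_mul]
    exact Real.rpow_le_rpow hL0.le (by linarith [Real.add_one_le_exp L]) hA.le
  have h875 : (875 : ℝ) ≤ Real.exp (7 * L) := by
    have h7 : (875 : ℝ) ≤ Real.exp 1 ^ 7 := by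
      calc (875 : ℝ) ≤ 2.7 ^ 7 := by norm_num
        _ ≤ _ := by gcongr; linarith [Real.exp_one_gt_d9]
    rw [← Real.exp_nat_mul] at h7
    refine h7.trans (Real.exp_le_exp.mpr (by push_cast; linarith))
  have hL2 : L ^ 2 ≤ Real.exp L ^ 2 := by
    gcongr; linarith [Real.add_one_le_exp L]
  have hBL : (κ ^ 2)⁻¹ ≤ Real.exp (B * L) :=
    hκB.trans (Real.exp_le_exp.mpr (by nlinarith))
  have hM : Real.exp ((11 + A + B) * L) = Real.exp (7 * L) * Real.exp (A * L) * Real.exp L ^ 2 *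
      (Real.exp L ^ 2 * Real.exp (B * L)) := by
    rw [← Real.exp_nat_mul, ← Real.exp_add, ← Real.exp_add, ← Real.exp_add, ← Real.exp_add]
    congr 1; push_cast; ring
  have hprod : 875 * (q : ℝ) * Real.exp L ^ 2 * (L ^ 2 * (κ ^ 2)⁻¹) ≤ Real.exp ((11 + A + B) * L) := by
    rw [hM]
    gcongr
  calc ‖entireL χ z‖ ≤ 7 * q * (‖z‖ + 1) ^ 2 := hup
    _ ≤ 7 * q * (5 * Real.exp L) ^ 2 := by gcongr
    _ = 875 * (q : ℝ) * Real.exp L ^ 2 * (L ^ 2 * (κ ^ 2)⁻¹) * ((κ / L) ^ 2 / 5) := by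
        field_simp; ring
    _ ≤ _ := mul_le_mul hprod hge (by positivity) (by positivity)

lemma div_sub_le_of_zero (χ : DirichletCharacter ℂ q) {A B κ L : ℝ} (hA : 0 < A) (hL : 1 ≤ L)
    (hq : (q : ℝ) ≤ L ^ A) (hκ : 0 < κ) (hκ1 : κ ≤ 1) (hB : 0 ≤ B) (hκB : (κ ^ 2)⁻¹ ≤ Real.exp B)
    {ρ : ℂ} (hρ : entireL χ ρ = 0) (him : |ρ.im| ≤ Real.exp L + 1) (hre : 1 + κ / L - ρ.re < 1 / 6) :
    4 / (1 + κ / L - ρ.re) ≤ 3 / (κ / L) + 1152 * ((11 + A + B) * L) +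
      4 * (if χ = 1 then (1 / (κ / L + ρ.im * I)).re else 0) +
      (if χ ^ 2 = 1 then (1 / (κ / L + 2 * ρ.im * I)).re else 0) := by
  have hL0 : 0 < L := by linarith
  set d := κ / L with hd
  have hdc : ((d : ℝ) : ℂ) = (κ : ℂ) / L := by rw [hd]; push_cast; rfl
  rw [← hdc]
  have hd0 : 0 < d := by positivity
  have hM : 0 ≤ (11 + A + B) * L := by positivity
  have hρ1 : ρ.re < 1 := by
    by_contra! h
    exact entireL_ne_zero_of_one_le_re χ h hρ
  have growth : ∀ (ψ : DirichletCharacter ℂ q) (t : ℝ), |t| ≤ 2 * (Real.exp L + 1) →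
      ∀ z ∈ closedBall ((1 + d : ℝ) + t * I : ℂ) (1 / 2),
        ‖entireL ψ z‖ ≤ Real.exp ((11 + A + B) * L) * ‖entireL ψ ((1 + d : ℝ) + t * I : ℂ)‖ :=
    fun ψ t ht z hz ↦ norm_entireL_le_exp_mul ψ hA hL hq hκ hκ1 hB hκB (by simp [hd])
      (by simpa using ht) hz
  have nonv : ∀ (ψ : DirichletCharacter ℂ q) (t : ℝ), entireL ψ ((1 + d : ℝ) + t * I : ℂ) ≠ 0 :=
    fun ψ t ↦ entireL_ne_zero_of_one_le_re ψ (by simp; linarith)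
  have hzs : ∀ (ψ : DirichletCharacter ℂ q) (t : ℝ), ∀ z ∈ ball ((1 + d : ℝ) + t * I : ℂ) (1 / 2 / 3),
      entireL ψ z = 0 → z.re ≤ ((1 + d : ℝ) + t * I : ℂ).re := by
    intro ψ t z _ hz
    by_contra! h
    refine entireL_ne_zero_of_one_le_re ψ ?_ hz
    simp at h; linarith
  have base : ∀ (ψ : DirichletCharacter ℂ q) (t : ℝ),
      deriv (entireL ψ) ((1 + d : ℝ) + t * I : ℂ) / entireL ψ ((1 + d : ℝ) + t * I : ℂ) =
      -mangoldtL ψ ((1 + d : ℝ) + t * I : ℂ) + (if ψ = 1 then 1 / (d + t * I) else 0) := by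
    intro ψ t
    rw [logDeriv_entireL ψ (by simp; linarith)]
    congr 3
    push_cast; ring
  have b1 := re_logDeriv_ge (differentiable_entireL (1 : DirichletCharacter ℂ q)) (by norm_num) hM
    (nonv 1 0) (growth 1 0 (by simp; positivity)) (hzs 1 0)
  have b2 := re_logDeriv_ge_of_zero (differentiable_entireL χ) (by norm_num) hM
    (nonv χ ρ.im) (growth χ ρ.im (by linarith [abs_nonneg ρ.im])) (hzs χ ρ.im) hρ (by
      have : ρ - ((1 + d : ℝ) + ρ.im * I : ℂ) = ((ρ.re - (1 + d) : ℝ) : ℂ) := by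
        apply Complex.ext <;> simp
      rw [mem_ball, dist_eq_norm, this, Complex.norm_real, Real.norm_eq_abs, abs_lt]
      constructor <;> linarith)
  have b3 := re_logDeriv_ge (differentiable_entireL (χ ^ 2)) (by norm_num) hM
    (nonv (χ ^ 2) (2 * ρ.im)) (growth (χ ^ 2) (2 * ρ.im) (by
      rw [abs_mul, abs_two]; linarith)) (hzs (χ ^ 2) (2 * ρ.im))
  rw [base] at b1 b2 b3
  have h341 := re_mangoldtL_three_four_one χ (σ := 1 + d) (t := ρ.im) (by linarith)
  have e : ((1 + d : ℝ) + ρ.im * I - ρ : ℂ) = ((1 + d - ρ.re : ℝ) : ℂ) := by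
    apply Complex.ext <;> simp
  rw [e] at b2
  have e2 : (1 / ((1 + d - ρ.re : ℝ) : ℂ)).re = 1 / (1 + d - ρ.re) := by
    rw [← Complex.ofReal_one, ← Complex.ofReal_div, Complex.ofReal_re]
  rw [e2] at b2
  have e1 : (1 / ((d : ℝ) + (0 : ℝ) * I : ℂ)).re = 1 / d := by
    rw [Complex.ofReal_zero, zero_mul, add_zero, ← Complex.ofReal_one, ← Complex.ofReal_div, Complex.ofReal_re]
  have e0 : ((1 + d : ℝ) + (0 : ℝ) * I : ℂ) = ((1 + d : ℝ) : ℂ) := by simp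
  rw [if_pos rfl, Complex.add_re, e1, e0, Complex.neg_re] at b1
  rw [Complex.add_re, Complex.neg_re, apply_ite Complex.re, Complex.zero_re] at b2 b3
  push_cast at b1 b2 b3 h341 ⊢
  have r1 : 4 / (1 + d - ρ.re) = 4 * (1 / (1 + d - ρ.re)) := by ring
  have r2 : 3 / d = 3 * (1 / d) := by ring
  rw [r1, r2]
  linarith

lemma re_one_div_le {d t : ℝ} (hd : 0 < d) (ht : 4 * d ≤ |t|) :
    (1 / (d + t * I : ℂ)).re ≤ 1 / 17 * (1 / d) := by
  have h : d ^ 2 * 16 ≤ t ^ 2 := by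
    rw [← sq_abs t]; nlinarith
  rw [one_div, Complex.inv_re, Complex.normSq_apply]
  simp only [Complex.add_re, Complex.ofReal_re, Complex.mul_re, Complex.I_re, mul_zero,
    Complex.ofReal_im, Complex.I_im, mul_one, sub_self, add_zero, Complex.add_im, Complex.mul_im,
    zero_add]
  rw [← mul_div_assoc, mul_one, div_le_div_iff₀ (add_pos_of_pos_of_nonneg (by positivity) (mul_self_nonneg t)) hd]
  nlinarith

lemma exists_entireL_one_ne_zero_near_one : ∃ c : ℝ, 0 < c ∧ ∀ (q : ℕ) [NeZero q] (s : ℂ),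
    0 < s.re → ‖s - 1‖ ≤ c → entireL (1 : DirichletCharacter ℂ q) s ≠ 0 := by
  have h1 : entireL (1 : DirichletCharacter ℂ 1) 1 ≠ 0 :=
    entireL_ne_zero_of_one_le_re _ (by simp)
  have hc := (differentiable_entireL (1 : DirichletCharacter ℂ 1)).continuous.continuousAt (x := 1)
  obtain ⟨c, hc0, hc⟩ := Metric.eventually_nhds_iff_ball.mp (hc.eventually_ne h1)
  refine ⟨c / 2, by positivity, fun q _ s hs hsc ↦ ?_⟩
  by_cases hne : s = 1
  · subst hne; exact entireL_ne_zero_of_one_le_re _ (by simp)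
  have h2 := hc s (by rw [mem_ball, dist_eq_norm]; linarith)
  rw [entireL_one_apply hne] at h2 ⊢
  refine mul_ne_zero (left_ne_zero_of_mul h2) ?_
  rw [← changeLevel_one (one_dvd q), LFunction_changeLevel (one_dvd q) 1 (.inr hne)]
  exact mul_ne_zero (right_ne_zero_of_mul h2) (prod_euler_ne_zero _ hs)

/-- The zero-free region for Dirichlet `L`-functions of moduli `q ≤ L ^ A` up to height
`exp L`. -/
theorem exists_zero_free {A : ℝ} (hA : 0 < A) : ∃ η : ℝ, 0 < η ∧ η ≤ 1 / 10 ∧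
    ∀ (q : ℕ) [NeZero q] (χ : DirichletCharacter ℂ q) (L : ℝ), 1 ≤ L → (q : ℝ) ≤ L ^ A →
      ∀ s : ℂ, |s.im| ≤ Real.exp L + 1 → 1 - η / L ≤ s.re → entireL χ s ≠ 0 := by
  obtain ⟨c₀, hc₀, hS⟩ := exists_LFunction_ne_zero_near_one (ε := 1 / A) (by positivity)
  obtain ⟨c₁, hc₁, hT⟩ := exists_entireL_one_ne_zero_near_one
  obtain ⟨u, hu0, hu5, hu1, hu2, hu3⟩ : ∃ u : ℝ, 0 < u ∧ u ≤ 1 / 5 ∧ 5 * u ≤ c₀ ∧ 5 * u ≤ c₁ ∧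
      11520 * (15 + A) * u ≤ 1 := by
    refine ⟨min (min (1 / 5) (c₀ / 5)) (min (c₁ / 5) (1 / (11520 * (15 + A)))), by positivity, ?_, ?_, ?_, ?_⟩
    · exact (min_le_left _ _).trans (min_le_left _ _)
    · linarith [(min_le_left (min (1 / 5) (c₀ / 5)) (min (c₁ / 5) (1 / (11520 * (15 + A))))).trans (min_le_right _ _)]
    · linarith [(min_le_right (min (1 / 5) (c₀ / 5)) (min (c₁ / 5) (1 / (11520 * (15 + A))))).trans (min_le_left _ _)]
    · rw [mul_comm, ← le_div_iff₀ (by positivity)]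
      exact (min_le_right _ _).trans (min_le_right _ _)
  have huu : u ^ 2 ≤ u := by nlinarith
  refine ⟨u ^ 2 / 10, by positivity, by nlinarith, fun q _ χ L hL hq s him hre hs ↦ ?_⟩
  have hL0 : 0 < L := by linarith
  have hB : ((u ^ 2) ^ 2)⁻¹ ≤ Real.exp (4 / u) := by
    have h1 : u⁻¹ ≤ Real.exp u⁻¹ := by linarith [Real.add_one_le_exp u⁻¹]
    calc ((u ^ 2) ^ 2)⁻¹ = u⁻¹ ^ 4 := by field_simp
      _ ≤ Real.exp u⁻¹ ^ 4 := by gcongr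
      _ = _ := by rw [← Real.exp_nat_mul]; congr 1
  have hs1 : s.re < 1 := by
    by_contra! h
    exact entireL_ne_zero_of_one_le_re χ h hs
  set d := u ^ 2 / L with hd
  have hd0 : 0 < d := by positivity
  have hdu : d ≤ u ^ 2 := div_le_self (by positivity) hL
  have hre' : 1 - d / 10 ≤ s.re := by
    have : u ^ 2 / 10 / L = d / 10 := by rw [hd]; ring
    linarith
  have hmain := div_sub_le_of_zero χ (B := 4 / u) hA hL hq (by positivity : 0 < u ^ 2) (by nlinarith)
    (by positivity) hB hs him (by rw [← hd]; nlinarith)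
  rw [← hd] at hmain
  have hdc : ((u ^ 2 : ℝ) : ℂ) / L = ((d : ℝ) : ℂ) := by rw [hd]; push_cast; rfl
  rw [hdc] at hmain
  have hE : 1152 * ((11 + A + 4 / u) * L) ≤ 1 / 10 * (1 / d) := by
    have hLd : L = u ^ 2 * (1 / d) := by rw [hd]; field_simp
    rw [hLd]
    have : 1152 * ((11 + A + 4 / u) * (u ^ 2 * (1 / d))) =
      1152 * ((11 + A) * u ^ 2 + 4 * u) * (1 / d) := by field_simp
    rw [this]
    apply mul_le_mul_of_nonneg_right _ (by positivity)
    nlinarith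
  have hlow : 40 / 11 * (1 / d) ≤ 4 / (1 + d - s.re) := by
    rw [mul_one_div, div_div, div_le_div_iff₀ (by positivity) (by linarith)]
    linarith
  have h3 : 3 / d = 3 * (1 / d) := by ring
  rw [h3] at hmain
  have hp : 0 < 1 / d := by positivity
  by_cases h2 : χ ^ 2 = 1
  · by_cases hγ : 4 * d ≤ |s.im|
    · have g1 := re_one_div_le hd0 hγ
      have g2 := re_one_div_le (t := 2 * s.im) hd0 (by rw [abs_mul, abs_two]; linarith [abs_nonneg s.im])
      push_cast at g2
      rw [if_pos h2] at hmain
      split_ifs at hmain <;> linarith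
    · push Not at hγ
      have hn : ‖s - 1‖ ≤ 5 * d := by
        have := Complex.norm_le_abs_re_add_abs_im (s - 1)
        simp only [Complex.sub_re, Complex.one_re, Complex.sub_im, Complex.one_im, sub_zero] at this
        rw [abs_of_neg (by linarith)] at this
        linarith
      by_cases hχ : χ = 1
      · subst hχ
        exact hT q s (by nlinarith) (by nlinarith) hs
      · rw [entireL_of_ne hχ] at hs
        refine hS q χ h2 hχ s (hn.trans ?_) hs
        have hq0 : (0 : ℝ) < q := by exact_mod_cast NeZero.pos q
        have : 1 / L ≤ (q : ℝ) ^ (-(1 / A)) := by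
          rw [Real.rpow_neg hq0.le, one_div]
          apply inv_anti₀ (by positivity)
          calc (q : ℝ) ^ (1 / A) ≤ (L ^ A) ^ (1 / A) := Real.rpow_le_rpow hq0.le hq (by positivity)
            _ = L := by rw [← Real.rpow_mul hL0.le]; simp [hA.ne']
        calc 5 * d = 5 * u ^ 2 * (1 / L) := by rw [hd]; ring
          _ ≤ c₀ * (1 / L) := by gcongr; linarith
          _ ≤ _ := by gcongr
  · have hχ : χ ≠ 1 := by rintro rfl; simp at h2
    rw [if_neg h2, if_neg hχ] at hmain
    linarith

end ZeroFree

section LogDerivBound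

open Complex Filter Topology DirichletCharacter Metric

/-- Nonvanishing of the (completed) `L`-functions close to the line `re s = 1`, with a bound for
their logarithmic derivatives. -/
theorem exists_norm_logDeriv_entireL_le {A : ℝ} (hA : 0 < A) : ∃ κ : ℝ, 0 < κ ∧ κ ≤ 1 / 10 ∧
    ∃ K : ℝ, 0 < K ∧ ∀ (q : ℕ) [NeZero q] (χ : DirichletCharacter ℂ q) (L : ℝ), 1 ≤ L →
      (q : ℝ) ≤ L ^ A → ∀ s : ℂ, |s.im| ≤ Real.exp L → |s.re - 1| ≤ κ / L →
        entireL χ s ≠ 0 ∧ ‖deriv (entireL χ) s / entireL χ s‖ ≤ K * L ^ 2 := by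
  obtain ⟨η, hη, hη1, hz⟩ := exists_zero_free hA
  set κ := η / 3 with hκ
  have hκ0 : 0 < κ := by positivity
  refine ⟨κ, hκ0, by linarith, 6 * (11 + A + 2 / κ) / κ, by positivity,
    fun q _ χ L hL hq s him hre ↦ ?_⟩
  have hL0 : 0 < L := by linarith
  have hd : η / L = 3 * (κ / L) := by rw [hκ]; ring
  have hd0 : 0 < κ / L := by positivity
  have hd1 : κ / L ≤ κ := div_le_self hκ0.le hL
  rw [abs_le] at hre
  refine ⟨hz q χ L hL hq s (by linarith) (by linarith), ?_⟩
  set c : ℂ := ((1 + κ / L : ℝ) : ℂ) + s.im * I with hc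
  have hcre : c.re = 1 + κ / L := by rw [hc]; simp [-Complex.ofReal_div]
  have hcim : c.im = s.im := by rw [hc]; simp [-Complex.ofReal_div]
  have hB : (κ ^ 2)⁻¹ ≤ Real.exp (2 / κ) := by
    have h1 : κ⁻¹ ≤ Real.exp κ⁻¹ := by linarith [Real.add_one_le_exp κ⁻¹]
    calc (κ ^ 2)⁻¹ = κ⁻¹ ^ 2 := by field_simp
      _ ≤ Real.exp κ⁻¹ ^ 2 := by gcongr
      _ = _ := by rw [← Real.exp_nat_mul]; congr 1
  have hR : 4 * (κ / L) ≤ 1 / 2 := by linarith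
  have hsc : dist s c ≤ 4 * (κ / L) / 2 := by
    have : s - c = ((s.re - (1 + κ / L) : ℝ) : ℂ) := by
      apply Complex.ext <;> simp only [Complex.sub_re, Complex.sub_im, hcre, hcim] <;>
        simp only [Complex.ofReal_re, Complex.ofReal_im, sub_self]
    rw [dist_eq_norm, this, Complex.norm_real, Real.norm_eq_abs, abs_le]
    constructor <;> linarith
  have key := norm_logDeriv_le_of_ne_zero (f := entireL χ) (c := c) (R := 4 * (κ / L))
    (M := (11 + A + 2 / κ) * L) (by positivity) (by positivity)
    (differentiable_entireL χ).differentiableOn ?_ ?_ hsc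
  · refine key.trans (le_of_eq ?_)
    field_simp
    ring
  · intro z hz'
    rw [mem_ball, dist_eq_norm] at hz'
    have h1 := (Complex.abs_re_le_norm (z - c)).trans hz'.le
    have h2 := (Complex.abs_im_le_norm (z - c)).trans hz'.le
    rw [Complex.sub_re, hcre, abs_le] at h1
    rw [Complex.sub_im, hcim] at h2
    refine hz q χ L hL hq z ?_ (by linarith)
    have := abs_sub_abs_le_abs_sub z.im s.im
    linarith
  · intro z hz'
    rw [mem_ball] at hz'
    exact norm_entireL_le_exp_mul χ hA hL hq hκ0 (by linarith) (by positivity) hB hcre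
      (by rw [hcim]; linarith [Real.exp_pos L]) (by linarith)

end LogDerivBound

section MellinKernels

open Complex Filter Topology MeasureTheory Set

lemma norm_inv_mul_add_one_le {s : ℂ} (hs : 1 / 2 ≤ s.re) :
    ‖(s * (s + 1))⁻¹‖ ≤ 4 * (1 + s.im ^ 2)⁻¹ := by
  have h1 : (1 + s.im ^ 2) / 4 ≤ ‖s‖ ^ 2 := by
    rw [Complex.sq_norm, Complex.normSq_apply]; nlinarith
  have h2 : ‖s‖ ≤ ‖s + 1‖ := by
    rw [← sq_le_sq₀ (norm_nonneg _) (norm_nonneg _), Complex.sq_norm, Complex.sq_norm,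
      Complex.normSq_apply, Complex.normSq_apply]
    simp; nlinarith
  have h3 : (1 + s.im ^ 2) / 4 ≤ ‖s * (s + 1)‖ := by
    rw [norm_mul]; nlinarith [norm_nonneg s]
  rw [norm_inv]
  calc ‖s * (s + 1)‖⁻¹ ≤ ((1 + s.im ^ 2) / 4)⁻¹ := inv_anti₀ (by positivity) h3
    _ = _ := by field_simp

lemma norm_inv_mul_add_one_line_le {c : ℝ} (hc : 1 / 2 ≤ c) (t : ℝ) :
    ‖(((c : ℂ) + t * I) * ((c : ℂ) + t * I + 1))⁻¹‖ ≤ 4 * (1 + t ^ 2)⁻¹ := by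
  have := norm_inv_mul_add_one_le (s := (c : ℂ) + t * I) (by simpa using hc)
  simpa using this

lemma integral_cpow_neg_mul_of_hasMellin {f : ℝ → ℂ} {g : ℂ → ℂ} {c u C : ℝ} (hu : 0 < u)
    (hf : ∀ s : ℂ, s.re = c → HasMellin f s (g s)) (hfu : ContinuousAt f u)
    (hgc : Continuous fun t : ℝ ↦ g (c + t * I)) (hg : ∀ t : ℝ, ‖g (c + t * I)‖ ≤ C * (1 + t ^ 2)⁻¹) :
    ∫ t : ℝ, (u : ℂ) ^ (-((c : ℂ) + t * I)) * g (c + t * I) = 2 * π * f u := by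
  have hm : ∀ t : ℝ, mellin f (c + t * I) = g (c + t * I) := fun t ↦ (hf _ (by simp)).2
  have h := mellinInv_mellin_eq c f hu (hf c (by simp)).1 ?_ hfu
  · rw [mellinInv] at h
    simp only [hm, smul_eq_mul] at h
    rw [← h]
    rw [Complex.real_smul]
    push_cast
    rw [← mul_assoc, mul_one_div_cancel (by simp), one_mul]
  · unfold VerticalIntegrable
    simp only [hm]
    exact (integrable_inv_one_add_sq.const_mul C).mono' hgc.aestronglyMeasurable
      (.of_forall hg)

/-- Mellin inversion for the weight `max (1 - u) 0`. -/
lemma integral_cpow_neg_div {c u : ℝ} (hc : 1 / 2 ≤ c) (hu : 0 < u) :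
    ∫ t : ℝ, (u : ℂ) ^ (-((c : ℂ) + t * I)) * (((c : ℂ) + t * I) * (c + t * I + 1))⁻¹ =
      2 * π * (max (1 - u) 0 : ℝ) := by
  set f : ℝ → ℂ := fun t ↦ indicator (Ioc 0 1) (fun _ ↦ 1) t - indicator (Ioc 0 1) (fun t : ℝ ↦ (t : ℂ) ^ (1 : ℂ)) t
    with hf
  have hfv : ∀ t : ℝ, 0 < t → f t = (max (1 - t) 0 : ℝ) := by
    intro t ht
    by_cases h1 : t ≤ 1
    · have : t ∈ Ioc (0 : ℝ) 1 := ⟨ht, h1⟩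
      simp only [hf, indicator_of_mem this, Complex.cpow_one]
      rw [max_eq_left (by linarith)]; push_cast; rfl
    · have : t ∉ Ioc (0 : ℝ) 1 := fun h ↦ h1 h.2
      simp only [hf, indicator_of_notMem this]
      rw [max_eq_right (by linarith)]; simp
  have hcont : ContinuousAt f u := by
    have : (fun t : ℝ ↦ ((max (1 - t) 0 : ℝ) : ℂ)) =ᶠ[𝓝 u] f := by
      filter_upwards [lt_mem_nhds hu] with t ht using (hfv t ht).symm
    exact ContinuousAt.congr (by fun_prop) this
  rw [← hfv u hu]
  refine integral_cpow_neg_mul_of_hasMellin (f := f) (g := fun s ↦ (s * (s + 1))⁻¹) (C := 4) hu ?_ hcont ?_ ?_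
  · intro s hs
    have hs0 : s ≠ 0 := by rintro rfl; simp at hs; linarith
    have hs1 : s + 1 ≠ 0 := by
      intro h
      have := congrArg Complex.re h
      simp at this; linarith
    have a1 := hasMellin_one_Ioc (s := s) (by linarith)
    have a2 := hasMellin_cpow_Ioc 1 (s := s) (by simp; linarith)
    have := hasMellin_sub a1.1 a2.1
    rw [a1.2, a2.2] at this
    have e : 1 / s - 1 / (s + 1) = (s * (s + 1))⁻¹ := by field_simp; ring
    rwa [e] at this
  · have : ∀ t : ℝ, ((c : ℂ) + t * I) * (c + t * I + 1) ≠ 0 := by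
      intro t
      refine mul_ne_zero ?_ ?_ <;> intro h <;>
      · have := congrArg Complex.re h
        simp at this; linarith
    exact Continuous.inv₀ (by fun_prop) this
  · exact norm_inv_mul_add_one_line_le hc

/-- Mellin inversion for the weight `(1 - u) ^ 2 / (2 * u)` on `(0, 1)`. -/
lemma integral_cpow_neg_div_sub_one {c u : ℝ} (hc : 1 < c) (hu : 0 < u) (hu1 : u < 1) :
    ∫ t : ℝ, (u : ℂ) ^ (-((c : ℂ) + t * I)) *
      ((c + t * I - 1)⁻¹ * (((c : ℂ) + t * I) * (c + t * I + 1))⁻¹) =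
      2 * π * ((1 - u) ^ 2 / (2 * u) : ℝ) := by
  set f : ℝ → ℂ := fun t ↦ ((1 / 2 : ℂ) • indicator (Ioc 0 1) (fun t : ℝ ↦ (t : ℂ) ^ (-1 : ℂ)) t -
    indicator (Ioc 0 1) (fun _ ↦ 1) t) + (1 / 2 : ℂ) • indicator (Ioc 0 1) (fun t : ℝ ↦ (t : ℂ) ^ (1 : ℂ)) t
    with hf
  have hfv : ∀ t : ℝ, 0 < t → t < 1 → f t = ((1 - t) ^ 2 / (2 * t) : ℝ) := by
    intro t ht h1
    have : t ∈ Ioc (0 : ℝ) 1 := ⟨ht, h1.le⟩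
    simp only [hf, indicator_of_mem this, Complex.cpow_one, Complex.cpow_neg_one, smul_eq_mul]
    have : (t : ℂ) ≠ 0 := by exact_mod_cast ht.ne'
    push_cast
    field_simp
    ring
  have hcont : ContinuousAt f u := by
    have : (fun t : ℝ ↦ (((1 - t) ^ 2 / (2 * t) : ℝ) : ℂ)) =ᶠ[𝓝 u] f := by
      filter_upwards [lt_mem_nhds hu, gt_mem_nhds hu1] with t ht ht1 using (hfv t ht ht1).symm
    refine ContinuousAt.congr ?_ this
    refine Complex.continuous_ofReal.continuousAt.comp ?_
    exact ContinuousAt.div (by fun_prop) (by fun_prop) (by positivity)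
  rw [← hfv u hu hu1]
  have hne : ∀ s : ℂ, s.re = c → s ≠ 0 ∧ s + 1 ≠ 0 ∧ s - 1 ≠ 0 := by
    intro s hs
    refine ⟨?_, ?_, ?_⟩ <;> intro h <;>
    · have := congrArg Complex.re h
      simp at this; linarith
  refine integral_cpow_neg_mul_of_hasMellin (f := f) (g := fun s ↦ (s - 1)⁻¹ * (s * (s + 1))⁻¹)
    (C := (c - 1)⁻¹ * 4) hu ?_ hcont ?_ ?_
  · intro s hs
    obtain ⟨hs0, hs1, hs2⟩ := hne s hs
    have a1 := hasMellin_one_Ioc (s := s) (by linarith)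
    have a2 := hasMellin_cpow_Ioc 1 (s := s) (by simp; linarith)
    have a3 := hasMellin_cpow_Ioc (-1) (s := s) (by simp; linarith)
    have b2 := hasMellin_const_smul a2.1 (1 / 2 : ℂ)
    have b3 := hasMellin_const_smul a3.1 (1 / 2 : ℂ)
    have b4 := hasMellin_sub b3.1 a1.1
    have := hasMellin_add b4.1 b2.1
    rw [b4.2, b2.2, b3.2, a1.2, a2.2, a3.2] at this
    have e : (1 / 2 : ℂ) • (1 / (s + -1)) - 1 / s + (1 / 2 : ℂ) • (1 / (s + 1)) =
        (s - 1)⁻¹ * (s * (s + 1))⁻¹ := by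
      rw [← sub_eq_add_neg, smul_eq_mul, smul_eq_mul]
      field_simp; ring
    rwa [e] at this
  · refine Continuous.mul (Continuous.inv₀ (by fun_prop) fun t ↦ (hne _ (by simp)).2.2)
      (Continuous.inv₀ (by fun_prop) fun t ↦ ?_)
    exact mul_ne_zero (hne _ (by simp)).1 (hne _ (by simp)).2.1
  · intro t
    rw [norm_mul, mul_assoc]
    refine mul_le_mul ?_ (norm_inv_mul_add_one_line_le (by linarith) t) (norm_nonneg _) (by
      have : 0 < c - 1 := by linarith
      positivity)
    rw [norm_inv]
    apply inv_anti₀ (by linarith)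
    simpa using Complex.re_le_norm ((c : ℂ) + t * I - 1)

lemma setIntegral_inv_one_add_sq_compl_le {T : ℝ} (hT : 0 < T) :
    ∫ t in (Ioc (-T) T)ᶜ, (1 + t ^ 2)⁻¹ ≤ 2 / T := by
  have hc : (Ioc (-T) T)ᶜ = Iic (-T) ∪ Ioi T := by
    ext t; simp only [mem_compl_iff, mem_Ioc, mem_union, mem_Iic, mem_Ioi]
    grind
  rw [hc, setIntegral_union (by rw [Set.disjoint_left]; intro t h1 h2; simp at h1 h2; linarith) measurableSet_Ioi
    integrable_inv_one_add_sq.integrableOn integrable_inv_one_add_sq.integrableOn,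
    integral_Iic_inv_one_add_sq, integral_Ioi_inv_one_add_sq, Real.arctan_neg]
  have h1 := Real.arctan_inv_of_pos hT
  have h2 : Real.arctan T⁻¹ ≤ T⁻¹ := by
    have := Real.le_tan (Real.arctan_nonneg.mpr (by positivity : 0 ≤ T⁻¹)) (Real.arctan_lt_pi_div_two _)
    rwa [Real.tan_arctan] at this
  have : 2 / T = T⁻¹ + T⁻¹ := by ring
  linarith

end MellinKernels

section ExplicitFormula

open Complex Filter Topology DirichletCharacter MeasureTheory Set
open ArithmeticFunction (vonMangoldt)

variable {q : ℕ} [NeZero q]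

/-- The Cesàro-smoothed sum `∑_{n ≤ x} χ(n) Λ(n) (1 - n / x)`. -/
noncomputable def smoothPsi (χ : DirichletCharacter ℂ q) (x : ℝ) : ℂ :=
  ∑ n ∈ Finset.range (⌊x⌋₊ + 1), χ ((n : ℕ) : ZMod q) * (vonMangoldt n : ℂ) * ((1 - n / x : ℝ) : ℂ)

omit [NeZero q] in
lemma norm_term_mangoldt_le (χ : DirichletCharacter ℂ q) (s : ℂ) (n : ℕ) :
    ‖LSeries.term (fun n : ℕ ↦ χ ((n : ℕ) : ZMod q) * (vonMangoldt n : ℂ)) s n‖ ≤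
      (LSeries.term (fun n : ℕ ↦ (1 : DirichletCharacter ℂ 1) ((n : ℕ) : ZMod 1) *
        (vonMangoldt n : ℂ)) (s.re : ℂ) n).re := by
  rcases Nat.eq_zero_or_pos n with rfl | hn
  · simp
  rw [LSeries.norm_term_eq, if_neg hn.ne', LSeries.term_of_ne_zero hn.ne']
  have e1 : (1 : DirichletCharacter ℂ 1) ((n : ℕ) : ZMod 1) = 1 := by
    rw [Subsingleton.elim ((n : ℕ) : ZMod 1) 1, map_one]
  have hr : ((n : ℂ) ^ ((s.re : ℝ) : ℂ)) = (((n : ℝ) ^ s.re : ℝ) : ℂ) := by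
    rw [Complex.ofReal_cpow (by positivity)]; simp
  rw [e1, one_mul, hr, ← Complex.ofReal_div, Complex.ofReal_re]
  have hΛ := ArithmeticFunction.vonMangoldt_nonneg (n := n)
  gcongr
  rw [norm_mul, Complex.norm_real, Real.norm_of_nonneg hΛ]
  exact mul_le_of_le_one_left hΛ (χ.norm_le_one _)

omit [NeZero q] in
lemma norm_mangoldtL_le (χ : DirichletCharacter ℂ q) {s : ℂ} (hs : 1 < s.re) :
    ‖mangoldtL χ s‖ ≤ (mangoldtL (1 : DirichletCharacter ℂ 1) s.re).re := by
  have h := mangoldtL_summable (1 : DirichletCharacter ℂ 1) (s := s.re) (by simpa using hs)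
  exact tsum_of_norm_bounded (Complex.hasSum_re h.hasSum) (norm_term_mangoldt_le χ s)

lemma cpow_line_mul {n : ℕ} (hn : 0 < n) {x : ℝ} (hx : 0 < x) (s : ℂ) :
    (((n / x : ℝ)) : ℂ) ^ (-s) = ((n : ℂ) ^ s)⁻¹ * (x : ℂ) ^ s := by
  rw [div_eq_mul_inv, Complex.ofReal_mul, Complex.mul_cpow_ofReal_nonneg (by positivity) (by positivity),
    Complex.ofReal_natCast, Complex.cpow_neg, Complex.ofReal_inv, Complex.inv_cpow, Complex.cpow_neg, inv_inv]
  rw [Complex.arg_ofReal_of_nonneg hx.le]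
  exact Real.pi_ne_zero.symm

lemma norm_cpow_line {x : ℝ} (hx : 0 < x) (c t : ℝ) : ‖(x : ℂ) ^ ((c : ℂ) + t * I)‖ = x ^ c := by
  rw [Complex.norm_cpow_eq_rpow_re_of_pos hx]; simp

lemma continuous_cpow_line {x : ℝ} (hx : 0 < x) (c : ℝ) :
    Continuous fun t : ℝ ↦ (x : ℂ) ^ ((c : ℂ) + t * I) :=
  Continuous.const_cpow (by fun_prop) (.inl (by exact_mod_cast hx.ne'))

lemma continuous_inv_line {c : ℝ} (hc : 0 < c) :
    Continuous fun t : ℝ ↦ (((c : ℂ) + t * I) * (c + t * I + 1))⁻¹ := by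
  refine Continuous.inv₀ (by fun_prop) fun t ↦ ?_
  refine mul_ne_zero ?_ ?_ <;> intro h <;>
  · have := congrArg Complex.re h
    simp at this; linarith

lemma integrable_mul_kernel {D : ℝ → ℂ} (hD : Continuous D) {B : ℝ} (hB : ∀ t, ‖D t‖ ≤ B) {x c : ℝ}
    (hx : 0 < x) (hc : 1 / 2 ≤ c) : Integrable fun t : ℝ ↦
      D t * ((x : ℂ) ^ ((c : ℂ) + t * I) * (((c : ℂ) + t * I) * (c + t * I + 1))⁻¹) := by
  refine (integrable_inv_one_add_sq.const_mul (B * (x ^ c * 4))).mono' (hD.mul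
    ((continuous_cpow_line hx c).mul (continuous_inv_line (by linarith)))).aestronglyMeasurable
    (.of_forall fun t ↦ ?_)
  have h0 : 0 ≤ B := (norm_nonneg _).trans (hB 0)
  rw [norm_mul, norm_mul, norm_cpow_line hx]
  have := norm_inv_mul_add_one_line_le hc t
  calc _ ≤ B * (x ^ c * (4 * (1 + t ^ 2)⁻¹)) := by gcongr; exact hB t
    _ = _ := by ring

omit [NeZero q] in
lemma integral_mangoldtL_mul (χ : DirichletCharacter ℂ q) {x c : ℝ} (hx : 0 < x) (hc : 1 < c) :
    ∫ t : ℝ, mangoldtL χ (c + t * I) *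
      ((x : ℂ) ^ ((c : ℂ) + t * I) * (((c : ℂ) + t * I) * (c + t * I + 1))⁻¹) =
      2 * π * smoothPsi χ x := by
  set a : ℕ → ℂ := fun n : ℕ ↦ χ ((n : ℕ) : ZMod q) * (vonMangoldt n : ℂ) with ha
  set F : ℕ → ℝ → ℂ := fun n t ↦ LSeries.term a (c + t * I) n *
      ((x : ℂ) ^ ((c : ℂ) + t * I) * (((c : ℂ) + t * I) * (c + t * I + 1))⁻¹) with hF
  have hcont : ∀ n, Continuous fun t : ℝ ↦ LSeries.term a (c + t * I) n := by
    intro n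
    rcases Nat.eq_zero_or_pos n with rfl | hn
    · simpa using continuous_const
    have hn0 : (n : ℂ) ≠ 0 := by exact_mod_cast hn.ne'
    simp only [LSeries.term_of_ne_zero hn.ne']
    refine Continuous.div continuous_const (Continuous.const_cpow (by fun_prop) (.inl hn0)) fun t ↦ ?_
    simp [Complex.cpow_eq_zero_iff, hn0]
  have hsum1 := mangoldtL_summable (1 : DirichletCharacter ℂ 1) (s := c) (by simpa using hc)
  have hbound : ∀ n (t : ℝ), ‖LSeries.term a (c + t * I) n‖ ≤ (LSeries.term (fun n : ℕ ↦
      (1 : DirichletCharacter ℂ 1) ((n : ℕ) : ZMod 1) * (vonMangoldt n : ℂ)) (c : ℂ) n).re := by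
    intro n t
    simpa using norm_term_mangoldt_le χ (c + t * I) n
  have hFint : ∀ n, Integrable (F n) := fun n ↦
    integrable_mul_kernel (hcont n) (hbound n) hx (by linarith)
  have hFle : ∀ n, ∫ t, ‖F n t‖ ≤ (LSeries.term (fun n : ℕ ↦
      (1 : DirichletCharacter ℂ 1) ((n : ℕ) : ZMod 1) * (vonMangoldt n : ℂ)) (c : ℂ) n).re *
      (x ^ c * (4 * π)) := by
    intro n
    rw [← integral_univ_inv_one_add_sq, ← integral_const_mul, ← integral_const_mul, ← integral_const_mul]
    refine integral_mono (hFint n).norm (((integrable_inv_one_add_sq.const_mul _).const_mul _).const_mul _)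
      fun t ↦ ?_
    have := norm_inv_mul_add_one_line_le (c := c) (by linarith) t
    simp only [hF, norm_mul, norm_cpow_line hx]
    have h0 := (norm_nonneg _).trans (hbound n t)
    gcongr
    · exact hbound n t
  have hFsum : Summable fun n ↦ ∫ t, ‖F n t‖ :=
    Summable.of_nonneg_of_le (fun n ↦ integral_nonneg fun t ↦ norm_nonneg _) hFle
      ((Complex.hasSum_re hsum1.hasSum).summable.mul_right _)
  have key := hasSum_integral_of_summable_integral_norm hFint hFsum
  have e1 : ∀ t : ℝ, ∑' n, F n t = mangoldtL χ (c + t * I) *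
      ((x : ℂ) ^ ((c : ℂ) + t * I) * (((c : ℂ) + t * I) * (c + t * I + 1))⁻¹) := by
    intro t
    simp only [hF, tsum_mul_right]; rfl
  have e2 : ∀ n, ∫ t, F n t = 2 * π * (a n * ((max (1 - n / x) 0 : ℝ) : ℂ)) := by
    intro n
    rcases Nat.eq_zero_or_pos n with rfl | hn
    · simp [hF, ha]
    have h := integral_cpow_neg_div (c := c) (u := n / x) (by linarith) (by positivity)
    have : ∀ t : ℝ, F n t = a n * ((((n / x : ℝ)) : ℂ) ^ (-((c : ℂ) + t * I)) *
        (((c : ℂ) + t * I) * (c + t * I + 1))⁻¹) := by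
      intro t
      rw [cpow_line_mul hn hx]
      simp only [hF, LSeries.term_of_ne_zero hn.ne']
      ring
    simp only [this]
    rw [integral_const_mul, h]; ring
  simp only [e1, e2] at key
  rw [← key.tsum_eq, tsum_mul_left, smoothPsi]
  congr 1
  rw [tsum_eq_sum (s := Finset.range (⌊x⌋₊ + 1))]
  · refine Finset.sum_congr rfl fun n hn ↦ ?_
    have : (n : ℝ) ≤ x := by
      rw [Finset.mem_range, Nat.lt_succ_iff] at hn
      exact (Nat.le_floor_iff hx.le).mp hn
    rw [max_eq_left]
    rw [sub_nonneg, div_le_one hx]; exact this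
  · intro n hn
    rw [Finset.mem_range, Nat.lt_succ_iff, Nat.le_floor_iff hx.le, not_le] at hn
    rw [max_eq_right]
    · simp
    · rw [sub_nonpos, one_le_div hx]; exact hn.le

lemma continuous_logDeriv_line (χ : DirichletCharacter ℂ q) {c : ℝ} (hc : 1 ≤ c) :
    Continuous fun t : ℝ ↦ deriv (entireL χ) (c + t * I) / entireL χ (c + t * I) := by
  have h1 : Continuous (deriv (entireL χ)) :=
    ((differentiable_entireL χ).contDiff (n := 1)).continuous_deriv le_rfl
  exact Continuous.div (h1.comp (by fun_prop)) ((differentiable_entireL χ).continuous.comp (by fun_prop))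
    fun t ↦ entireL_ne_zero_of_one_le_re χ (by simpa using hc)

lemma norm_inv_sub_one_line_le {c : ℝ} (hc : 1 < c) (t : ℝ) :
    ‖(c + t * I - 1 : ℂ)⁻¹‖ ≤ 1 / (c - 1) := by
  rw [norm_inv, one_div]
  apply inv_anti₀ (by linarith)
  simpa using Complex.re_le_norm ((c : ℂ) + t * I - 1)

lemma norm_logDeriv_line_le (χ : DirichletCharacter ℂ q) {c : ℝ} (hc : 1 < c) (t : ℝ) :
    ‖deriv (entireL χ) (c + t * I) / entireL χ (c + t * I)‖ ≤
      (mangoldtL (1 : DirichletCharacter ℂ 1) c).re + 1 / (c - 1) := by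
  have hs : 1 < ((c : ℂ) + t * I).re := by simpa using hc
  rw [logDeriv_entireL χ hs]
  refine (norm_add_le _ _).trans (add_le_add ?_ ?_)
  · rw [norm_neg]; simpa using norm_mangoldtL_le χ hs
  · split_ifs
    · rw [one_div]; exact norm_inv_sub_one_line_le hc t
    · simp; linarith

lemma integral_logDeriv_mul (χ : DirichletCharacter ℂ q) {x c : ℝ} (hx : 1 < x) (hc : 1 < c) :
    ∫ t : ℝ, deriv (entireL χ) (c + t * I) / entireL χ (c + t * I) *
      ((x : ℂ) ^ ((c : ℂ) + t * I) * (((c : ℂ) + t * I) * (c + t * I + 1))⁻¹) =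
      -(2 * π * (smoothPsi χ x - if χ = 1 then (((x - 1) ^ 2 / (2 * x) : ℝ) : ℂ) else 0)) := by
  have hx0 : 0 < x := by linarith
  have hinvc : Continuous fun t : ℝ ↦ (c + t * I - 1 : ℂ)⁻¹ := by
    refine Continuous.inv₀ (by fun_prop) fun t h ↦ ?_
    have := congrArg Complex.re h
    simp at this; linarith
  have hE : ∀ t : ℝ, mangoldtL χ (c + t * I) = (if χ = 1 then (c + t * I - 1 : ℂ)⁻¹ else 0) -
      deriv (entireL χ) (c + t * I) / entireL χ (c + t * I) := by
    intro t
    rw [logDeriv_entireL χ (by simpa using hc), one_div]; ring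
  have hI1 := integrable_mul_kernel (continuous_logDeriv_line χ hc.le) (norm_logDeriv_line_le χ hc) hx0
    (c := c) (by linarith)
  have hI2 := integrable_mul_kernel hinvc (norm_inv_sub_one_line_le hc) hx0 (c := c) (by linarith)
  have h1 := integral_mangoldtL_mul χ hx0 hc
  simp only [hE] at h1
  by_cases hχ : χ = 1
  · simp only [if_pos hχ, sub_mul] at h1 ⊢
    rw [integral_sub hI2 hI1] at h1
    have h2 := integral_cpow_neg_div_sub_one (c := c) (u := 1 / x) hc (by positivity)
      (by rw [div_lt_one hx0]; exact hx)
    have h3 : ∀ t : ℝ, (((1 / x : ℝ)) : ℂ) ^ (-((c : ℂ) + t * I)) = (x : ℂ) ^ ((c : ℂ) + t * I) := by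
      intro t
      have := cpow_line_mul (n := 1) one_pos hx0 ((c : ℂ) + t * I)
      simpa using this
    have h4 : (1 - 1 / x) ^ 2 / (2 * (1 / x)) = (x - 1) ^ 2 / (2 * x) := by field_simp
    simp only [h3, h4] at h2
    have h5 : ∀ t : ℝ, (c + t * I - 1 : ℂ)⁻¹ * ((x : ℂ) ^ ((c : ℂ) + t * I) * (((c : ℂ) + t * I) * (c + t * I + 1))⁻¹) =
      (x : ℂ) ^ ((c : ℂ) + t * I) * ((c + t * I - 1 : ℂ)⁻¹ * (((c : ℂ) + t * I) * (c + t * I + 1))⁻¹) := fun t ↦ by ring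
    simp only [h5, h2] at h1
    linear_combination -h1
  · simp only [if_neg hχ, zero_sub, neg_mul, integral_neg, sub_zero] at h1 ⊢
    linear_combination -h1

end ExplicitFormula

section ContourShift

open Complex Filter Topology DirichletCharacter MeasureTheory Set

lemma norm_integral_line_le {G : ℂ → ℂ} {δ T B x : ℝ} (hδ : 0 < δ) (hδ1 : δ ≤ 1 / 2) (hT : 1 ≤ T)
    (hx : 1 ≤ x) (hB : 0 ≤ B)
    (hG : DifferentiableOn ℂ G (uIcc (1 - δ) (1 + δ) ×ℂ uIcc (-T) T))
    (hGB : ∀ s : ℂ, |s.re - 1| ≤ δ → |s.im| ≤ T → ‖G s‖ ≤ B)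
    (hGc : Continuous fun t : ℝ ↦ G ((1 + δ : ℝ) + t * I)) (hGt : ∀ t : ℝ, ‖G ((1 + δ : ℝ) + t * I)‖ ≤ B) :
    ‖∫ t : ℝ, G ((1 + δ : ℝ) + t * I) * ((x : ℂ) ^ (((1 + δ : ℝ) : ℂ) + t * I) *
      ((((1 + δ : ℝ) : ℂ) + t * I) * ((1 + δ : ℝ) + t * I + 1))⁻¹)‖ ≤
      B * (4 * π * x ^ (1 - δ) + 16 * x ^ (1 + δ) / T) := by
  have hx0 : 0 < x := by linarith
  set H : ℂ → ℂ := fun s ↦ G s * ((x : ℂ) ^ s * (s * (s + 1))⁻¹) with hH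
  have hHn : ∀ s : ℂ, 1 / 2 ≤ s.re → ‖G s‖ ≤ B → ‖H s‖ ≤ B * (x ^ s.re * (4 * (1 + s.im ^ 2)⁻¹)) := by
    intro s hs hb
    simp only [hH]
    rw [norm_mul, norm_mul, Complex.norm_cpow_eq_rpow_re_of_pos hx0]
    have := norm_inv_mul_add_one_le hs
    gcongr
  have hmain : Integrable fun t : ℝ ↦ H ((1 + δ : ℝ) + t * I) :=
    integrable_mul_kernel hGc hGt hx0 (by linarith)
  change ‖∫ t : ℝ, H ((1 + δ : ℝ) + t * I)‖ ≤ _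
  have hHd : DifferentiableOn ℂ H (uIcc (1 - δ) (1 + δ) ×ℂ uIcc (-T) T) := by
    intro s hs
    have hsre : 1 - δ ≤ s.re := by
      have := hs.1
      rw [mem_preimage, uIcc_of_le (by linarith)] at this
      exact this.1
    refine (hG s hs).mul (DifferentiableWithinAt.mul ?_ ?_)
    · exact (DifferentiableAt.const_cpow differentiableAt_id (.inl (by exact_mod_cast hx0.ne'))).differentiableWithinAt
    · refine (DifferentiableAt.inv (by fun_prop) ?_).differentiableWithinAt
      refine mul_ne_zero ?_ ?_ <;> intro h <;>
      · have := congrArg Complex.re h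
        simp at this; linarith
  have hrect := Complex.integral_boundary_rect_eq_zero_of_differentiableOn H
    (((1 - δ : ℝ) : ℂ) + (-T : ℝ) * I) (((1 + δ : ℝ) : ℂ) + (T : ℝ) * I) (by simpa using hHd)
  have hre : ∀ a b : ℝ, ((a : ℂ) + b * I).re = a := by simp
  have him : ∀ a b : ℝ, ((a : ℂ) + b * I).im = b := by simp
  simp only [hre, him, smul_eq_mul] at hrect
  have hhor : ∀ b : ℝ, |b| = T → ‖∫ σ in (1 - δ)..(1 + δ), H (σ + b * I)‖ ≤ 4 * B * x ^ (1 + δ) / T := by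
    intro b hb
    have := intervalIntegral.norm_integral_le_of_norm_le_const (a := 1 - δ) (b := 1 + δ)
      (f := fun σ : ℝ ↦ H (σ + b * I)) (C := 4 * B * x ^ (1 + δ) / T) ?_
    · refine this.trans ?_
      rw [show 1 + δ - (1 - δ) = 2 * δ by ring, abs_of_pos (by positivity)]
      apply mul_le_of_le_one_right (by positivity) (by linarith)
    · intro σ hσ
      rw [uIoc_of_le (by linarith)] at hσ
      have h1 := hHn (σ + b * I) (by rw [hre]; linarith [hσ.1])
        (hGB _ (by rw [hre, abs_le]; constructor <;> linarith [hσ.1, hσ.2]) (by rw [him, hb]))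
      rw [hre, him] at h1
      refine h1.trans ?_
      have h2 : (1 + b ^ 2)⁻¹ ≤ T⁻¹ := by
        apply inv_anti₀ (by linarith)
        rw [← sq_abs, hb]; nlinarith
      have h3 : x ^ σ ≤ x ^ (1 + δ) := Real.rpow_le_rpow_of_exponent_le hx hσ.2
      calc B * (x ^ σ * (4 * (1 + b ^ 2)⁻¹)) ≤ B * (x ^ (1 + δ) * (4 * T⁻¹)) := by gcongr
        _ = _ := by ring
  have hb1 := hhor (-T) (by rw [abs_neg, abs_of_pos]; linarith)
  have hb2 := hhor T (by rw [abs_of_pos]; linarith)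
  have hleft : ‖∫ t in (-T)..T, H (((1 - δ : ℝ) : ℂ) + t * I)‖ ≤ B * (4 * π * x ^ (1 - δ)) := by
    rw [intervalIntegral.integral_of_le (by linarith)]
    calc _ ≤ ∫ t in Ioc (-T) T, B * (x ^ (1 - δ) * 4) * (1 + t ^ 2)⁻¹ := by
            refine norm_integral_le_of_norm_le (integrable_inv_one_add_sq.const_mul _).integrableOn ?_
            filter_upwards [ae_restrict_mem measurableSet_Ioc] with t ht
            have h1 := hHn (((1 - δ : ℝ) : ℂ) + t * I) (by rw [hre]; linarith)
              (hGB _ (by rw [hre, abs_le]; constructor <;> linarith) (by rw [him, abs_le]; exact ⟨ht.1.le, ht.2⟩))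
            rw [hre, him] at h1
            linarith
      _ ≤ ∫ t : ℝ, B * (x ^ (1 - δ) * 4) * (1 + t ^ 2)⁻¹ :=
            setIntegral_le_integral (integrable_inv_one_add_sq.const_mul _)
              (.of_forall fun t ↦ by positivity)
      _ = _ := by rw [integral_const_mul, integral_univ_inv_one_add_sq]; ring
  have htail : ‖∫ t in (Ioc (-T) T)ᶜ, H (((1 + δ : ℝ) : ℂ) + t * I)‖ ≤ 8 * B * x ^ (1 + δ) / T := by
    calc _ ≤ ∫ t in (Ioc (-T) T)ᶜ, B * (x ^ (1 + δ) * 4) * (1 + t ^ 2)⁻¹ := by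
            refine norm_integral_le_of_norm_le (integrable_inv_one_add_sq.const_mul _).integrableOn ?_
            refine .of_forall fun t ↦ ?_
            have h1 := hHn (((1 + δ : ℝ) : ℂ) + t * I) (by rw [hre]; linarith) (hGt t)
            rw [hre, him] at h1
            linarith
      _ ≤ B * (x ^ (1 + δ) * 4) * (2 / T) := by
            rw [integral_const_mul]
            exact mul_le_mul_of_nonneg_left (setIntegral_inv_one_add_sq_compl_le (by linarith)) (by positivity)
      _ = _ := by ring
  rw [← integral_add_compl measurableSet_Ioc hmain,
    ← intervalIntegral.integral_of_le (by linarith : -T ≤ T)]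
  refine (norm_add_le _ _).trans ?_
  have hmid : ‖∫ t in (-T)..T, H (((1 + δ : ℝ) : ℂ) + t * I)‖ ≤
      B * (4 * π * x ^ (1 - δ)) + 4 * B * x ^ (1 + δ) / T + 4 * B * x ^ (1 + δ) / T := by
    set X1 := ∫ σ in (1 - δ)..(1 + δ), H (σ + (-T : ℝ) * I)
    set X2 := ∫ σ in (1 - δ)..(1 + δ), H (σ + T * I)
    set X3 := ∫ t in (-T)..T, H (((1 + δ : ℝ) : ℂ) + t * I)
    set X4 := ∫ t in (-T)..T, H (((1 - δ : ℝ) : ℂ) + t * I)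
    have e : X3 = X4 + I * X1 + -(I * X2) := by
      have h2 : I * I = -1 := Complex.I_mul_I
      linear_combination (-I) * hrect + (X3 - X4) * h2
    rw [e]
    refine (norm_add₃_le).trans ?_
    rw [norm_neg, norm_mul, norm_mul, Complex.norm_I, one_mul, one_mul]
    gcongr
  have : B * (4 * π * x ^ (1 - δ) + 16 * x ^ (1 + δ) / T) = B * (4 * π * x ^ (1 - δ)) +
    4 * B * x ^ (1 + δ) / T + 4 * B * x ^ (1 + δ) / T + 8 * B * x ^ (1 + δ) / T := by ring
  rw [this]
  exact add_le_add hmid htail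

/-- The smoothed prime number theorem for Dirichlet characters of modulus `q ≤ L ^ A`,
where `x = exp (L ^ 2)`. -/
theorem exists_norm_smoothPsi_sub_le {A : ℝ} (hA : 0 < A) : ∃ κ : ℝ, 0 < κ ∧ κ ≤ 1 ∧
    ∃ K : ℝ, 0 < K ∧ ∀ (q : ℕ) [NeZero q] (χ : DirichletCharacter ℂ q) (L x : ℝ), 1 ≤ L → (q : ℝ) ≤ L ^ A →
      x = Real.exp (L ^ 2) →
      ‖smoothPsi χ x - (if χ = 1 then (((x - 1) ^ 2 / (2 * x) : ℝ) : ℂ) else 0)‖ ≤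
        K * (x * Real.exp (-κ * L)) := by
  obtain ⟨κ, hκ, hκ1, K, hK, h⟩ := exists_norm_logDeriv_entireL_le hA
  set K₁ := K + 2 / κ with hK₁
  have hK₁0 : 0 < K₁ := by positivity
  refine ⟨κ / 2, by positivity, by linarith, 30 * K₁ * (8 / κ ^ 2), by positivity, fun q _ χ L x hL hq hx ↦ ?_⟩
  have hL0 : 0 < L := by linarith
  have hx1 : 1 < x := by rw [hx]; exact Real.one_lt_exp_iff.mpr (by positivity)
  set δ := κ / L with hδ
  have hδ0 : 0 < δ := by positivity
  have hδκ : δ ≤ κ := div_le_self hκ.le hL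
  have hδi : 1 / δ ≤ 1 / κ * L ^ 2 := by
    rw [hδ, one_div_div, one_div_mul_eq_div]
    gcongr; nlinarith
  have hW : (mangoldtL (1 : DirichletCharacter ℂ 1) (1 + δ : ℝ)).re ≤ K * L ^ 2 + 1 / δ := by
    have h1 := h 1 (1 : DirichletCharacter ℂ 1) L hL (by
      simpa using Real.one_le_rpow hL hA.le) ((1 + δ : ℝ) : ℂ) (by simp [-Complex.ofReal_add]; positivity) (by
      rw [Complex.ofReal_re, add_sub_cancel_left, abs_of_pos hδ0])
    have h2 := h1.2
    rw [logDeriv_entireL _ (by rw [Complex.ofReal_re]; linarith), if_pos rfl] at h2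
    have h3 := (Complex.abs_re_le_norm _).trans h2
    have h4 : (1 / (((1 + δ : ℝ) : ℂ) - 1)).re = 1 / δ := by
      rw [← Complex.ofReal_one, ← Complex.ofReal_sub, ← Complex.ofReal_div, Complex.ofReal_re]
      congr 1; ring
    rw [Complex.add_re, h4, Complex.neg_re] at h3
    linarith [(abs_le.mp h3).1]
  have hline : ∀ t : ℝ, ‖deriv (entireL χ) ((1 + δ : ℝ) + t * I) / entireL χ ((1 + δ : ℝ) + t * I)‖ ≤
      K₁ * L ^ 2 := by
    intro t
    refine (norm_logDeriv_line_le χ (c := 1 + δ) (by linarith) t).trans ?_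
    rw [add_sub_cancel_left]
    have : K₁ * L ^ 2 = K * L ^ 2 + 1 / κ * L ^ 2 + 1 / κ * L ^ 2 := by rw [hK₁]; ring
    linarith
  have hKK : K * L ^ 2 ≤ K₁ * L ^ 2 := by
    gcongr; rw [hK₁]; linarith [show 0 < 2 / κ by positivity]
  have key := norm_integral_line_le (G := fun s ↦ deriv (entireL χ) s / entireL χ s) (T := Real.exp L)
    (B := K₁ * L ^ 2) hδ0 (by linarith) (Real.one_le_exp hL0.le) hx1.le (by positivity) ?_ ?_
    (continuous_logDeriv_line χ (by linarith)) hline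
  · rw [integral_logDeriv_mul χ hx1 (by linarith), norm_neg, norm_mul] at key
    have hpi : ‖(2 * π : ℂ)‖ = 2 * π := by
      rw [norm_mul, Complex.norm_real, Real.norm_of_nonneg Real.pi_pos.le]; simp
    rw [hpi] at key
    have e1 : x ^ (1 - δ) = x * Real.exp (-κ * L) := by
      rw [Real.rpow_sub (by linarith), Real.rpow_one, hx, ← Real.exp_mul, ← Real.exp_sub, ← Real.exp_add]
      congr 1; rw [hδ]; field_simp; ring
    have e2 : x ^ (1 + δ) / Real.exp L ≤ x * Real.exp (-κ * L) := by
      rw [Real.rpow_add (by linarith), Real.rpow_one, hx, ← Real.exp_mul, ← Real.exp_add, ← Real.exp_sub,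
        ← Real.exp_add]
      apply Real.exp_le_exp.mpr
      have : L ^ 2 * δ = κ * L := by rw [hδ]; field_simp
      rw [this]; nlinarith
    have e3 : L ^ 2 * Real.exp (-κ * L) ≤ 8 / κ ^ 2 * Real.exp (-(κ / 2) * L) := by
      have h1 : (κ / 2 * L) ^ 2 / 2 ≤ Real.exp (κ / 2 * L) := by
        have := Real.quadratic_le_exp_of_nonneg (x := κ / 2 * L) (by positivity)
        nlinarith [show 0 ≤ κ / 2 * L by positivity]
      have h2 : Real.exp (-(κ / 2) * L) = Real.exp (κ / 2 * L) * Real.exp (-κ * L) := by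
        rw [← Real.exp_add]; congr 1; ring
      rw [h2, ← mul_assoc]
      gcongr
      calc L ^ 2 = 8 / κ ^ 2 * ((κ / 2 * L) ^ 2 / 2) := by field_simp; ring
        _ ≤ _ := by gcongr
    have hp := Real.pi_lt_d2
    have hp3 := Real.pi_gt_three
    set N := ‖smoothPsi χ x - (if χ = 1 then (((x - 1) ^ 2 / (2 * x) : ℝ) : ℂ) else 0)‖ with hN
    have hb : N ≤ 30 * (K₁ * L ^ 2 * (x * Real.exp (-κ * L))) := by
      have hn : 0 ≤ N := norm_nonneg _
      have : 2 * π * N ≤ K₁ * L ^ 2 * (4 * π * (x * Real.exp (-κ * L)) + 16 * (x * Real.exp (-κ * L))) := by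
        refine key.trans ?_
        rw [e1, mul_div_assoc]
        gcongr
      have hp0 : 0 ≤ K₁ * L ^ 2 * (x * Real.exp (-κ * L)) := by positivity
      nlinarith
    calc N ≤ 30 * K₁ * x * (L ^ 2 * Real.exp (-κ * L)) := by linarith
      _ ≤ 30 * K₁ * x * (8 / κ ^ 2 * Real.exp (-(κ / 2) * L)) := by gcongr
      _ = _ := by ring
  · intro s hs
    have h1 := hs.1
    have h2 := hs.2
    rw [mem_preimage, uIcc_of_le (by linarith), mem_Icc] at h1
    rw [mem_preimage, uIcc_of_le (by linarith [Real.exp_pos L]), mem_Icc] at h2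
    have hne := (h q χ L hL hq s (abs_le.mpr h2) (abs_le.mpr ⟨by linarith, by linarith⟩)).1
    have hd := differentiable_entireL χ
    exact (DifferentiableAt.div (hd.contDiff.differentiable_deriv_two s) (hd s) hne).differentiableWithinAt
  · intro s h1 h2
    exact ((h q χ L hL hq s h2 h1).2).trans hKK

end ContourShift

section ResidueClass

open ArithmeticFunction (vonMangoldt)
open ArithmeticFunction.vonMangoldt (residueClass residueClass_nonneg residueClass_le residueClass_apply)
open Finset

/-- The Chebyshev function `ψ(x; q, a)`. -/
noncomputable def psiMod {q : ℕ} (a : ZMod q) (x : ℝ) : ℝ :=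
  ∑ n ∈ range (⌊x⌋₊ + 1), residueClass a n

/-- The integral `∫₀ˣ ψ(t; q, a) dt`, written as a finite sum. -/
noncomputable def psiModPrimitive {q : ℕ} (a : ZMod q) (x : ℝ) : ℝ :=
  ∑ n ∈ range (⌊x⌋₊ + 1), residueClass a n * (x - n)

lemma ofReal_psiModPrimitive {q : ℕ} [NeZero q] {a : ZMod q} (ha : IsUnit a) {x : ℝ} (hx : 0 < x) :
    ((psiModPrimitive a x : ℝ) : ℂ) =
      (q.totient : ℂ)⁻¹ * x * ∑ χ : DirichletCharacter ℂ q, χ a⁻¹ * smoothPsi χ x := by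
  simp only [psiModPrimitive, smoothPsi, mul_sum, Complex.ofReal_sum]
  rw [sum_comm]
  refine sum_congr rfl fun n _ ↦ ?_
  rw [Complex.ofReal_mul, residueClass_apply ha, mul_assoc, sum_mul, mul_sum]
  refine sum_congr rfl fun χ _ ↦ ?_
  have : (x : ℂ) ≠ 0 := by exact_mod_cast hx.ne'
  push_cast
  field_simp

lemma card_dirichletCharacter (q : ℕ) [NeZero q] :
    (univ : Finset (DirichletCharacter ℂ q)).card = q.totient := by
  rw [← DirichletCharacter.card_eq_totient_of_hasEnoughRootsOfUnity ℂ q, Nat.card_eq_fintype_card,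
    card_univ]

lemma exists_abs_psiModPrimitive_sub_le {A : ℝ} (hA : 0 < A) : ∃ κ : ℝ, 0 < κ ∧ κ ≤ 1 ∧
    ∃ K : ℝ, 0 < K ∧ ∀ (q : ℕ) [NeZero q] (a : ZMod q) (L x : ℝ), IsUnit a → 1 ≤ L →
      (q : ℝ) ≤ L ^ A → x = Real.exp (L ^ 2) →
      |psiModPrimitive a x - (q.totient : ℝ)⁻¹ * ((x - 1) ^ 2 / 2)| ≤
        K * (x ^ 2 * Real.exp (-κ * L)) := by
  obtain ⟨κ, hκ, hκ1, K, hK, h⟩ := exists_norm_smoothPsi_sub_le hA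
  refine ⟨κ, hκ, hκ1, K, hK, fun q _ a L x ha hL hq hx ↦ ?_⟩
  have hx0 : 0 < x := hx ▸ Real.exp_pos _
  have hφ : 0 < (q.totient : ℝ) := by exact_mod_cast Nat.totient_pos.mpr (NeZero.pos q)
  have hφ' : (q.totient : ℂ) ≠ 0 := by exact_mod_cast hφ.ne'
  have hxc : (x : ℂ) ≠ 0 := by exact_mod_cast hx0.ne'
  have e : ((psiModPrimitive a x - (q.totient : ℝ)⁻¹ * ((x - 1) ^ 2 / 2) : ℝ) : ℂ) =
      (q.totient : ℂ)⁻¹ * x * ∑ χ : DirichletCharacter ℂ q, χ a⁻¹ *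
        (smoothPsi χ x - (if χ = 1 then (((x - 1) ^ 2 / (2 * x) : ℝ) : ℂ) else 0)) := by
    rw [Complex.ofReal_sub, ofReal_psiModPrimitive ha hx0]
    simp only [mul_sub, sum_sub_distrib, mul_ite, mul_zero, sum_ite_eq', mem_univ, if_true]
    have h1 : (1 : DirichletCharacter ℂ q) a⁻¹ = 1 := by
      apply MulChar.one_apply
      obtain ⟨u, rfl⟩ := ha
      rw [ZMod.inv_coe_unit]
      exact Units.isUnit _
    rw [h1]
    congr 1
    push_cast
    field_simp
  rw [← Real.norm_eq_abs, ← Complex.norm_real, e, norm_mul, norm_mul, norm_inv, Complex.norm_natCast,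
    Complex.norm_real, Real.norm_of_nonneg hx0.le]
  have hs : ‖∑ χ : DirichletCharacter ℂ q, χ a⁻¹ *
        (smoothPsi χ x - (if χ = 1 then (((x - 1) ^ 2 / (2 * x) : ℝ) : ℂ) else 0))‖ ≤
        q.totient * (K * (x * Real.exp (-κ * L))) := by
    refine (norm_sum_le_of_le _ (fun χ _ ↦ ?_)).trans_eq
      (by rw [sum_const, card_dirichletCharacter, nsmul_eq_mul])
    rw [norm_mul]
    exact (mul_le_of_le_one_left (norm_nonneg _) (χ.norm_le_one _)).trans (h q χ L x hL hq hx)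
  calc _ ≤ (q.totient : ℝ)⁻¹ * x * (q.totient * (K * (x * Real.exp (-κ * L)))) := by gcongr
    _ = _ := by field_simp

lemma psiModPrimitive_eq_sum_max {q : ℕ} (a : ZMod q) {y z : ℝ} (hy : 0 ≤ y) (hyz : y ≤ z) :
    psiModPrimitive a y = ∑ n ∈ range (⌊z⌋₊ + 1), residueClass a n * max (y - n) 0 := by
  rw [psiModPrimitive]
  refine sum_subset_zero_on_sdiff ?_ ?_ ?_
  · exact range_subset_range.mpr (by gcongr)
  · intro n hn
    simp only [mem_sdiff, mem_range, not_lt] at hn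
    have : y < n := (Nat.floor_lt hy).mp hn.2
    rw [max_eq_right (by linarith), mul_zero]
  · intro n hn
    have : (n : ℝ) ≤ y := (Nat.le_floor_iff hy).mp (Nat.lt_succ_iff.mp (mem_range.mp hn))
    rw [max_eq_left (by linarith)]

lemma psiMod_eq_sum_ite {q : ℕ} (a : ZMod q) {y z : ℝ} (hy : 0 ≤ y) (hyz : y ≤ z) :
    psiMod a y = ∑ n ∈ range (⌊z⌋₊ + 1), residueClass a n * (if (n : ℝ) ≤ y then 1 else 0) := by
  rw [psiMod]
  refine sum_subset_zero_on_sdiff ?_ ?_ ?_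
  · exact range_subset_range.mpr (by gcongr)
  · intro n hn
    simp only [mem_sdiff, mem_range, not_lt] at hn
    have : y < n := (Nat.floor_lt hy).mp hn.2
    rw [if_neg (by linarith), mul_zero]
  · intro n hn
    have : (n : ℝ) ≤ y := (Nat.le_floor_iff hy).mp (Nat.lt_succ_iff.mp (mem_range.mp hn))
    rw [if_pos this, mul_one]

lemma mul_psiMod_le {q : ℕ} (a : ZMod q) {x h : ℝ} (hx : 0 ≤ x) (hh : 0 ≤ h) :
    h * psiMod a x ≤ psiModPrimitive a (x + h) - psiModPrimitive a x := by
  rw [psiMod_eq_sum_ite a hx (show x ≤ x + h by linarith), psiModPrimitive_eq_sum_max a hx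
    (show x ≤ x + h by linarith), psiModPrimitive_eq_sum_max a (by linarith : 0 ≤ x + h) le_rfl, mul_sum,
    ← sum_sub_distrib]
  refine sum_le_sum fun n _ ↦ ?_
  rw [← mul_sub, mul_left_comm]
  refine mul_le_mul_of_nonneg_left ?_ (residueClass_nonneg a n)
  split_ifs with hn
  · rw [max_eq_left (by linarith), max_eq_left (by linarith)]; linarith
  · rw [mul_zero, sub_nonneg]
    gcongr; linarith

lemma le_mul_psiMod {q : ℕ} (a : ZMod q) {x h : ℝ} (hx : h ≤ x) (hh : 0 ≤ h) :
    psiModPrimitive a x - psiModPrimitive a (x - h) ≤ h * psiMod a x := by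
  rw [psiMod_eq_sum_ite a (hh.trans hx) le_rfl, psiModPrimitive_eq_sum_max a (hh.trans hx) le_rfl,
    psiModPrimitive_eq_sum_max a (by linarith : 0 ≤ x - h) (by linarith : x - h ≤ x), mul_sum,
    ← sum_sub_distrib]
  refine sum_le_sum fun n _ ↦ ?_
  rw [← mul_sub, mul_left_comm]
  refine mul_le_mul_of_nonneg_left ?_ (residueClass_nonneg a n)
  split_ifs with hn
  · rw [max_eq_left (by linarith : 0 ≤ x - n)]
    linarith [le_max_left (x - h - n) 0]
  · rw [max_eq_right (by linarith), max_eq_right (by linarith)]; simp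

lemma psiMod_nonneg {q : ℕ} (a : ZMod q) (x : ℝ) : 0 ≤ psiMod a x :=
  sum_nonneg fun n _ ↦ residueClass_nonneg a n

lemma psiMod_le_psi {q : ℕ} (a : ZMod q) (x : ℝ) : psiMod a x ≤ Chebyshev.psi x := by
  rw [Chebyshev.psi_eq_sum_Icc, psiMod, Nat.range_succ_eq_Icc_zero]
  exact sum_le_sum fun n _ ↦ residueClass_le a n

lemma inv_totient_nonneg_le_one (q : ℕ) :
    0 ≤ (q.totient : ℝ)⁻¹ ∧ (q.totient : ℝ)⁻¹ ≤ 1 :=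
  ⟨by positivity, Nat.cast_inv_le_one _⟩

lemma exists_abs_psiMod_sub_le {A : ℝ} (hA : 0 < A) : ∃ κ : ℝ, 0 < κ ∧ κ ≤ 1 ∧
    ∃ K : ℝ, 0 < K ∧ ∀ (q : ℕ) [NeZero q] (a : ZMod q) (L x : ℝ), IsUnit a → 1 ≤ L →
      (q : ℝ) ≤ L ^ A → x = Real.exp (L ^ 2) →
      |psiMod a x - (q.totient : ℝ)⁻¹ * x| ≤ K * (x * Real.exp (-κ * L)) := by
  obtain ⟨κ, hκ, hκ1, K, hK, h⟩ := exists_abs_psiModPrimitive_sub_le (show 0 < A + 1 by linarith)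
  set B : ℝ := 2 ^ (A + 1) with hB
  have hB2 : 2 ≤ B := by
    rw [hB]; exact Real.self_le_rpow_of_one_le (by norm_num) (by linarith)
  have hlog4 : 0 < Real.log 4 := Real.log_pos (by norm_num)
  set K₂ : ℝ := (Real.log 4 + 5) * Real.exp (κ / 4 * B) with hK₂
  have hK₂0 : 0 < K₂ := by positivity
  refine ⟨κ / 4, by linarith, by linarith, 16 * K + 2 + K₂, by positivity,
    fun q _ a L x ha hL hq hx ↦ ?_⟩
  obtain ⟨hM0, hM1⟩ := inv_totient_nonneg_le_one q
  set M : ℝ := (q.totient : ℝ)⁻¹ with hM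
  have hx0 : 0 < x := hx ▸ Real.exp_pos _
  set ε : ℝ := Real.exp (-(κ / 4) * L) with hε
  have hε0 : 0 < ε := Real.exp_pos _
  have hε1 : ε ≤ 1 := Real.exp_le_one_iff.mpr (by nlinarith)
  have hxε0 : 0 < x * ε := by positivity
  rcases lt_or_ge L B with hLB | hLB
  · have h1 := psiMod_nonneg a x
    have h2 := (psiMod_le_psi a x).trans (Chebyshev.psi_le_const_mul_self hx0.le)
    have h3 : |psiMod a x - M * x| ≤ (Real.log 4 + 5) * x := by
      rw [abs_le]
      constructor <;> nlinarith
    have h4 : 1 ≤ Real.exp (κ / 4 * B) * ε := by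
      rw [hε, ← Real.exp_add]
      apply Real.one_le_exp
      nlinarith
    calc _ ≤ (Real.log 4 + 5) * x := h3
      _ ≤ (Real.log 4 + 5) * x * (Real.exp (κ / 4 * B) * ε) := le_mul_of_one_le_right (by positivity) h4
      _ = K₂ * (x * ε) := by rw [hK₂]; ring
      _ ≤ _ := by gcongr; linarith
  · have hE (y : ℝ) (hy1 : x / 2 ≤ y) (hy2 : y ≤ 2 * x) :
        |psiModPrimitive a y - M * ((y - 1) ^ 2 / 2)| ≤ 4 * K * x ^ 2 * ε ^ 2 := by
      have hy0 : 0 < y := by linarith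
      have hlogy : (L / 2) ^ 2 ≤ Real.log y := by
        have : Real.log (x / 2) ≤ Real.log y := Real.log_le_log (by positivity) hy1
        rw [Real.log_div hx0.ne' two_ne_zero, hx, Real.log_exp] at this
        nlinarith [Real.log_two_lt_d9]
      have hly : 0 ≤ Real.log y := (sq_nonneg _).trans hlogy
      have hL' : L / 2 ≤ √(Real.log y) := Real.le_sqrt_of_sq_le hlogy
      have hq' : (q : ℝ) ≤ √(Real.log y) ^ (A + 1) := by
        calc (q : ℝ) ≤ L ^ A := hq
          _ ≤ L ^ A * (L / B) := le_mul_of_one_le_right (by positivity) (by rwa [one_le_div (by linarith)])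
          _ = (L / 2) ^ (A + 1) := by
            rw [Real.div_rpow (by linarith) (by norm_num), Real.rpow_add_one (by linarith), hB]; ring
          _ ≤ _ := by gcongr
      have := h q a (√(Real.log y)) y ha (by linarith) hq'
        (by rw [Real.sq_sqrt hly, Real.exp_log hy0])
      refine this.trans ?_
      have e1 : Real.exp (-κ * √(Real.log y)) ≤ ε ^ 2 := by
        rw [hε, ← Real.exp_nat_mul]
        apply Real.exp_le_exp.mpr
        push_cast
        nlinarith
      calc K * (y ^ 2 * Real.exp (-κ * √(Real.log y))) ≤ K * ((2 * x) ^ 2 * ε ^ 2) := by gcongr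
        _ = _ := by ring
    set η : ℝ := x * ε / 2 with hη
    have hη0 : 0 < η := by positivity
    have hηx : η ≤ x / 2 := by rw [hη]; nlinarith
    have h1 := mul_psiMod_le a hx0.le hη0.le
    have h2 := le_mul_psiMod a (by linarith : η ≤ x) hη0.le
    have b1 := abs_le.mp (hE x (by linarith) (by linarith))
    have b2 := abs_le.mp (hE (x + η) (by linarith) (by linarith))
    have b3 := abs_le.mp (hE (x - η) (by linarith) (by linarith))
    have hb : 4 * K * x ^ 2 * ε ^ 2 = η * (8 * K * (x * ε)) := by rw [hη]; ring
    rw [hb] at b1 b2 b3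
    have hxε : 1 ≤ x * ε := by
      rw [hε, hx, ← Real.exp_add]
      apply Real.one_le_exp
      nlinarith
    have u1 : η * psiMod a x ≤ η * (M * (x - 1 + η / 2) + 16 * K * (x * ε)) := by linarith
    have u2 : η * (M * (x - 1 - η / 2) - 16 * K * (x * ε)) ≤ η * psiMod a x := by linarith
    replace u1 := le_of_mul_le_mul_left u1 hη0
    replace u2 := le_of_mul_le_mul_left u2 hη0
    have hK₂' : 0 ≤ K₂ * (x * ε) := by positivity
    have hMη : M * η ≤ η := mul_le_of_le_one_left hη0.le hM1
    have w1 : M * (x - 1 + η / 2) = M * x - M + M * η / 2 := by ring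
    have w2 : M * (x - 1 - η / 2) = M * x - M - M * η / 2 := by ring
    have w3 : (16 * K + 2 + K₂) * (x * ε) = 16 * K * (x * ε) + 2 * (x * ε) + K₂ * (x * ε) := by ring
    rw [abs_le, w3]
    constructor <;> linarith

end ResidueClass

section PartialSummation

open ArithmeticFunction (vonMangoldt vonMangoldt_apply_prime vonMangoldt_nonneg)
open ArithmeticFunction.vonMangoldt (residueClass residueClass_nonneg residueClass_le)
open Finset MeasureTheory

/-- The weight `log p` on the primes `p ≡ a (mod q)`. -/
noncomputable def logPrimeMod {q : ℕ} (a : ZMod q) (n : ℕ) : ℝ :=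
  if n.Prime ∧ (n : ZMod q) = a then Real.log n else 0

/-- The Chebyshev function `θ(x; q, a)`. -/
noncomputable def thetaMod {q : ℕ} (a : ZMod q) (x : ℝ) : ℝ :=
  ∑ n ∈ Icc 0 ⌊x⌋₊, logPrimeMod a n

lemma logPrimeMod_le_residueClass {q : ℕ} (a : ZMod q) (n : ℕ) : logPrimeMod a n ≤ residueClass a n := by
  rw [logPrimeMod]
  split_ifs with h
  · simp [residueClass, h.2, vonMangoldt_apply_prime h.1]
  · exact residueClass_nonneg a n

lemma residueClass_sub_logPrimeMod_le {q : ℕ} (a : ZMod q) (n : ℕ) :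
    residueClass a n - logPrimeMod a n ≤ vonMangoldt n - (if n.Prime then Real.log n else 0) := by
  by_cases hp : n.Prime
  · by_cases ha : (n : ZMod q) = a <;>
      simp [residueClass, logPrimeMod, hp, ha, vonMangoldt_apply_prime hp]
  · simpa [logPrimeMod, hp] using residueClass_le a n

lemma thetaMod_nonneg {q : ℕ} (a : ZMod q) (x : ℝ) : 0 ≤ thetaMod a x := by
  refine sum_nonneg fun n _ ↦ ?_
  rw [logPrimeMod]
  split_ifs
  exacts [Real.log_natCast_nonneg n, le_rfl]

lemma thetaMod_le_psiMod {q : ℕ} (a : ZMod q) (x : ℝ) : thetaMod a x ≤ psiMod a x := by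
  rw [thetaMod, psiMod, Nat.range_succ_eq_Icc_zero]
  exact sum_le_sum fun n _ ↦ logPrimeMod_le_residueClass a n

lemma psiMod_sub_thetaMod_le {q : ℕ} (a : ZMod q) (x : ℝ) :
    psiMod a x - thetaMod a x ≤ Chebyshev.psi x - Chebyshev.theta x := by
  rw [thetaMod, psiMod, Nat.range_succ_eq_Icc_zero, Chebyshev.psi_eq_sum_Icc,
    Chebyshev.theta_eq_sum_Icc, sum_filter, ← sum_sub_distrib, ← sum_sub_distrib]
  exact sum_le_sum fun n _ ↦ residueClass_sub_logPrimeMod_le a n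

lemma abs_thetaMod_sub_le_mul {q : ℕ} (a : ZMod q) {x : ℝ} (hx : 0 ≤ x) :
    |thetaMod a x - (q.totient : ℝ)⁻¹ * x| ≤ (Real.log 4 + 5) * x := by
  have h1 := thetaMod_nonneg a x
  have h2 := (thetaMod_le_psiMod a x).trans
    ((psiMod_le_psi a x).trans (Chebyshev.psi_le_const_mul_self hx))
  obtain ⟨hM0, hM1⟩ := inv_totient_nonneg_le_one q
  have h3 := mul_le_of_le_one_left hx hM1
  have h4 : 0 ≤ (q.totient : ℝ)⁻¹ * x := by positivity
  have h5 : 0 ≤ Real.log 4 * x := mul_nonneg (Real.log_nonneg (by norm_num)) hx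
  rw [abs_le]
  constructor <;> linarith

lemma sqrt_le_mul_exp {κ L x : ℝ} (hκ : κ ≤ 1) (hL : 0 ≤ L) (hx : x = Real.exp (L ^ 2)) :
    √x ≤ 3 * (x * Real.exp (-κ * L)) := by
  rw [hx, ← Real.exp_half, ← Real.exp_add]
  calc Real.exp (L ^ 2 / 2) ≤ Real.exp (1 + (L ^ 2 + -κ * L)) :=
        Real.exp_le_exp.mpr (by nlinarith [sq_nonneg (L - 1)])
    _ = Real.exp 1 * Real.exp (L ^ 2 + -κ * L) := Real.exp_add _ _
    _ ≤ _ := by gcongr; exact Real.exp_one_lt_three.le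

lemma exists_abs_thetaMod_sub_le {A : ℝ} (hA : 0 < A) : ∃ κ : ℝ, 0 < κ ∧ κ ≤ 1 ∧
    ∃ K : ℝ, 0 < K ∧ ∀ (q : ℕ) [NeZero q] (a : ZMod q) (L x : ℝ), IsUnit a → 1 ≤ L →
      (q : ℝ) ≤ L ^ A → x = Real.exp (L ^ 2) →
      |thetaMod a x - (q.totient : ℝ)⁻¹ * x| ≤ K * (x * Real.exp (-κ * L)) := by
  obtain ⟨κ, hκ, hκ1, K, hK, h⟩ := exists_abs_psiMod_sub_le hA
  obtain ⟨C, hC⟩ := Chebyshev.psi_sub_theta_le_mul_sqrt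
  refine ⟨κ, hκ, hκ1, K + 3 * |C|, by positivity, fun q _ a L x ha hL hq hx ↦ ?_⟩
  have h1 := abs_le.mp (h q a L x ha hL hq hx)
  have h2 := thetaMod_le_psiMod a x
  have h3 : psiMod a x - thetaMod a x ≤ |C| * (3 * (x * Real.exp (-κ * L))) := by
    refine (psiMod_sub_thetaMod_le a x).trans ((hC x).trans ?_)
    gcongr
    · exact le_abs_self C
    · exact sqrt_le_mul_exp hκ1 (by linarith) hx
  have h4 : 0 ≤ |C| * (3 * (x * Real.exp (-κ * L))) := by rw [hx]; positivity
  rw [abs_le]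
  constructor <;> linarith

lemma exists_abs_thetaMod_sub_le_of_le {A : ℝ} (hA : 0 < A) : ∃ κ : ℝ, 0 < κ ∧
    ∃ K : ℝ, 0 < K ∧ ∀ (q : ℕ) [NeZero q] (a : ZMod q) (L x : ℝ), IsUnit a → 1 ≤ L →
      (q : ℝ) ≤ L ^ A → x = Real.exp (L ^ 2) → ∀ t, 0 < t → t ≤ x →
      |thetaMod a t - (q.totient : ℝ)⁻¹ * t| ≤ K * (x * Real.exp (-κ * L)) := by
  obtain ⟨κ, hκ, hκ1, K, hK, h⟩ := exists_abs_thetaMod_sub_le (show 0 < A + 1 by linarith)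
  set B : ℝ := 2 ^ (A + 1) with hB
  have hB2 : 2 ≤ B := by
    rw [hB]; exact Real.self_le_rpow_of_one_le (by norm_num) (by linarith)
  set c : ℝ := Real.log 4 + 5 with hc
  have hc0 : 0 < c := by
    have : 0 < Real.log 4 := Real.log_pos (by norm_num)
    positivity
  refine ⟨κ / 2, by linarith, K + c * 3 + c * Real.exp (κ / 2 * B), by positivity,
    fun q _ a L x ha hL hq hx t ht htx ↦ ?_⟩
  have hx0 : 0 < x := hx ▸ Real.exp_pos _
  rcases lt_or_ge L B with hLB | hLB
  · have h4 : 1 ≤ Real.exp (κ / 2 * B) * Real.exp (-(κ / 2) * L) := by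
      rw [← Real.exp_add]
      apply Real.one_le_exp
      nlinarith
    calc _ ≤ c * t := abs_thetaMod_sub_le_mul a ht.le
      _ ≤ c * x := by gcongr
      _ ≤ c * x * (Real.exp (κ / 2 * B) * Real.exp (-(κ / 2) * L)) :=
          le_mul_of_one_le_right (by positivity) h4
      _ = c * Real.exp (κ / 2 * B) * (x * Real.exp (-(κ / 2) * L)) := by ring
      _ ≤ _ := by
        gcongr
        linarith [show 0 < c * 3 by positivity]
  rcases le_total t (√x) with hts | hts
  · calc _ ≤ c * t := abs_thetaMod_sub_le_mul a ht.le
      _ ≤ c * (3 * (x * Real.exp (-(κ / 2) * L))) := by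
        gcongr
        exact hts.trans (sqrt_le_mul_exp (by linarith) (by linarith) hx)
      _ = c * 3 * (x * Real.exp (-(κ / 2) * L)) := by ring
      _ ≤ _ := by
        gcongr
        linarith [show 0 < c * Real.exp (κ / 2 * B) by positivity]
  · have hlogt : (L / 2) ^ 2 ≤ Real.log t := by
      have : Real.log (√x) ≤ Real.log t := Real.log_le_log (by positivity) hts
      rw [Real.log_sqrt hx0.le, hx, Real.log_exp] at this
      nlinarith
    have hlt : 0 ≤ Real.log t := (sq_nonneg _).trans hlogt
    have hL' : L / 2 ≤ √(Real.log t) := Real.le_sqrt_of_sq_le hlogt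
    have hq' : (q : ℝ) ≤ √(Real.log t) ^ (A + 1) := by
      calc (q : ℝ) ≤ L ^ A := hq
        _ ≤ L ^ A * (L / B) := le_mul_of_one_le_right (by positivity) (by rwa [one_le_div (by linarith)])
        _ = (L / 2) ^ (A + 1) := by
          rw [Real.div_rpow (by linarith) (by norm_num), Real.rpow_add_one (by linarith), hB]; ring
        _ ≤ _ := by gcongr
    refine (h q a (√(Real.log t)) t ha (by linarith) hq'
      (by rw [Real.sq_sqrt hlt, Real.exp_log ht])).trans ?_
    have e1 : Real.exp (-κ * √(Real.log t)) ≤ Real.exp (-(κ / 2) * L) := by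
      apply Real.exp_le_exp.mpr
      nlinarith
    gcongr
    linarith [show 0 < c * 3 by positivity, show 0 < c * Real.exp (κ / 2 * B) by positivity]

lemma continuousOn_inv_mul_log_sq (x : ℝ) :
    ContinuousOn (fun t : ℝ ↦ (t * Real.log t ^ 2)⁻¹) (Set.Icc 2 x) := by
  intro t ht
  have h0 : t ≠ 0 := by linarith [ht.1]
  have h1 : t * Real.log t ^ 2 ≠ 0 :=
    mul_ne_zero h0 (pow_ne_zero 2 (Real.log_pos (by linarith [ht.1])).ne')
  exact ContinuousAt.continuousWithinAt (by fun_prop)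

lemma primeCountingMod_eq_thetaMod_div_log_add_integral {q : ℕ} (a : ℤ) {x : ℝ} (hx : 2 ≤ x) :
    (primeCountingMod x q a : ℝ) = thetaMod (a : ZMod q) x / Real.log x +
      ∫ t in (2 : ℝ)..x, thetaMod (a : ZMod q) t * (t * Real.log t ^ 2)⁻¹ := by
  have h0 : (primeCountingMod x q a : ℝ) =
      ∑ n ∈ Icc 0 ⌊x⌋₊, (Real.log n)⁻¹ * logPrimeMod (a : ZMod q) n := by
    rw [primeCountingMod, card_eq_sum_ones, sum_filter, Nat.range_succ_eq_Icc_zero]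
    push_cast
    refine sum_congr rfl fun n _ ↦ ?_
    rw [logPrimeMod]
    split_ifs with h
    · have : Real.log n ≠ 0 := (Real.log_pos (by exact_mod_cast h.1.one_lt)).ne'
      field_simp
    · simp
  rw [h0, sum_mul_eq_sub_integral_mul₁ (logPrimeMod (a : ZMod q)) (f := fun t ↦ (Real.log t)⁻¹)
    (by simp [logPrimeMod]) (by simp [logPrimeMod]), ← intervalIntegral.integral_of_le hx]
  · have : ∫ t in (2 : ℝ)..x, deriv (fun t ↦ (Real.log t)⁻¹) t *
          ∑ k ∈ Icc 0 ⌊t⌋₊, logPrimeMod (a : ZMod q) k =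
        -∫ t in (2 : ℝ)..x, thetaMod (a : ZMod q) t * (t * Real.log t ^ 2)⁻¹ := by
      rw [← intervalIntegral.integral_neg]
      refine intervalIntegral.integral_congr fun t _ ↦ ?_
      simp only [thetaMod, deriv_inv_log_apply]
      field_simp
    rw [this, thetaMod]
    ring
  · intro t ht
    have h1 : t ≠ 0 := by linarith [ht.1]
    have h2 : Real.log t ≠ 0 := (Real.log_pos (by linarith [ht.1])).ne'
    fun_prop
  · refine (continuousOn_inv_mul_log_sq x).neg.integrableOn_Icc.congr_fun (fun t _ ↦ ?_) measurableSet_Icc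
    simp only [Pi.neg_apply, deriv_inv_log_apply]
    field_simp

lemma integral_one_div_log_eq {x : ℝ} (hx : 2 ≤ x) :
    ∫ t in (2 : ℝ)..x, 1 / Real.log t =
      x / Real.log x - 2 / Real.log 2 + ∫ t in (2 : ℝ)..x, t * (t * Real.log t ^ 2)⁻¹ := by
  have hi : IntervalIntegrable (fun t : ℝ ↦ t * (t * Real.log t ^ 2)⁻¹) volume 2 x := by
    apply ContinuousOn.intervalIntegrable
    rw [Set.uIcc_of_le hx]
    exact continuousOn_id.mul (continuousOn_inv_mul_log_sq x)
  have hi' : IntervalIntegrable (fun t : ℝ ↦ 1 / Real.log t) volume 2 x := by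
    apply ContinuousOn.intervalIntegrable
    rw [Set.uIcc_of_le hx]
    intro t ht
    have h1 : t ≠ 0 := by linarith [ht.1]
    have h2 : Real.log t ≠ 0 := (Real.log_pos (by linarith [ht.1])).ne'
    exact ContinuousAt.continuousWithinAt (by fun_prop)
  have := intervalIntegral.integral_eq_sub_of_hasDerivAt (f := fun t ↦ t / Real.log t)
    (f' := fun t ↦ 1 / Real.log t - t * (t * Real.log t ^ 2)⁻¹) (a := 2) (b := x) (fun t ht ↦ ?_) (hi'.sub hi)
  · rw [intervalIntegral.integral_sub hi' hi] at this
    linarith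
  · rw [Set.uIcc_of_le hx] at ht
    have h1 : t ≠ 0 := by linarith [ht.1]
    have h2 : Real.log t ≠ 0 := (Real.log_pos (by linarith [ht.1])).ne'
    refine ((hasDerivAt_id t).div (Real.hasDerivAt_log h1) h2).congr_deriv ?_
    simp only [id]
    field_simp

lemma integral_inv_mul_log_sq_le {x : ℝ} (hx : 2 ≤ x) :
    ∫ t in (2 : ℝ)..x, (t * Real.log t ^ 2)⁻¹ ≤ 1 / Real.log 2 := by
  have := intervalIntegral.integral_eq_sub_of_hasDerivAt (f := fun t ↦ -(Real.log t)⁻¹)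
    (f' := fun t ↦ (t * Real.log t ^ 2)⁻¹) (a := 2) (b := x) (fun t ht ↦ ?_)
    (by
      apply ContinuousOn.intervalIntegrable
      rw [Set.uIcc_of_le hx]
      exact continuousOn_inv_mul_log_sq x)
  · have h : 0 < (Real.log x)⁻¹ := inv_pos.mpr (Real.log_pos (by linarith))
    rw [this, one_div]
    linarith
  · rw [Set.uIcc_of_le hx] at ht
    have h1 : t ≠ 0 := by linarith [ht.1]
    have h2 : Real.log t ≠ 0 := (Real.log_pos (by linarith [ht.1])).ne'
    refine ((Real.hasDerivAt_log h1).inv h2).neg.congr_deriv ?_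
    field_simp

lemma abs_primeCountingMod_sub_le {q : ℕ} (a : ℤ) {x B : ℝ} (hx : 2 ≤ x)
    (hB : ∀ t, 0 < t → t ≤ x → |thetaMod (a : ZMod q) t - (q.totient : ℝ)⁻¹ * t| ≤ B) :
    |(primeCountingMod x q a : ℝ) - (1 / (q.totient : ℝ)) * ∫ t in (2 : ℝ)..x, 1 / Real.log t| ≤
      4 * B + 4 := by
  obtain ⟨hM0, hM1⟩ := inv_totient_nonneg_le_one q
  set M : ℝ := (q.totient : ℝ)⁻¹ with hM
  have hw := continuousOn_inv_mul_log_sq x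
  have hwi : IntervalIntegrable (fun t : ℝ ↦ (t * Real.log t ^ 2)⁻¹) volume 2 x := by
    apply ContinuousOn.intervalIntegrable
    rwa [Set.uIcc_of_le hx]
  have hi : IntervalIntegrable (fun t : ℝ ↦ M * (t * (t * Real.log t ^ 2)⁻¹)) volume 2 x := by
    apply ContinuousOn.intervalIntegrable
    rw [Set.uIcc_of_le hx]
    exact continuousOn_const.mul (continuousOn_id.mul hw)
  have hiθ : IntervalIntegrable (fun t : ℝ ↦ thetaMod (a : ZMod q) t * (t * Real.log t ^ 2)⁻¹)
      volume 2 x := by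
    rw [intervalIntegrable_iff_integrableOn_Icc_of_le hx]
    refine (integrableOn_mul_sum_Icc (m := 0) (logPrimeMod (a : ZMod q)) (by norm_num)
      hw.integrableOn_Icc).congr_fun (fun t _ ↦ ?_) measurableSet_Icc
    simp only [thetaMod]
    ring
  have hl2 := Real.log_two_gt_d9
  have hlx : Real.log 2 ≤ Real.log x := Real.log_le_log (by norm_num) hx
  have hB0 : 0 ≤ B := (abs_nonneg _).trans (hB x (by linarith) le_rfl)
  have e : (primeCountingMod x q a : ℝ) - (1 / (q.totient : ℝ)) * ∫ t in (2 : ℝ)..x, 1 / Real.log t =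
      (thetaMod (a : ZMod q) x - M * x) / Real.log x + M * (2 / Real.log 2) +
        ∫ t in (2 : ℝ)..x, (thetaMod (a : ZMod q) t - M * t) * (t * Real.log t ^ 2)⁻¹ := by
    have : ∀ t : ℝ, (thetaMod (a : ZMod q) t - M * t) * (t * Real.log t ^ 2)⁻¹ =
        thetaMod (a : ZMod q) t * (t * Real.log t ^ 2)⁻¹ - M * (t * (t * Real.log t ^ 2)⁻¹) :=
      fun t ↦ by ring
    simp only [this]
    rw [intervalIntegral.integral_sub hiθ hi, intervalIntegral.integral_const_mul,
      primeCountingMod_eq_thetaMod_div_log_add_integral a hx, integral_one_div_log_eq hx, one_div, ← hM]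
    ring
  have b1 : |(thetaMod (a : ZMod q) x - M * x) / Real.log x| ≤ 2 * B := by
    rw [abs_div, abs_of_pos (by linarith : 0 < Real.log x), div_le_iff₀ (by linarith)]
    have := hB x (by linarith) le_rfl
    nlinarith
  have b2 : |M * (2 / Real.log 2)| ≤ 4 := by
    have h2 : 2 / Real.log 2 ≤ 4 := by rw [div_le_iff₀ (by linarith)]; linarith
    have h3 : 0 ≤ 2 / Real.log 2 := by positivity
    rw [abs_of_nonneg (by positivity)]
    nlinarith
  have b3 : |∫ t in (2 : ℝ)..x, (thetaMod (a : ZMod q) t - M * t) * (t * Real.log t ^ 2)⁻¹| ≤ 2 * B := by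
    rw [← Real.norm_eq_abs]
    refine (intervalIntegral.norm_integral_le_of_norm_le hx (g := fun t ↦ B * (t * Real.log t ^ 2)⁻¹)
      (Filter.Eventually.of_forall fun t ht ↦ ?_) (hwi.const_mul B)).trans ?_
    · have ht0 : 0 < t := by linarith [ht.1]
      rw [norm_mul, Real.norm_eq_abs, Real.norm_of_nonneg (by positivity)]
      gcongr
      exact hB t ht0 ht.2
    · rw [intervalIntegral.integral_const_mul, mul_comm 2 B]
      gcongr
      refine (integral_inv_mul_log_sq_le hx).trans ?_
      rw [div_le_iff₀ (by linarith)]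
      linarith
  rw [e]
  refine (abs_add_le _ _).trans ((add_le_add_left (abs_add_le _ _) _).trans ?_)
  linarith

end PartialSummation

end SiegelWalfisz

/-- **Siegel–Walfisz theorem**: for every `A > 0` there are constants `C_A > 0` and `K > 0`
(the implied constant) such that for all `x ≥ 2`, all positive `q ≤ (log x) ^ A` and all
`a` coprime to `q`,
`π(x; q, a) = (1/φ(q)) ∫₂ˣ dt / log t + O_A(x * exp (-C_A * √(log x)))`. -/
theorem siegel_walfisz :
    ∀ A : ℝ, 0 < A → ∃ C : ℝ, 0 < C ∧ ∃ K : ℝ, 0 < K ∧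
      ∀ (x : ℝ) (q : ℕ) (a : ℤ), 2 ≤ x → 0 < q → (q : ℝ) ≤ (Real.log x) ^ A →
        Int.gcd a q = 1 →
        |(primeCountingMod x q a : ℝ) -
            (1 / (Nat.totient q : ℝ)) * ∫ t in (2:ℝ)..x, 1 / Real.log t| ≤
          K * (x * Real.exp (-C * Real.sqrt (Real.log x))) := by
  intro A hA
  obtain ⟨κ, hκ, K, hK, h⟩ :=
    SiegelWalfisz.exists_abs_thetaMod_sub_le_of_le (show 0 < 2 * A by linarith)
  refine ⟨min κ 1, by positivity, 4 * K + 12, by positivity, fun x q a hx hq hqx hgcd ↦ ?_⟩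
  have : NeZero q := ⟨hq.ne'⟩
  have hx0 : 0 < x := by linarith
  have hlog0 : 0 ≤ Real.log x := Real.log_nonneg (by linarith)
  have hlog : 1 ≤ Real.log x := by
    by_contra! hlt
    have h1 : (1 : ℝ) ≤ q := by exact_mod_cast hq
    linarith [Real.rpow_lt_one hlog0 hlt hA]
  have ha : IsUnit (a : ZMod q) :=
    (ZMod.coe_int_isUnit_iff_isCoprime a q).mpr (Int.isCoprime_iff_gcd_eq_one.mpr hgcd).symm
  set L : ℝ := √(Real.log x) with hL
  have hL1 : 1 ≤ L := Real.one_le_sqrt.mpr hlog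
  have hxL : x = Real.exp (L ^ 2) := by rw [hL, Real.sq_sqrt hlog0, Real.exp_log hx0]
  have hqL : (q : ℝ) ≤ L ^ (2 * A) := by
    rwa [Real.rpow_mul (by linarith), Real.rpow_two, hL, Real.sq_sqrt hlog0]
  refine (SiegelWalfisz.abs_primeCountingMod_sub_le a hx (h q (a : ZMod q) L x ha hL1 hqL hxL)).trans ?_
  have h1 : x * Real.exp (-κ * L) ≤ x * Real.exp (-min κ 1 * L) := by
    gcongr
    exact min_le_left κ 1
  have h2 : 1 ≤ 3 * (x * Real.exp (-min κ 1 * L)) :=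
    (Real.one_le_sqrt.mpr (by linarith)).trans
      (SiegelWalfisz.sqrt_le_mul_exp (min_le_right κ 1) (by linarith) hxL)
  nlinarith
end

section
/- For every real y > 0, one has e^{−y} = (1/(2πi)) ∫_{2−i∞}^{2+i∞} y^{−s} Γ(s) ds, where the integral is taken over the vertical line Re(s) = 2. -/
open Real Complex MeasureTheory

/-- On the right half-plane, `Γ` is bounded in norm by its value at the real part. -/
lemma norm_Gamma_le_Gamma_re {s : ℂ} (hs : 0 < s.re) :
    ‖Complex.Gamma s‖ ≤ Real.Gamma s.re := by
  rw [Complex.Gamma_eq_integral hs, Real.Gamma_eq_integral hs, Complex.GammaIntegral]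
  refine (norm_integral_le_integral_norm _).trans_eq
    (setIntegral_congr_fun measurableSet_Ioi fun x hx ↦ ?_)
  simp [norm_cpow_eq_rpow_re_of_pos hx, Complex.norm_exp]

lemma norm_Gamma_two_add_mul_I_le (t : ℝ) :
    ‖Complex.Gamma (2 + t * I)‖ ≤ 6 * (1 + t ^ 2)⁻¹ := by
  have h2 : (2 + t * I : ℂ) ≠ 0 := fun h ↦ by simpa using congrArg re h
  have h3 : (2 + t * I + 1 : ℂ) ≠ 0 := fun h ↦ by
    have := congrArg re h
    norm_num at this
  have hrec : Complex.Gamma (2 + t * I + 1 + 1) =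
      (2 + t * I + 1) * ((2 + t * I) * Complex.Gamma (2 + t * I)) := by
    rw [Complex.Gamma_add_one _ h3, Complex.Gamma_add_one _ h2]
  have hre : (2 + t * I + 1 + 1 : ℂ).re = 4 := by norm_num
  have hle : ‖Complex.Gamma (2 + t * I + 1 + 1)‖ ≤ 6 := by
    refine (norm_Gamma_le_Gamma_re (by rw [hre]; norm_num)).trans_eq ?_
    rw [hre, Real.Gamma_ofNat_eq_factorial]
    norm_num [Nat.factorial]
  have hn2 : √(1 + t ^ 2) ≤ ‖(2 + t * I : ℂ)‖ := by
    rw [Complex.norm_def]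
    apply Real.sqrt_le_sqrt
    norm_num [Complex.normSq_apply]
    nlinarith
  have hn3 : √(1 + t ^ 2) ≤ ‖(2 + t * I + 1 : ℂ)‖ := by
    rw [Complex.norm_def]
    apply Real.sqrt_le_sqrt
    norm_num [Complex.normSq_apply]
    nlinarith
  have hprod : 1 + t ^ 2 ≤ ‖(2 + t * I + 1 : ℂ)‖ * ‖(2 + t * I : ℂ)‖ := by
    rw [← Real.mul_self_sqrt (show 0 ≤ 1 + t ^ 2 by positivity)]
    gcongr
  rw [hrec, norm_mul, norm_mul, ← mul_assoc] at hle
  rw [← div_eq_mul_inv, le_div_iff₀ (by positivity), mul_comm]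
  exact (mul_le_mul_of_nonneg_right hprod (norm_nonneg _)).trans hle

lemma mellin_exp_neg_eq_Gamma {s : ℂ} (hs : 0 < s.re) :
    mellin (fun x ↦ (Real.exp (-x) : ℂ)) s = Complex.Gamma s := by
  rw [Complex.Gamma_eq_integral hs, Complex.GammaIntegral_eq_mellin]

lemma continuous_Gamma_two_add_mul_I :
    Continuous fun t : ℝ ↦ Complex.Gamma (2 + t * I) := by
  refine continuous_iff_continuousAt.2 fun t ↦ ?_
  refine ContinuousAt.comp (f := fun t : ℝ ↦ (2 + t * I : ℂ)) (g := Complex.Gamma)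
    (Complex.differentiableAt_Gamma _ fun m h ↦ ?_).continuousAt (by fun_prop)
  have h' : (2 : ℝ) = -m := by simpa using congrArg re h
  linarith [Nat.cast_nonneg (α := ℝ) m]

lemma integrable_Gamma_two_add_mul_I :
    Integrable fun t : ℝ ↦ Complex.Gamma (2 + t * I) :=
  (integrable_inv_one_add_sq.const_mul 6).mono'
    continuous_Gamma_two_add_mul_I.aestronglyMeasurable
    (.of_forall norm_Gamma_two_add_mul_I_le)

/-- Inverse Mellin transform of `Γ`: for every `y > 0`,
`e^(-y) = (1/(2πi)) ∫_{2-i∞}^{2+i∞} y^(-s) Γ(s) ds`, the integral being over the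
vertical line `Re s = 2`, i.e. `∫_ℝ y^(-(2+it)) Γ(2+it) · i dt`. -/
theorem inverse_mellin_gamma (y : ℝ) (hy : 0 < y) :
    (Real.exp (-y) : ℂ) =
      (1 / (2 * π * Complex.I)) *
        ∫ t : ℝ, (y : ℂ) ^ (-(2 + t * Complex.I)) * Complex.Gamma (2 + t * Complex.I)
          * Complex.I := by
  have hmellin (t : ℝ) : mellin (fun x ↦ (Real.exp (-x) : ℂ)) (2 + t * I) =
      Complex.Gamma (2 + t * I) := mellin_exp_neg_eq_Gamma (by simp)
  have hconv : MellinConvergent (fun x ↦ (Real.exp (-x) : ℂ)) ((2 : ℝ) : ℂ) := by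
    simpa [MellinConvergent, mul_comm] using
      Complex.GammaIntegral_convergent (s := 2) (by simp)
  have hvert : VerticalIntegrable (mellin fun x ↦ (Real.exp (-x) : ℂ)) 2 := by
    simpa only [VerticalIntegrable, ofReal_ofNat, hmellin] using integrable_Gamma_two_add_mul_I
  have hinv := mellinInv_mellin_eq 2 _ hy hconv hvert (by fun_prop)
  rw [← hinv, mellinInv, integral_mul_const]
  simp only [ofReal_ofNat, hmellin, smul_eq_mul, real_smul]
  generalize (∫ t : ℝ, (y : ℂ) ^ (-(2 + t * I)) * Complex.Gamma (2 + t * I)) = J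
  push_cast
  field_simp
end

section
/- For every real σ with 0 < σ < 1, one has ζ(σ) < 0. -/
open Complex Set Filter Topology MeasureTheory Asymptotics

/-- The fractional part of `t`, cut off to the half-line `t > 1`. -/
noncomputable def fractTail : ℝ → ℂ := (Ioi (1 : ℝ)).indicator fun t ↦ ((Int.fract t : ℝ) : ℂ)

lemma norm_fractTail_le_one (t : ℝ) : ‖fractTail t‖ ≤ 1 := by
  unfold fractTail
  refine (norm_indicator_le_norm_self _ _).trans ?_
  rw [norm_real, Real.norm_of_nonneg (Int.fract_nonneg t)]
  exact (Int.fract_lt_one t).le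

lemma measurable_fractTail : Measurable fractTail :=
  (measurable_ofReal.comp measurable_fract).indicator measurableSet_Ioi

lemma locallyIntegrable_fractTail : LocallyIntegrable fractTail :=
  (locallyIntegrable_const (1 : ℝ)).mono measurable_fractTail.aestronglyMeasurable
    (ae_of_all _ fun t ↦ by simpa using norm_fractTail_le_one t)

lemma fractTail_isBigO_atTop : fractTail =O[atTop] fun t : ℝ ↦ t ^ (-0 : ℝ) :=
  .of_bound 1 (Eventually.of_forall fun t ↦ by simpa using norm_fractTail_le_one t)

lemma fractTail_isBigO_nhdsGT_zero (b : ℝ) : fractTail =O[𝓝[>] 0] fun t : ℝ ↦ t ^ (-b) := by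
  have h : fractTail =ᶠ[𝓝[>] 0] fun _ ↦ 0 := by
    filter_upwards [mem_nhdsWithin_of_mem_nhds (Iio_mem_nhds zero_lt_one)] with t ht
    exact indicator_of_notMem (notMem_Ioi.2 (le_of_lt ht)) _
  exact h.trans_isBigO (isBigO_zero _ _)

lemma mellinConvergent_fractTail {s : ℂ} (hs : s.re < 0) : MellinConvergent fractTail s :=
  mellinConvergent_of_isBigO_rpow (locallyIntegrable_fractTail.locallyIntegrableOn _)
    fractTail_isBigO_atTop hs (fractTail_isBigO_nhdsGT_zero _) (sub_one_lt s.re)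

lemma differentiableAt_mellin_fractTail {s : ℂ} (hs : s.re < 0) :
    DifferentiableAt ℂ (mellin fractTail) s :=
  mellin_differentiableAt_of_isBigO_rpow (locallyIntegrable_fractTail.locallyIntegrableOn _)
    fractTail_isBigO_atTop hs (fractTail_isBigO_nhdsGT_zero _) (sub_one_lt s.re)

lemma cpow_smul_fractTail (s : ℂ) :
    (fun t : ℝ ↦ (t : ℂ) ^ s • fractTail t) =
      (Ioi (1 : ℝ)).indicator fun t : ℝ ↦ (t : ℂ) ^ s * ((Int.fract t : ℝ) : ℂ) := by
  ext t
  by_cases ht : t ∈ Ioi (1 : ℝ) <;> simp [fractTail, ht]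

lemma mellin_fractTail (s : ℂ) :
    mellin fractTail s = ∫ t in Ioi (1 : ℝ), (t : ℂ) ^ (s - 1) * ((Int.fract t : ℝ) : ℂ) := by
  rw [mellin, cpow_smul_fractTail, setIntegral_indicator measurableSet_Ioi,
    inter_eq_right.2 (Ioi_subset_Ioi zero_le_one)]

lemma integrableOn_cpow_mul_fract {s : ℂ} (hs : s.re < 0) :
    IntegrableOn (fun t : ℝ ↦ (t : ℂ) ^ (s - 1) * ((Int.fract t : ℝ) : ℂ)) (Ioi 1) := by
  have h := mellinConvergent_fractTail hs
  rw [MellinConvergent, cpow_smul_fractTail] at h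
  have h' := h.mono_set (Ioi_subset_Ioi (zero_le_one (α := ℝ)))
  exact (integrableOn_congr_fun (fun t ht ↦ indicator_of_mem ht _) measurableSet_Ioi).1 h'

lemma mellin_fractTail_ofReal (x : ℝ) :
    mellin fractTail x = ((∫ t in Ioi (1 : ℝ), t ^ (x - 1) * Int.fract t : ℝ) : ℂ) := by
  rw [mellin_fractTail, ← integral_complex_ofReal]
  refine setIntegral_congr_fun measurableSet_Ioi fun t ht ↦ ?_
  have : (0 : ℝ) ≤ t := zero_le_one.trans (le_of_lt ht)
  push_cast [ofReal_cpow this]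
  rfl

lemma riemannZeta_eq_sub_mul_mellin_fractTail_of_one_lt_re {s : ℂ} (hs : 1 < s.re) :
    riemannZeta s = s / (s - 1) - s * mellin fractTail (-s) := by
  have hs1 : s - 1 ≠ 0 := sub_ne_zero.2 fun h ↦ by simp [h] at hs
  have hz := LSeries_eq_mul_integral_of_nonneg (fun _ ↦ 1) zero_le_one hs
    (by simpa using isBigO_refl _ _) (fun _ ↦ zero_le_one)
  have h1 : LSeries (fun _ ↦ ((1 : ℝ) : ℂ)) s = riemannZeta s := by
    rw [← LSeries_one_eq_riemannZeta hs]
    congr 1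
  have hre : (-s).re < -1 := by simpa using hs
  have hpow : ∫ t in Ioi (1 : ℝ), (t : ℂ) ^ (-s) = 1 / (s - 1) := by
    rw [integral_Ioi_cpow_of_lt hre zero_lt_one, ofReal_one, one_cpow, neg_div, ← div_neg]
    congr 1
    ring
  rw [← h1, hz, mellin_fractTail, div_eq_mul_one_div, ← hpow, ← mul_sub,
    ← integral_sub (integrableOn_Ioi_cpow_of_lt hre zero_lt_one)
      (integrableOn_cpow_mul_fract (by linarith))]
  congr 1
  refine setIntegral_congr_fun measurableSet_Ioi fun t ht ↦ ?_
  have ht0 : (0 : ℝ) < t := zero_lt_one.trans ht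
  have ht0' : (t : ℂ) ≠ 0 := ofReal_ne_zero.2 ht0.ne'
  have hfl : (⌊t⌋₊ : ℂ) = t - ((Int.fract t : ℝ) : ℂ) := by
    rw [← ofReal_natCast, natCast_floor_eq_intCast_floor ht0.le, ← ofReal_sub,
      Int.self_sub_fract]
  have hsplit : (t : ℂ) ^ (-s) = t * (t : ℂ) ^ (-s - 1) := by
    rw [cpow_sub _ _ ht0', cpow_one, mul_div_cancel₀ _ ht0']
  simp only [ofReal_one, Finset.sum_const, Nat.card_Icc, add_tsub_cancel_right, nsmul_eq_mul,
    mul_one, hfl, neg_add']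
  rw [hsplit]
  ring

/-- The formula `ζ(s) = s / (s - 1) - s ∫₁^∞ {t} t ^ (-s - 1) dt`, valid for `0 < re s`. -/
theorem riemannZeta_eq_sub_mul_mellin_fractTail {s : ℂ} (hs : 0 < s.re) (hs1 : s ≠ 1) :
    riemannZeta s = s / (s - 1) - s * mellin fractTail (-s) := by
  have hopen : IsOpen {z : ℂ | 0 < z.re} := isOpen_lt continuous_const continuous_re
  have hdiff : DifferentiableOn ℂ (fun z ↦ z - (z - 1) * z * mellin fractTail (-z))
      {z : ℂ | 0 < z.re} := fun z hz ↦ by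
    have hM : DifferentiableAt ℂ (fun z ↦ mellin fractTail (-z)) z :=
      (differentiableAt_mellin_fractTail (s := -z) (by simpa using hz)).comp z
        differentiableAt_id.neg
    exact (by fun_prop : DifferentiableAt ℂ
      (fun z ↦ z - (z - 1) * z * mellin fractTail (-z)) z).differentiableWithinAt
  have heq : riemannZeta₁ =ᶠ[𝓝 2] fun z ↦ z - (z - 1) * z * mellin fractTail (-z) := by
    filter_upwards [(isOpen_lt continuous_const continuous_re).mem_nhds
      (show (1 : ℝ) < (2 : ℂ).re by simp)] with z hz
    have hz1 : z ≠ 1 := fun h ↦ by simp [h] at hz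
    have hz1' : z - 1 ≠ 0 := sub_ne_zero.2 hz1
    have h := riemannZeta_eq_sub_mul_mellin_fractTail_of_one_lt_re hz
    rw [riemannZeta_eq_inv_sub_mul hz1, inv_mul_eq_iff_eq_mul₀ hz1'] at h
    rw [h]
    field_simp
  have h := (differentiable_riemannZeta₁.differentiableOn.analyticOnNhd hopen)
    |>.eqOn_of_preconnected_of_eventuallyEq (hdiff.analyticOnNhd hopen)
      (convex_halfSpace_re_gt 0).isPreconnected (by simp) heq hs
  have hs1' : s - 1 ≠ 0 := sub_ne_zero.2 hs1
  rw [riemannZeta_eq_inv_sub_mul hs1, h]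
  field_simp

/-- For every real `σ` with `0 < σ < 1`, `ζ(σ)` is a negative real number. -/
theorem zeta_neg_of_mem_unit_interval (σ : ℝ) (h0 : 0 < σ) (h1 : σ < 1) :
    ∃ r : ℝ, riemannZeta (σ : ℂ) = (r : ℂ) ∧ r < 0 := by
  refine ⟨σ / (σ - 1) - σ * ∫ t in Ioi (1 : ℝ), t ^ (-σ - 1) * Int.fract t, ?_, ?_⟩
  · rw [riemannZeta_eq_sub_mul_mellin_fractTail (by simpa using h0) (by exact_mod_cast h1.ne),
      ← ofReal_neg, mellin_fractTail_ofReal]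
    push_cast
    rfl
  · have hint : 0 ≤ ∫ t in Ioi (1 : ℝ), t ^ (-σ - 1) * Int.fract t :=
      setIntegral_nonneg measurableSet_Ioi fun t ht ↦
        mul_nonneg (Real.rpow_nonneg (zero_le_one.trans (le_of_lt ht)) _) (Int.fract_nonneg t)
    have hneg : σ / (σ - 1) < 0 := div_neg_of_pos_of_neg h0 (by linarith)
    have := mul_nonneg h0.le hint
    linarith
end
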